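/- arXiv:2509.22629 — 3 statements merged into one kernel-verified Lean document; each statement's English description precedes it below -/
import Mathlib

section
/- There exists a constant C > 0 such that for every k ≥ 1 and every graph H on k vertices, R_ind(H) ≤ 2^{Ck}; that is, there exists a graph G with at most 2^{Ck} vertices such that every 2-colouring of the edges of G contains a monochromatic induced copy of H. -/
open scoped Classical

/-- The edge-colouring `c` of the graph `G` admits a monochromatic induced copy of `H`:
there is a set `L` of vertices such that the induced subgraph `G[L]` is isomorphic to `H`
and all edges of `G[L]` receive the same colour. -/
def HasMonoInducedCopy {n k r : ℕ} (G : SimpleGraph (Fin n)) (H : SimpleGraph (Fin k))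
    (c : Sym2 (Fin n) → Fin r) : Prop :=
  ∃ (L : Finset (Fin n)) (j : Fin r),
    Nonempty (H ≃g G.induce (L : Set (Fin n))) ∧
    ∀ x ∈ L, ∀ y ∈ L, G.Adj x y → c s(x, y) = j

namespace InducedRamsey

open Finset

/-- Proportion of the elements of `A` satisfying `p`. -/
noncomputable def pr {Ω : Type*} (A : Finset Ω) (p : Ω → Prop) : ℝ :=
  ((A.filter p).card : ℝ) / A.card

section Proportion

variable {Ω κ K : Type*} [Fintype κ] [Fintype K]

lemma pr_nonneg (A : Finset Ω) (p : Ω → Prop) : 0 ≤ pr A p := by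
  unfold pr; positivity

lemma pr_le_one (A : Finset Ω) (p : Ω → Prop) : pr A p ≤ 1 := by
  unfold pr
  exact div_le_one_of_le₀ (by exact_mod_cast card_le_card (filter_subset _ _)) (by positivity)

lemma card_mul_pr (A : Finset Ω) (p : Ω → Prop) :
    (A.card : ℝ) * pr A p = (A.filter p).card := by
  unfold pr
  rcases A.eq_empty_or_nonempty with rfl | h
  · simp
  · have : (A.card : ℝ) ≠ 0 := by exact_mod_cast h.card_pos.ne'
    field_simp

lemma sum_card_fiber (A : Finset Ω) (g : Ω → κ) :
    ∑ s, ((A.filter (fun ω => g ω = s)).card : ℝ) = A.card := by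
  exact_mod_cast (card_eq_sum_card_fiberwise (f := g) (s := A) (t := univ) (by simp)).symm

lemma sum_pr_fiber {A : Finset Ω} (hA : A.Nonempty) (g : Ω → κ) :
    ∑ s, pr A (fun ω => g ω = s) = 1 := by
  have h : (A.card : ℝ) ≠ 0 := by exact_mod_cast hA.card_pos.ne'
  unfold pr
  rw [← sum_div, sum_card_fiber, div_self h]

lemma sum_pr_mul_pr_fiber (A : Finset Ω) (g : Ω → κ) (p : Ω → Prop) :
    ∑ s, pr A (fun ω => g ω = s) * pr (A.filter (fun ω => g ω = s)) p = pr A p := by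
  have h : ∀ s, pr A (fun ω => g ω = s) * pr (A.filter (fun ω => g ω = s)) p
      = (((A.filter p).filter (fun ω => g ω = s)).card : ℝ) / A.card := by
    intro s
    have := card_mul_pr (A.filter (fun ω => g ω = s)) p
    rw [filter_comm, ← this]
    unfold pr
    ring
  simp_rw [h]
  rw [← sum_div, sum_card_fiber, pr]

/-- Total squared mass of the laws of the random variables `X i` on `A`. -/
noncomputable def energy {ι : Type*} [Fintype ι] (X : ι → Ω → K) (A : Finset Ω) : ℝ :=
  ∑ i, ∑ c, pr A (fun ω => X i ω = c) ^ 2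

variable {ι : Type*} [Fintype ι]

lemma energy_nonneg (X : ι → Ω → K) (A : Finset Ω) : 0 ≤ energy X A :=
  sum_nonneg fun _ _ => sum_nonneg fun _ _ => sq_nonneg _

lemma energy_le (X : ι → Ω → K) {A : Finset Ω} (hA : A.Nonempty) :
    energy X A ≤ Fintype.card ι := by
  unfold energy
  calc _ ≤ ∑ _i : ι, (1 : ℝ) := by
        refine sum_le_sum fun i _ => ?_
        rw [← sum_pr_fiber hA (X i)]
        refine sum_le_sum fun c _ => ?_
        have h0 := pr_nonneg A (fun ω => X i ω = c)
        have h1 := pr_le_one A (fun ω => X i ω = c)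
        nlinarith
    _ = _ := by simp

lemma sum_pr_mul_sq_sub {A : Finset Ω} (hA : A.Nonempty) (g : Ω → κ) (p : Ω → Prop) :
    ∑ s, pr A (fun ω => g ω = s) * (pr (A.filter (fun ω => g ω = s)) p - pr A p) ^ 2
      = ∑ s, pr A (fun ω => g ω = s) * pr (A.filter (fun ω => g ω = s)) p ^ 2 - pr A p ^ 2 := by
  have h1 := sum_pr_fiber hA g
  have h2 := sum_pr_mul_pr_fiber A g p
  calc _ = ∑ s, (pr A (fun ω => g ω = s) * pr (A.filter (fun ω => g ω = s)) p ^ 2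
        - 2 * pr A p * (pr A (fun ω => g ω = s) * pr (A.filter (fun ω => g ω = s)) p)
        + pr A p ^ 2 * pr A (fun ω => g ω = s)) := by
        refine sum_congr rfl fun s _ => ?_
        ring
    _ = _ := by
        rw [sum_add_distrib, sum_sub_distrib, ← mul_sum, ← mul_sum, h1, h2]
        ring

lemma sum_energy_increment (X : ι → Ω → K) {A : Finset Ω} (hA : A.Nonempty) (g : Ω → κ) :
    ∑ s, pr A (fun ω => g ω = s) * ∑ i, ∑ c,
      (pr (A.filter (fun ω => g ω = s)) (fun ω => X i ω = c) - pr A (fun ω => X i ω = c)) ^ 2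
      = ∑ s, pr A (fun ω => g ω = s) *
        (energy X (A.filter (fun ω => g ω = s)) - energy X A) := by
  have h1 := sum_pr_fiber hA g
  simp_rw [mul_sub, sum_sub_distrib]
  rw [← sum_mul, h1, one_mul]
  unfold energy
  simp_rw [mul_sum]
  rw [sum_comm, sum_comm (s := univ (α := κ)), ← sum_sub_distrib]
  refine sum_congr rfl fun i _ => ?_
  rw [sum_comm, sum_comm (s := univ (α := κ)), ← sum_sub_distrib]
  exact sum_congr rfl fun c _ => sum_pr_mul_sq_sub hA g _

/-- Concavity of the logarithm, in the form `H(g) ≤ log |κ|`. -/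
lemma sum_pr_mul_log_le {A : Finset Ω} (hA : A.Nonempty) (g : Ω → κ) :
    ∑ s, pr A (fun ω => g ω = s) *
      (Real.log A.card - Real.log (A.filter (fun ω => g ω = s)).card)
      ≤ Real.log (Fintype.card κ) := by
  have h1 := sum_pr_fiber hA g
  have hA0 : (0 : ℝ) < A.card := by exact_mod_cast hA.card_pos
  obtain ⟨a, -⟩ := hA
  have hn : (0 : ℝ) < Fintype.card κ := by
    exact_mod_cast Fintype.card_pos_iff.2 ⟨g a⟩
  set n : ℝ := (Fintype.card κ : ℝ) with hn'
  have key : ∀ s, pr A (fun ω => g ω = s) *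
      (Real.log A.card - Real.log (A.filter (fun ω => g ω = s)).card)
      ≤ pr A (fun ω => g ω = s) * Real.log n + (1 / n - pr A (fun ω => g ω = s)) := by
    intro s
    rcases (A.filter (fun ω => g ω = s)).eq_empty_or_nonempty with h | h
    · simp [pr, h]
      positivity
    · have hB : (0 : ℝ) < (A.filter (fun ω => g ω = s)).card := by exact_mod_cast h.card_pos
      set b : ℝ := ((A.filter (fun ω => g ω = s)).card : ℝ) with hb
      set P := pr A (fun ω => g ω = s) with hP
      have hPb : P = b / A.card := rfl
      have hP0 : 0 < P := by rw [hPb]; positivity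
      have hl := Real.log_le_sub_one_of_pos (x := 1 / (P * n)) (by positivity)
      have e : Real.log (1 / (P * n)) = Real.log A.card - Real.log b - Real.log n := by
        rw [one_div, Real.log_inv, Real.log_mul hP0.ne' hn.ne', hPb,
          Real.log_div hB.ne' hA0.ne']
        ring
      rw [e] at hl
      have := mul_le_mul_of_nonneg_left hl hP0.le
      have e2 : P * (1 / (P * n) - 1) = 1 / n - P := by field_simp
      rw [e2] at this
      linarith
  refine (sum_le_sum fun s _ => key s).trans ?_
  rw [sum_add_distrib, sum_sub_distrib, ← sum_mul, h1]
  simp only [sum_const, card_univ, nsmul_eq_mul, ← hn']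
  rw [mul_one_div_cancel hn.ne']
  linarith

/-- There is a dense set of outcomes on which observing a random variable with few values hardly
changes the laws of the `X i`, in mean square. -/
theorem exists_stable [Fintype Ω] [Nonempty Ω] (X : ι → Ω → K) {l : ℝ} (hl : 0 < l) :
    ∃ A : Finset Ω, A.Nonempty ∧
      Real.log (Fintype.card Ω) - Real.log A.card ≤ Fintype.card ι / l ∧
      ∀ (κ : Type) [Fintype κ] (g : Ω → κ),
        ∑ s, pr A (fun ω => g ω = s) * ∑ i, ∑ c,
          (pr (A.filter (fun ω => g ω = s)) (fun ω => X i ω = c)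
            - pr A (fun ω => X i ω = c)) ^ 2 ≤ l * Real.log (Fintype.card κ) := by
  obtain ⟨A, hA, hmax⟩ := (univ.filter fun A : Finset Ω => A.Nonempty).exists_max_image
    (fun A => energy X A + l * Real.log A.card) ⟨univ, by simp⟩
  simp only [mem_filter, mem_univ, true_and] at hA hmax
  refine ⟨A, hA, ?_, fun κ _ g => ?_⟩
  · have h := hmax univ univ_nonempty
    have h1 := energy_nonneg X (univ : Finset Ω)
    have h2 := energy_le X hA
    rw [card_univ] at h
    rw [le_div_iff₀ hl]
    linarith
  · rw [sum_energy_increment X hA g]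
    calc _ ≤ ∑ s, pr A (fun ω => g ω = s) *
        (l * (Real.log A.card - Real.log (A.filter (fun ω => g ω = s)).card)) := by
          refine sum_le_sum fun s _ => ?_
          rcases (A.filter (fun ω => g ω = s)).eq_empty_or_nonempty with h | h
          · simp [pr, h]
          · refine mul_le_mul_of_nonneg_left ?_ (pr_nonneg _ _)
            have := hmax _ h
            linarith
      _ = l * ∑ s, pr A (fun ω => g ω = s) *
        (Real.log A.card - Real.log (A.filter (fun ω => g ω = s)).card) := by
          rw [mul_sum]
          exact sum_congr rfl fun s _ => by ring
      _ ≤ _ := mul_le_mul_of_nonneg_left (sum_pr_mul_log_le hA g) hl.le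

end Proportion

section Resampling

variable {I K : Type*} [Fintype I] [DecidableEq I] [Fintype K]

/-- Resampling one coordinate of a product distribution does not change expectations. -/
lemma sum_prod_mul_resample (q : I → K → ℝ) (i : I) (hq : ∑ c, q i c = 1)
    (φ : (I → K) → ℝ) :
    ∑ y : I → K, (∏ j, q j (y j)) * ∑ c, q i c * φ (Function.update y i c)
      = ∑ y : I → K, (∏ j, q j (y j)) * φ y := by
  let e : (I → K) × K ≃ (I → K) × K :=
    { toFun := fun p => (Function.update p.1 i p.2, p.1 i)
      invFun := fun p => (Function.update p.1 i p.2, p.1 i)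
      left_inv := fun p => by simp
      right_inv := fun p => by simp }
  have hw : ∀ (y : I → K) (c : K), (∏ j, q j (y j)) * q i c
      = (∏ j, q j (Function.update y i c j)) * q i (y i) := by
    intro y c
    rw [← mul_prod_erase univ _ (mem_univ i),
      ← mul_prod_erase univ (fun j => q j (Function.update y i c j)) (mem_univ i)]
    have : ∏ j ∈ univ.erase i, q j (Function.update y i c j) = ∏ j ∈ univ.erase i, q j (y j) :=
      prod_congr rfl fun j hj => by rw [Function.update_of_ne (ne_of_mem_erase hj)]
    rw [this, Function.update_self]
    ring
  calc _ = ∑ p : (I → K) × K, (∏ j, q j (Function.update p.1 i p.2 j)) * q i (p.1 i)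
        * φ (Function.update p.1 i p.2) := by
        rw [Fintype.sum_prod_type]
        refine sum_congr rfl fun y _ => ?_
        rw [mul_sum]
        exact sum_congr rfl fun c _ => by rw [← hw]; ring
    _ = ∑ p : (I → K) × K, (∏ j, q j (p.1 j)) * q i p.2 * φ p.1 :=
        Equiv.sum_comp e (fun p : (I → K) × K => (∏ j, q j (p.1 j)) * q i p.2 * φ p.1)
    _ = _ := by
        rw [Fintype.sum_prod_type]
        refine sum_congr rfl fun y _ => ?_
        dsimp only
        rw [← sum_mul, ← mul_sum, hq, mul_one]

lemma sum_prod_eq_one (q : I → K → ℝ) (hq : ∀ i, ∑ c, q i c = 1) :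
    ∑ y : I → K, ∏ j, q j (y j) = 1 := by
  have := prod_univ_sum (fun _ : I => (univ : Finset K)) q
  rw [Fintype.piFinset_univ] at this
  rw [← this]
  simp [hq]

lemma sum_resample_uniform [Nonempty K] (i : I) (φ : (I → K) → ℝ) :
    ∑ y : I → K, ∑ c, φ (Function.update y i c) = Fintype.card K * ∑ y : I → K, φ y := by
  have hK : (Fintype.card K : ℝ) ≠ 0 := by exact_mod_cast Fintype.card_ne_zero
  have h := sum_prod_mul_resample (fun (_ : I) (_ : K) => ((Fintype.card K : ℝ))⁻¹) i
    (by simp [hK]) φ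
  simp only [← mul_sum] at h
  have hp : (∏ _j : I, ((Fintype.card K : ℝ))⁻¹) ≠ 0 := by
    simp [prod_const, hK]
  have h2 := mul_left_cancel₀ hp h
  rw [← h2]
  field_simp

variable {Ω κ : Type*} [Fintype κ]

/-- How much observing `g` changes the law of `X`, on average. -/
noncomputable def influence (A : Finset Ω) (X : Ω → K) (g : Ω → κ) : ℝ :=
  ∑ s, pr A (fun ω => g ω = s) * ∑ c,
    |pr (A.filter (fun ω => g ω = s)) (fun ω => X ω = c) - pr A (fun ω => X ω = c)|

omit [Fintype I] in
lemma sum_resample_le (A : Finset Ω) (Y : I → Ω → K) (i : I) (g : Ω → κ)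
    (hg : ∀ ω ω', g ω = g ω' → ∀ j, j ≠ i → Y j ω = Y j ω')
    (φ : (I → K) → ℝ) (h0 : ∀ y, 0 ≤ φ y) (h1 : ∀ y, φ y ≤ 1) :
    ∑ ω ∈ A, ∑ c, pr A (fun ω => Y i ω = c) * φ (Function.update (fun j => Y j ω) i c)
      ≤ ∑ ω ∈ A, φ (fun j => Y j ω) + A.card * influence A (Y i) g := by
  have hfib : ∀ F : Ω → ℝ, ∑ ω ∈ A, F ω = ∑ s, ∑ ω ∈ A.filter (fun ω => g ω = s), F ω :=
    fun F => (sum_fiberwise A g F).symm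
  rw [hfib, hfib (fun ω => φ (fun j => Y j ω)), influence, mul_sum, ← sum_add_distrib]
  refine sum_le_sum fun s _ => ?_
  rw [← mul_assoc, card_mul_pr]
  set B := A.filter (fun ω => g ω = s) with hB
  rcases B.eq_empty_or_nonempty with h | ⟨ω₀, hω₀⟩
  · simp [h]
  have hgs : ∀ ω ∈ B, g ω = s := fun ω hω => (mem_filter.1 hω).2
  have hupd : ∀ ω ∈ B, ∀ c, Function.update (fun j => Y j ω) i c
      = Function.update (fun j => Y j ω₀) i c := by
    intro ω hω c
    funext j
    by_cases hj : j = i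
    · subst hj; simp
    · simp only [Function.update_of_ne hj]
      exact hg ω ω₀ ((hgs ω hω).trans (hgs ω₀ hω₀).symm) j hj
  set f : K → ℝ := fun c => φ (Function.update (fun j => Y j ω₀) i c) with hf
  have e1 : ∑ ω ∈ B, ∑ c, pr A (fun ω => Y i ω = c) * φ (Function.update (fun j => Y j ω) i c)
      = B.card * ∑ c, pr A (fun ω => Y i ω = c) * f c := by
    rw [← nsmul_eq_mul, ← sum_const]
    refine sum_congr rfl fun ω hω => sum_congr rfl fun c _ => ?_
    rw [hupd ω hω c]
  have e2 : ∑ ω ∈ B, φ (fun j => Y j ω) = B.card * ∑ c, pr B (fun ω => Y i ω = c) * f c := by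
    have : ∀ ω ∈ B, φ (fun j => Y j ω) = f (Y i ω) := by
      intro ω hω
      rw [hf]
      simp only
      rw [← hupd ω hω, Function.update_eq_self]
    rw [sum_congr rfl this, ← sum_fiberwise B (Y i), mul_sum]
    refine sum_congr rfl fun c _ => ?_
    rw [← mul_assoc, card_mul_pr, ← nsmul_eq_mul, ← sum_const]
    refine sum_congr rfl fun ω hω => ?_
    rw [(mem_filter.1 hω).2]
  rw [e1, e2, ← mul_add, ← sum_add_distrib]
  refine mul_le_mul_of_nonneg_left (sum_le_sum fun c _ => ?_) (by positivity)
  have hf0 : 0 ≤ f c := h0 _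
  have hf1 : f c ≤ 1 := h1 _
  set a := pr A (fun ω => Y i ω = c)
  set b := pr B (fun ω => Y i ω = c)
  have : (a - b) * f c ≤ |b - a| := by
    calc (a - b) * f c ≤ |a - b| * f c := mul_le_mul_of_nonneg_right (le_abs_self _) hf0
      _ ≤ |a - b| * 1 := mul_le_mul_of_nonneg_left hf1 (abs_nonneg _)
      _ = |b - a| := by rw [mul_one, abs_sub_comm]
  linarith

/-- If each variable is hardly influenced by the others, then the joint law is close to the
product of the marginals. -/
theorem product_law_le {A : Finset Ω} (hA : A.Nonempty) (Y : I → Ω → K) (g : I → Ω → κ)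
    (hg : ∀ i ω ω', g i ω = g i ω' → ∀ j, j ≠ i → Y j ω = Y j ω')
    (φ : (I → K) → ℝ) (h0 : ∀ y, 0 ≤ φ y) (h1 : ∀ y, φ y ≤ 1) :
    A.card * ∑ y : I → K, (∏ i, pr A (fun ω => Y i ω = y i)) * φ y
      ≤ ∑ ω ∈ A, φ (fun j => Y j ω) + A.card * ∑ i, influence A (Y i) (g i) := by
  set q : I → K → ℝ := fun i c => pr A (fun ω => Y i ω = c) with hqdef
  have hq : ∀ i, ∑ c, q i c = 1 := fun i => sum_pr_fiber hA (Y i)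
  have hq0 : ∀ i c, 0 ≤ q i c := fun i c => pr_nonneg _ _
  have main : ∀ T : Finset I, ∃ ψ : (I → K) → ℝ, (∀ y, 0 ≤ ψ y) ∧ (∀ y, ψ y ≤ 1) ∧
      (∀ y y', (∀ j, j ∉ T → y j = y' j) → ψ y = ψ y') ∧
      ∑ y : I → K, (∏ i, q i (y i)) * ψ y = ∑ y : I → K, (∏ i, q i (y i)) * φ y ∧
      ∑ ω ∈ A, ψ (fun j => Y j ω)
        ≤ ∑ ω ∈ A, φ (fun j => Y j ω) + A.card * ∑ i ∈ T, influence A (Y i) (g i) := by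
    intro T
    induction T using Finset.induction_on with
    | empty =>
      refine ⟨φ, h0, h1, fun y y' h => ?_, rfl, by simp⟩
      rw [funext fun j => h j (notMem_empty j)]
    | insert i T hi ih =>
      obtain ⟨ψ, hψ0, hψ1, hψd, hψs, hψA⟩ := ih
      refine ⟨fun y => ∑ c, q i c * ψ (Function.update y i c), fun y => ?_, fun y => ?_, ?_, ?_, ?_⟩
      · exact sum_nonneg fun c _ => mul_nonneg (hq0 i c) (hψ0 _)
      · rw [← hq i]
        exact sum_le_sum fun c _ => mul_le_of_le_one_right (hq0 i c) (hψ1 _)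
      · intro y y' h
        refine sum_congr rfl fun c _ => ?_
        rw [hψd (Function.update y i c) (Function.update y' i c)]
        intro j hj
        by_cases hji : j = i
        · subst hji; simp
        · simp only [Function.update_of_ne hji]
          exact h j (by simp [hji, hj])
      · rw [sum_prod_mul_resample q i (hq i), hψs]
      · refine (sum_resample_le A Y i (g i) (hg i) ψ hψ0 hψ1).trans ?_
        rw [sum_insert hi, mul_add]
        linarith
  obtain ⟨ψ, -, -, hψd, hψs, hψA⟩ := main univ
  obtain ⟨ω₀, hω₀⟩ := hA
  have hc : ∀ y, ψ y = ψ (fun j => Y j ω₀) := fun y => hψd _ _ fun j hj => absurd (mem_univ j) hj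
  have e : ∑ y : I → K, (∏ i, q i (y i)) * ψ y = ψ (fun j => Y j ω₀) := by
    simp_rw [hc]
    rw [← sum_mul, sum_prod_eq_one q hq, one_mul]
  rw [← hψs, e]
  refine le_trans (le_of_eq ?_) hψA
  rw [sum_congr rfl fun ω _ => hc (fun j => Y j ω), sum_const, nsmul_eq_mul]

lemma influence_le (A : Finset Ω) (hA : A.Nonempty) (X : Ω → K) (g : Ω → κ) {b : ℝ} (hb : 0 < b) :
    influence A X g ≤ (∑ s, pr A (fun ω => g ω = s) * ∑ c,
      (pr (A.filter (fun ω => g ω = s)) (fun ω => X ω = c) - pr A (fun ω => X ω = c)) ^ 2) / b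
      + Fintype.card K * b := by
  have hs := sum_pr_fiber hA g
  have : ∀ t : ℝ, |t| ≤ t ^ 2 / b + b := by
    intro t
    rw [← sq_abs, ← sub_nonneg]
    have : |t| ^ 2 / b + b - |t| = ((|t| - b / 2) ^ 2 + 3 / 4 * b ^ 2) / b := by
      field_simp; ring
    rw [this]
    positivity
  calc influence A X g ≤ ∑ s, pr A (fun ω => g ω = s) * ((∑ c,
      (pr (A.filter (fun ω => g ω = s)) (fun ω => X ω = c) - pr A (fun ω => X ω = c)) ^ 2) / b
        + Fintype.card K * b) := by
        refine sum_le_sum fun s _ => mul_le_mul_of_nonneg_left ?_ (pr_nonneg _ _)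
        refine (sum_le_sum fun c _ => this _).trans ?_
        rw [sum_add_distrib, sum_div]
        simp
    _ = _ := by
        simp_rw [mul_add]
        rw [sum_add_distrib, ← sum_mul, hs, one_mul, sum_div]
        simp_rw [mul_div_assoc]

lemma influence_of_const {A : Finset Ω} {X : Ω → K} {k₀ : K} (hX : ∀ ω, X ω = k₀) (g : Ω → κ) :
    influence A X g = 0 := by
  refine sum_eq_zero fun s _ => ?_
  rcases (A.filter (fun ω => g ω = s)).eq_empty_or_nonempty with h | h
  · simp [pr, h]
  · refine mul_eq_zero_of_right _ (sum_eq_zero fun c _ => ?_)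
    have hA : A.Nonempty := h.mono (filter_subset _ _)
    have e1 : ((A.filter (fun ω => g ω = s)).card : ℝ) ≠ 0 := by exact_mod_cast h.card_pos.ne'
    have e2 : (A.card : ℝ) ≠ 0 := by exact_mod_cast hA.card_pos.ne'
    by_cases hc : k₀ = c
    · simp [pr, hX, hc, e1, e2]
    · simp [pr, hX, hc]

end Resampling

section Bias

/-- A large set of bit strings has few biased coordinates. -/
theorem sum_abs_bias_le {J : Type*} [Fintype J] [DecidableEq J] {A : Finset (J → Bool)}
    (hA : A.Nonempty) {t : ℝ} (ht : 0 < t) :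
    ∑ j, |2 * pr A (fun ω => ω j = true) - 1|
      ≤ (Real.log (Fintype.card (J → Bool)) - Real.log A.card) / t + t * Fintype.card J / 2 := by
  have hA0 : (0 : ℝ) < A.card := by exact_mod_cast hA.card_pos
  set d : J → ℝ := fun j => 2 * pr A (fun ω => ω j = true) - 1 with hd
  obtain ⟨ε, hε, hεd⟩ : ∃ ε : J → ℝ, (∀ j, ε j = 1 ∨ ε j = -1) ∧ ∀ j, ε j * d j = |d j| := by
    refine ⟨fun j => if 0 ≤ d j then 1 else -1, fun j => ?_, fun j => ?_⟩
    · dsimp only; split_ifs <;> simp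
    · dsimp only
      split_ifs with h
      · rw [abs_of_nonneg h, one_mul]
      · rw [abs_of_neg (not_le.1 h)]; ring
  let σ : Bool → ℝ := fun b => if b = true then 1 else -1
  have hσ : ∀ j, ∑ ω ∈ A, σ (ω j) = A.card * d j := by
    intro j
    have h1 : ∀ ω : J → Bool, σ (ω j) = 2 * (if ω j = true then 1 else 0) - 1 := by
      intro ω; dsimp only [σ]; split_ifs <;> norm_num
    have h2 : ∑ ω ∈ A, (if ω j = true then (1 : ℝ) else 0)
        = A.card * pr A (fun ω => ω j = true) := by
      rw [card_mul_pr, sum_boole]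
      congr!
    simp_rw [h1]
    rw [sum_sub_distrib, ← mul_sum, h2]
    simp only [sum_const, nsmul_eq_mul, hd]
    ring
  set S : (J → Bool) → ℝ := fun ω => ∑ j, ε j * σ (ω j) with hS
  have hSA : ∑ ω ∈ A, S ω = A.card * ∑ j, |d j| := by
    rw [hS, sum_comm, mul_sum]
    refine sum_congr rfl fun j _ => ?_
    rw [← mul_sum, hσ, ← hεd]
    ring
  set m : ℝ := t * ∑ j, |d j| with hm
  have lower : A.card * Real.exp m ≤ ∑ ω ∈ A, Real.exp (t * S ω) := by
    have h1 : ∀ ω, Real.exp m * (1 + t * S ω - m) ≤ Real.exp (t * S ω) := by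
      intro ω
      have h2 : Real.exp (t * S ω) = Real.exp m * Real.exp (t * S ω - m) := by
        rw [← Real.exp_add]; congr 1; ring
      rw [h2]
      refine mul_le_mul_of_nonneg_left ?_ (Real.exp_pos _).le
      linarith [Real.add_one_le_exp (t * S ω - m)]
    refine le_trans (le_of_eq ?_) (sum_le_sum fun ω _ => h1 ω)
    rw [← mul_sum, sum_sub_distrib, sum_add_distrib, ← mul_sum, hSA]
    simp only [sum_const, nsmul_eq_mul, hm]
    ring
  have upper : ∑ ω : J → Bool, Real.exp (t * S ω)
      ≤ Fintype.card (J → Bool) * Real.exp (t ^ 2 * Fintype.card J / 2) := by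
    have h1 : ∀ ω : J → Bool, Real.exp (t * S ω) = ∏ j, Real.exp (t * (ε j * σ (ω j))) := by
      intro ω
      rw [← Real.exp_sum, hS, mul_sum]
    simp_rw [h1]
    have h2 := prod_univ_sum (fun _ : J => (univ : Finset Bool))
      (fun j b => Real.exp (t * (ε j * σ b)))
    rw [Fintype.piFinset_univ] at h2
    rw [← h2]
    have h3 : ∀ j, ∑ b, Real.exp (t * (ε j * σ b)) = 2 * Real.cosh t := by
      intro j
      rw [Real.cosh_eq, Fintype.sum_bool]
      rcases hε j with h | h <;> simp [h, σ] <;> ring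
    simp_rw [h3]
    rw [prod_const, card_univ, mul_pow, Fintype.card_fun, Fintype.card_bool]
    push_cast
    refine mul_le_mul_of_nonneg_left ?_ (by positivity)
    refine (pow_le_pow_left₀ (Real.cosh_pos t).le (Real.cosh_le_exp_half_sq t) _).trans ?_
    rw [← Real.exp_nat_mul]
    exact Real.exp_le_exp.2 (le_of_eq (by ring))
  have hle := lower.trans ((sum_le_sum_of_subset_of_nonneg (subset_univ A)
    fun ω _ _ => (Real.exp_pos _).le).trans upper)
  have hΩ : (0 : ℝ) < Fintype.card (J → Bool) := by exact_mod_cast Fintype.card_pos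
  have hlog := Real.log_le_log (by positivity) hle
  rw [Real.log_mul hA0.ne' (Real.exp_ne_zero _), Real.log_mul hΩ.ne' (Real.exp_ne_zero _),
    Real.log_exp, Real.log_exp] at hlog
  rw [div_add' _ _ _ ht.ne', le_div_iff₀ ht]
  linarith

end Bias

section SecondMoment

variable {I K : Type*} [Fintype I] [DecidableEq I] [Fintype K] [DecidableEq K]

lemma sum_prod_mul_boole (q : I → K → ℝ) (hq : ∀ i, ∑ c, q i c = 1) (E : Finset I) (t : I → K) :
    ∑ y : I → K, (∏ i, q i (y i)) * (if ∀ e ∈ E, y e = t e then 1 else 0)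
      = ∏ e ∈ E, q e (t e) := by
  have h1 : ∀ y : I → K, (∏ i, q i (y i)) * (if ∀ e ∈ E, y e = t e then (1 : ℝ) else 0)
      = ∏ i, (q i (y i) * if i ∈ E → y i = t i then 1 else 0) := by
    intro y
    rw [prod_mul_distrib, prod_boole]
    simp
  simp_rw [h1]
  have h2 := prod_univ_sum (fun _ : I => (univ : Finset K))
    (fun i c => q i c * if i ∈ E → c = t i then (1 : ℝ) else 0)
  rw [Fintype.piFinset_univ] at h2
  rw [← h2, ← prod_subset (subset_univ E)]
  · refine prod_congr rfl fun e he => ?_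
    simp [he]
  · intro i _ hi
    simp [hi, hq]

/-- Second moment method for the existence of a match between a random string, chosen according
to a product distribution, and one of a family of partial strings. -/
theorem second_moment {ρ : Type*} [Fintype ρ] [Nonempty ρ] (q : I → K → ℝ)
    (hq0 : ∀ i c, 0 ≤ q i c) (hq : ∀ i, ∑ c, q i c = 1) (E : ρ → Finset I) (t : ρ → I → K)
    {b : ℝ} (hb : 1 ≤ b) (ht : ∀ r, ∀ e ∈ E r, 1 / b ≤ q e (t r e)) :
    2 - (∑ r, ∑ r', b ^ (E r ∩ E r').card) / (Fintype.card ρ : ℝ) ^ 2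
      ≤ ∑ y : I → K, (∏ i, q i (y i)) * (if ∃ r, ∀ e ∈ E r, y e = t r e then 1 else 0) := by
  set w : (I → K) → ℝ := fun y => ∏ i, q i (y i) with hw
  have hw0 : ∀ y, 0 ≤ w y := fun y => prod_nonneg fun i _ => hq0 _ _
  have hw1 : ∑ y, w y = 1 := sum_prod_eq_one q hq
  set n : ℝ := (Fintype.card ρ : ℝ) with hn
  have hn0 : 0 < n := by rw [hn]; exact_mod_cast Fintype.card_pos
  set p : ρ → ℝ := fun r => ∏ e ∈ E r, q e (t r e) with hp
  have hb0 : 0 < 1 / b := by positivity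
  have hp0 : ∀ r, 0 < p r := fun r => prod_pos fun e he => hb0.trans_le (ht r e he)
  set M : ρ → (I → K) → ℝ := fun r y => if ∀ e ∈ E r, y e = t r e then 1 else 0 with hM
  set Z : (I → K) → ℝ := fun y => (∑ r, M r y / p r) / n with hZ
  have hM1 : ∀ r, ∑ y, w y * M r y = p r := fun r => sum_prod_mul_boole q hq (E r) (t r)
  have hEZ : ∑ y, w y * Z y = 1 := by
    simp_rw [hZ, mul_div_assoc', mul_sum]
    rw [← sum_div, sum_comm]
    have : ∀ r, ∑ y, w y * (M r y / p r) = 1 := by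
      intro r
      simp_rw [mul_div_assoc']
      rw [← sum_div, hM1, div_self (hp0 r).ne']
    simp only [← mul_div_assoc] at this ⊢
    simp_rw [this]
    simp only [sum_const, card_univ, nsmul_eq_mul, ← hn, mul_one]
    exact div_self hn0.ne'
  have hMM : ∀ r r', ∑ y, w y * (M r y * M r' y) ≤ p r * p r' * b ^ (E r ∩ E r').card := by
    intro r r'
    have h1 : ∑ y, w y * (M r y * M r' y)
        ≤ ∑ y, w y * (if ∀ e ∈ E r ∪ E r', y e = (if e ∈ E r then t r e else t r' e)
            then 1 else 0) := by
      refine sum_le_sum fun y _ => mul_le_mul_of_nonneg_left ?_ (hw0 y)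
      by_cases hr : ∀ e ∈ E r, y e = t r e
      · by_cases hr' : ∀ e ∈ E r', y e = t r' e
        · have : ∀ e ∈ E r ∪ E r', y e = (if e ∈ E r then t r e else t r' e) := by
            intro e he
            split_ifs with h
            · exact hr e h
            · exact hr' e ((mem_union.1 he).resolve_left h)
          rw [if_pos this]
          simp only [hM, if_pos hr, if_pos hr', mul_one, le_refl]
        · simp only [hM, hr', if_false, mul_zero]
          split_ifs <;> norm_num
      · simp only [hM, hr, if_false, zero_mul]
        split_ifs <;> norm_num
    refine h1.trans ?_
    rw [sum_prod_mul_boole q hq, ← union_sdiff_self_eq_union, prod_union disjoint_sdiff]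
    have e1 : ∏ e ∈ E r, q e (if e ∈ E r then t r e else t r' e) = p r :=
      prod_congr rfl fun e he => by rw [if_pos he]
    have e2 : ∏ e ∈ E r' \ E r, q e (if e ∈ E r then t r e else t r' e)
        = ∏ e ∈ E r' \ E r, q e (t r' e) :=
      prod_congr rfl fun e he => by rw [if_neg (mem_sdiff.1 he).2]
    have e3 : p r' = (∏ e ∈ E r' \ E r, q e (t r' e)) * ∏ e ∈ E r ∩ E r', q e (t r' e) := by
      rw [mul_comm, inter_comm]
      exact (prod_inter_mul_prod_sdiff (E r') (E r) _).symm
    have e4 : 1 ≤ (∏ e ∈ E r ∩ E r', q e (t r' e)) * b ^ (E r ∩ E r').card := by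
      rw [← prod_const, ← prod_mul_distrib]
      refine one_le_prod fun e he => ?_
      have := ht r' e (mem_inter.1 he).2
      rw [div_le_iff₀ (by positivity)] at this
      exact this
    rw [e1, e2, mul_assoc]
    refine mul_le_mul_of_nonneg_left ?_ (hp0 r).le
    rw [e3, mul_assoc]
    exact le_mul_of_one_le_right (prod_nonneg fun e _ => hq0 _ _) e4
  have hEZ2 : ∑ y, w y * Z y ^ 2 ≤ (∑ r, ∑ r', b ^ (E r ∩ E r').card) / n ^ 2 := by
    have h1 : ∀ y, w y * Z y ^ 2
        = (∑ r, ∑ r', w y * (M r y * M r' y) / (p r * p r')) / n ^ 2 := by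
      intro y
      rw [hZ, div_pow, sq (∑ r, _), sum_mul_sum, ← mul_div_assoc, mul_sum]
      congr 1
      refine sum_congr rfl fun r _ => ?_
      rw [mul_sum]
      refine sum_congr rfl fun r' _ => ?_
      rw [div_mul_div_comm, mul_div_assoc']
    simp_rw [h1]
    rw [← sum_div, sum_comm]
    refine div_le_div_of_nonneg_right (sum_le_sum fun r _ => ?_) (by positivity)
    rw [sum_comm]
    refine sum_le_sum fun r' _ => ?_
    rw [← sum_div, div_le_iff₀ (mul_pos (hp0 r) (hp0 r'))]
    linarith [hMM r r']
  have hpt : ∀ y, w y * (2 * Z y - Z y ^ 2)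
      ≤ w y * (if ∃ r, ∀ e ∈ E r, y e = t r e then 1 else 0) := by
    intro y
    refine mul_le_mul_of_nonneg_left ?_ (hw0 y)
    split_ifs with h
    · nlinarith [sq_nonneg (Z y - 1)]
    · push Not at h
      have : Z y = 0 := by
        rw [hZ]
        dsimp only
        rw [sum_eq_zero, zero_div]
        intro r _
        obtain ⟨e, he, hne⟩ := h r
        have : ¬ ∀ e ∈ E r, y e = t r e := fun h' => hne (h' e he)
        simp [hM, this]
      simp [this]
  refine le_trans ?_ (sum_le_sum fun y _ => hpt y)
  have : ∑ y, w y * (2 * Z y - Z y ^ 2) = 2 * ∑ y, w y * Z y - ∑ y, w y * Z y ^ 2 := by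
    rw [mul_sum, ← sum_sub_distrib]
    exact sum_congr rfl fun y _ => by ring
  rw [this, hEZ]
  linarith

end SecondMoment

section Ramsey

lemma exists_mono_of_two_pow_le {α : Type*} (f : Sym2 α → Fin 2) (n : ℕ) :
    ∀ (a b : ℕ) (S : Finset α), a + b = n → 2 ^ n ≤ S.card →
      (∃ T ⊆ S, T.card = a ∧ ∀ x ∈ T, ∀ y ∈ T, x ≠ y → f s(x, y) = 0) ∨
      (∃ T ⊆ S, T.card = b ∧ ∀ x ∈ T, ∀ y ∈ T, x ≠ y → f s(x, y) = 1) := by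
  have extend : ∀ (S U : Finset α) (v : α) (c : Fin 2) (a : ℕ), v ∈ S →
      U ⊆ (S.erase v).filter (fun y => f s(v, y) = c) → U.card = a →
      (∀ x ∈ U, ∀ y ∈ U, x ≠ y → f s(x, y) = c) →
      ∃ T ⊆ S, T.card = a + 1 ∧ ∀ x ∈ T, ∀ y ∈ T, x ≠ y → f s(x, y) = c := by
    intro S U v c a hv hU hc hf
    have hUv : ∀ y ∈ U, y ≠ v ∧ y ∈ S ∧ f s(v, y) = c := fun y hy => by
      simpa [and_assoc] using hU hy
    refine ⟨insert v U, insert_subset hv fun y hy => (hUv y hy).2.1, ?_, ?_⟩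
    · rw [card_insert_of_notMem fun h => (hUv v h).1 rfl, hc]
    · intro x hx y hy hxy
      rcases mem_insert.1 hx with rfl | hx
      · exact (hUv y ((mem_insert.1 hy).resolve_left (Ne.symm hxy))).2.2
      · rcases mem_insert.1 hy with hy | hy
        · rw [hy, Sym2.eq_swap]
          exact (hUv x hx).2.2
        · exact hf x hx y hy hxy
  induction n with
  | zero =>
    intro a b S hab _
    exact Or.inl ⟨∅, empty_subset _, by simp; omega, by simp⟩
  | succ n ih =>
    intro a b S hab hS
    rcases a with _ | a
    · exact Or.inl ⟨∅, empty_subset _, by simp, by simp⟩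
    rcases b with _ | b
    · exact Or.inr ⟨∅, empty_subset _, by simp, by simp⟩
    obtain ⟨v, hv⟩ : S.Nonempty := card_pos.1 (lt_of_lt_of_le (by positivity) hS)
    have hcard : ((S.erase v).filter fun y => f s(v, y) = 0).card
        + ((S.erase v).filter fun y => f s(v, y) = 1).card = S.card - 1 := by
      rw [← card_erase_of_mem hv,
        ← card_filter_add_card_filter_not (s := S.erase v) (fun y => f s(v, y) = 0)]
      congr 2
      refine filter_congr fun y _ => ?_
      constructor <;> intro h <;> omega
    have hpow : 2 ^ (n + 1) = 2 ^ n + 2 ^ n := by ring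
    by_cases h0 : 2 ^ n ≤ ((S.erase v).filter fun y => f s(v, y) = 0).card
    · rcases ih a (b + 1) _ (by omega) h0 with ⟨U, hU, hc, hf⟩ | ⟨U, hU, hc, hf⟩
      · exact Or.inl (extend S U v 0 a hv hU hc hf)
      · exact Or.inr ⟨U, hU.trans ((filter_subset _ _).trans (erase_subset _ _)), hc, hf⟩
    · rcases ih (a + 1) b ((S.erase v).filter fun y => f s(v, y) = 1) (by omega) (by omega) with
        ⟨U, hU, hc, hf⟩ | ⟨U, hU, hc, hf⟩
      · exact Or.inl ⟨U, hU.trans ((filter_subset _ _).trans (erase_subset _ _)), hc, hf⟩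
      · exact Or.inr (extend S U v 1 b hv hU hc hf)

lemma exists_mono_finset {R : ℕ} (k : ℕ) (hR : 4 ^ k ≤ R) (f : Sym2 (Fin R) → Fin 2) :
    ∃ (c : Fin 2) (T : Finset (Fin R)), T.card = k ∧
      ∀ x ∈ T, ∀ y ∈ T, x ≠ y → f s(x, y) = c := by
  have h : 2 ^ (k + k) ≤ (univ : Finset (Fin R)).card := by
    rw [card_univ, Fintype.card_fin, ← two_mul, pow_mul]
    exact hR
  rcases exists_mono_of_two_pow_le f (k + k) k k univ rfl h with ⟨T, -, h1, h2⟩ | ⟨T, -, h1, h2⟩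
  · exact ⟨0, T, h1, h2⟩
  · exact ⟨1, T, h1, h2⟩

lemma sum_pow_card_agree (R m : ℕ) (B : ℝ) :
    ∑ r : Fin R → Fin m, ∑ r' : Fin R → Fin m, B ^ (univ.filter fun i => r i = r' i).card
      = ((m : ℝ) * (m - 1 + B)) ^ R := by
  have h1 : ∀ r : Fin R → Fin m, ∑ r' : Fin R → Fin m, B ^ (univ.filter fun i => r i = r' i).card
      = (m - 1 + B) ^ R := by
    intro r
    have h2 := prod_univ_sum (fun _ : Fin R => (univ : Finset (Fin m)))
      (fun i c => if r i = c then B else 1)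
    rw [Fintype.piFinset_univ] at h2
    have h3 : ∀ i, ∑ c, (if r i = c then B else 1) = m - 1 + B := by
      intro i
      have : ∀ c, (if r i = c then B else 1) = 1 + if r i = c then B - 1 else 0 := by
        intro c; split_ifs <;> ring
      simp_rw [this]
      rw [sum_add_distrib]
      simp
      ring
    simp_rw [h3] at h2
    rw [prod_const, card_univ, Fintype.card_fin] at h2
    rw [h2]
    refine sum_congr rfl fun r' _ => ?_
    rw [prod_ite]
    simp
  simp_rw [h1]
  simp [mul_pow]

end Ramsey

section Pattern

/-- `y` assigns one colour to the edges, and `none` to the non-edges, of some copy of `H`. -/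
def HasPattern {P : Type*} {k : ℕ} (H : SimpleGraph (Fin k)) (y : Sym2 P → Option (Fin 2)) : Prop :=
  ∃ (c : Fin 2) (v : Fin k → P), Function.Injective v ∧
    ∀ i j, i ≠ j → y s(v i, v j) = if H.Adj i j then some c else none

/-- Independent labels that are not too biased contain any given pattern with probability at
least one half. -/
theorem half_le_prob_hasPattern {k R m : ℕ} (H : SimpleGraph (Fin k)) (hR : 4 ^ k ≤ R)
    (hm : m = 4 * R * 8 ^ k) (q : Sym2 (Fin R × Fin m) → Option (Fin 2) → ℝ)
    (hq0 : ∀ e c, 0 ≤ q e c) (hq : ∀ e, ∑ c, q e c = 1)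
    (hl : ∀ e, ¬ e.IsDiag → 1 / 4 ≤ q e none) (hu : ∀ e, ¬ e.IsDiag → q e none ≤ 3 / 4) :
    1 / 2 ≤ ∑ y : Sym2 (Fin R × Fin m) → Option (Fin 2),
      (∏ e, q e (y e)) * (if HasPattern H y then 1 else 0) := by
  have hR0 : 0 < R := lt_of_lt_of_le (by positivity) hR
  have hm0 : 0 < m := by rw [hm]; positivity
  have : Nonempty (Fin m) := ⟨⟨0, hm0⟩⟩
  have hcol : ∀ e : Sym2 (Fin R × Fin m), ∃ c : Fin 2, ¬ e.IsDiag → 1 / 8 ≤ q e (some c) := by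
    intro e
    by_contra! h
    have h0 := h 0
    have h1 := h 1
    have h2 := hq e
    rw [Fintype.sum_option, Fin.sum_univ_two] at h2
    linarith [hu e h0.1, h0.2, h1.2]
  choose col hcol using hcol
  let lift : (Fin R → Fin m) → Fin R → Fin R × Fin m := fun r a => (a, r a)
  have lift_inj : ∀ r, Function.Injective (lift r) := fun r a b h => (Prod.ext_iff.1 h).1
  choose c T hT hc using fun r : Fin R → Fin m =>
    exists_mono_finset k hR (fun e => col (e.map (lift r)))
  let v : ∀ r : Fin R → Fin m, Fin k ↪ Fin R × Fin m := fun r =>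
    ((T r).orderEmbOfFin (hT r)).toEmbedding.trans ⟨lift r, lift_inj r⟩
  have hv : ∀ r i, ∃ a ∈ T r, v r i = lift r a := fun r i =>
    ⟨(T r).orderEmbOfFin (hT r) i, orderEmbOfFin_mem _ _ _, rfl⟩
  let E : (Fin R → Fin m) → Finset (Sym2 (Fin R × Fin m)) := fun r =>
    ((T r ×ˢ T r).filter fun p => p.1 ≠ p.2).image fun p => s(lift r p.1, lift r p.2)
  let t : (Fin R → Fin m) → Sym2 (Fin R × Fin m) → Option (Fin 2) := fun r e =>
    if e ∈ (H.map (v r)).edgeSet then some (c r) else none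
  have ht : ∀ r, ∀ e ∈ E r, 1 / 8 ≤ q e (t r e) := by
    intro r e he
    obtain ⟨⟨a, b⟩, hab, rfl⟩ := mem_image.1 he
    simp only [mem_filter, mem_product] at hab
    have hd : ¬ (s(lift r a, lift r b) : Sym2 (Fin R × Fin m)).IsDiag := by
      rw [Sym2.mk_isDiag_iff]
      exact fun h => hab.2 (lift_inj r h)
    dsimp only [t]
    split_ifs
    · have := hc r a hab.1.1 b hab.1.2 hab.2
      simp only [Sym2.map_mk] at this
      rw [← this]
      exact hcol _ hd
    · linarith [hl _ hd]
  have hint : ∀ r r', (E r ∩ E r').card ≤ k * (univ.filter fun i => r i = r' i).card := by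
    intro r r'
    rw [← hT r, ← card_product]
    refine le_trans (card_le_card (t := (T r ×ˢ univ.filter fun i => r i = r' i).image
      fun p => s(lift r p.1, lift r p.2)) ?_) card_image_le
    intro e he
    obtain ⟨h1, h2⟩ := mem_inter.1 he
    obtain ⟨⟨a, b⟩, hab, rfl⟩ := mem_image.1 h1
    obtain ⟨⟨a', b'⟩, -, heq⟩ := mem_image.1 h2
    simp only [mem_filter, mem_product] at hab
    refine mem_image.2 ⟨(a, b), mem_product.2 ⟨hab.1.1, ?_⟩, rfl⟩
    simp only [mem_filter, mem_univ, true_and]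
    simp only [lift, Sym2.eq_iff, Prod.mk.injEq] at heq
    rcases heq with ⟨_, h3, h4⟩ | ⟨⟨h3, h4⟩, _⟩
    · rw [← h4, h3]
    · rw [← h4, h3]
  have key := second_moment q hq0 hq E t (b := 8) (by norm_num) ht
  have hcount : (∑ r, ∑ r', (8 : ℝ) ^ (E r ∩ E r').card)
      / (Fintype.card (Fin R → Fin m) : ℝ) ^ 2 ≤ 3 / 2 := by
    have hm' : (0 : ℝ) < m := by exact_mod_cast hm0
    have hR' : (0 : ℝ) < R := by exact_mod_cast hR0
    have h1 : (∑ r, ∑ r', (8 : ℝ) ^ (E r ∩ E r').card) ≤ ((m : ℝ) * (m - 1 + 8 ^ k)) ^ R := by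
      rw [← sum_pow_card_agree]
      refine sum_le_sum fun r _ => sum_le_sum fun r' _ => ?_
      rw [← pow_mul]
      exact pow_le_pow_right₀ (by norm_num) (hint r r')
    have h2 : ((m : ℝ) * (m - 1 + 8 ^ k)) ≤ m ^ 2 * Real.exp (1 / (4 * R)) := by
      have := Real.add_one_le_exp (1 / (4 * R : ℝ))
      have h3 : (m : ℝ) * (1 / (4 * R)) = 8 ^ k := by
        rw [hm]; push_cast; field_simp
      calc (m : ℝ) * (m - 1 + 8 ^ k) ≤ m * (m + 8 ^ k) := by gcongr; linarith
        _ = m ^ 2 * (1 / (4 * R) + 1) := by rw [← h3]; ring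
        _ ≤ _ := by gcongr
    have h3 : Real.exp (1 / 4) ≤ 3 / 2 := by
      have := Real.exp_bound_div_one_sub_of_interval (x := 1 / 4) (by norm_num) (by norm_num)
      linarith
    rw [Fintype.card_fun, Fintype.card_fin, Fintype.card_fin]
    push_cast
    rw [div_le_iff₀ (by positivity)]
    have h80 : (1 : ℝ) ≤ 8 ^ k := one_le_pow₀ (by norm_num)
    calc _ ≤ ((m : ℝ) * (m - 1 + 8 ^ k)) ^ R := h1
      _ ≤ (m ^ 2 * Real.exp (1 / (4 * R))) ^ R :=
          pow_le_pow_left₀ (mul_nonneg hm'.le (by linarith)) h2 R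
      _ = Real.exp (1 / 4) * ((m : ℝ) ^ R) ^ 2 := by
          rw [mul_pow, ← Real.exp_nat_mul, ← pow_mul, ← pow_mul, mul_comm 2 R, mul_comm]
          congr 2
          field_simp
      _ ≤ _ := by gcongr
  have hle : ∑ y : Sym2 (Fin R × Fin m) → Option (Fin 2), (∏ e, q e (y e)) *
        (if ∃ r, ∀ e ∈ E r, y e = t r e then 1 else 0)
      ≤ ∑ y : Sym2 (Fin R × Fin m) → Option (Fin 2),
        (∏ e, q e (y e)) * (if HasPattern H y then 1 else 0) := by
    refine sum_le_sum fun y _ => mul_le_mul_of_nonneg_left ?_ (prod_nonneg fun e _ => hq0 _ _)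
    by_cases h : ∃ r, ∀ e ∈ E r, y e = t r e
    · have hp : HasPattern H y := by
        obtain ⟨r, hr⟩ := h
        refine ⟨c r, v r, (v r).injective, fun i j hij => ?_⟩
        rw [hr]
        · simp only [t, SimpleGraph.mem_edgeSet, SimpleGraph.map_adj_apply]
        · obtain ⟨a, ha, hva⟩ := hv r i
          obtain ⟨b, hb, hvb⟩ := hv r j
          rw [hva, hvb]
          refine mem_image.2 ⟨(a, b), ?_, rfl⟩
          simp only [mem_filter, mem_product]
          refine ⟨⟨ha, hb⟩, fun hab => hij ((v r).injective ?_)⟩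
          rw [hva, hvb, hab]
      rw [if_pos h, if_pos hp]
    · rw [if_neg h]
      split_ifs <;> norm_num
  linarith

end Pattern

section Averaging

lemma card_sq_mul_sum_le {P V : Type*} [Fintype P] [DecidableEq P] [Fintype V] [Nonempty V]
    (a b : P) (F : (P → V) → ℝ) {C : ℝ}
    (h : ∀ x, ∑ u, ∑ v, F (Function.update (Function.update x a u) b v) ≤ C) :
    (Fintype.card V : ℝ) ^ 2 * ∑ x, F x ≤ Fintype.card (P → V) * C := by
  have h1 := sum_resample_uniform b F
  have h2 := sum_resample_uniform a (fun y => ∑ v, F (Function.update y b v))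
  rw [sq, mul_assoc, ← h1, ← h2]
  refine (sum_le_sum fun x _ => h x).trans (le_of_eq ?_)
  simp

variable {P V Ω K : Type*} [DecidableEq P]

/-- The labels of all pairs that contain `x d` for some `d ∉ {a, b}`. -/
def observe (χ : Ω → Sym2 V → K) (k₀ : K) (a b : P) (x : P → V) (ω : Ω) : P → V → K :=
  fun d v => if d ≠ a ∧ d ≠ b then χ ω s(x d, v) else k₀

lemma observe_update (χ : Ω → Sym2 V → K) (k₀ : K) (a b : P) (x : P → V) (u v : V) :
    observe χ k₀ a b (Function.update (Function.update x a u) b v) = observe χ k₀ a b x := by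
  funext ω d w
  unfold observe
  split_ifs with h
  · rw [Function.update_of_ne h.2, Function.update_of_ne h.1]
  · rfl

lemma eq_of_observe_eq {χ : Ω → Sym2 V → K} {k₀ : K} (hχ : ∀ ω v, χ ω s(v, v) = k₀) {a b : P}
    {x : P → V} {ω ω' : Ω} (h : observe χ k₀ a b x ω = observe χ k₀ a b x ω') {j : Sym2 P}
    (hj : j ≠ s(a, b)) : χ ω (j.map x) = χ ω' (j.map x) := by
  have key : ∀ d d', d ≠ a ∧ d ≠ b → χ ω s(x d, x d') = χ ω' s(x d, x d') := by
    intro d d' hd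
    have := congr_fun (congr_fun h d) (x d')
    simpa only [observe, if_pos hd] using this
  induction j using Sym2.ind with
  | _ d d' =>
    rw [Sym2.map_mk]
    by_cases hd : d ≠ a ∧ d ≠ b
    · exact key d d' hd
    by_cases hd' : d' ≠ a ∧ d' ≠ b
    · rw [Sym2.eq_swap]
      exact key d' d hd'
    have hdd : d = d' := by
      by_contra hne
      refine hj ?_
      rw [Sym2.eq_iff]
      grind
    rw [hdd, hχ, hχ]

/-- Averaging the influence over the images of two distinct vertices. -/
lemma sum_influence_le {V P : Type} [Fintype P] [DecidableEq P] [Fintype V] [DecidableEq V]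
    [Nonempty V] {Ω : Type*} {K : Type} [Fintype K] [Nonempty P] {A : Finset Ω} (hA : A.Nonempty)
    (χ : Ω → Sym2 V → K) (k₀ : K) {l β : ℝ} (hβ : 0 < β)
    (hst : ∀ (κ : Type) [Fintype κ] (g : Ω → κ), ∑ s, pr A (fun ω => g ω = s) *
      ∑ i : V × V, ∑ c, (pr (A.filter (fun ω => g ω = s)) (fun ω => χ ω s(i.1, i.2) = c)
        - pr A (fun ω => χ ω s(i.1, i.2) = c)) ^ 2 ≤ l * Real.log (Fintype.card κ))
    {a b : P} (hab : a ≠ b) :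
    (Fintype.card V : ℝ) ^ 2 * ∑ x : P → V,
        influence A (fun ω => χ ω s(x a, x b)) (observe χ k₀ a b x)
      ≤ Fintype.card (P → V) *
        (l * Real.log (Fintype.card (P → V → K)) / β
          + Fintype.card K * β * (Fintype.card V : ℝ) ^ 2) := by
  refine card_sq_mul_sum_le a b _ fun x => ?_
  simp only [observe_update, Function.update_self, Function.update_of_ne hab]
  rw [← Fintype.sum_prod_type' (f := fun u v =>
    influence A (fun ω => χ ω s(u, v)) (observe χ k₀ a b x))]
  refine (sum_le_sum fun i _ => influence_le A hA _ _ hβ).trans ?_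
  rw [sum_add_distrib, ← sum_div, sum_comm]
  refine add_le_add (div_le_div_of_nonneg_right (le_trans (le_of_eq ?_)
    (hst _ (observe χ k₀ a b x))) hβ.le) (le_of_eq ?_)
  · refine sum_congr rfl fun s _ => ?_
    rw [← mul_sum]
  · simp
    ring

end Averaging

section RandomGraph

lemma pr_not {Ω : Type*} {A : Finset Ω} (hA : A.Nonempty) (p : Ω → Prop) :
    pr A (fun ω => ¬ p ω) = 1 - pr A p := by
  have hA0 : (A.card : ℝ) ≠ 0 := by exact_mod_cast hA.card_pos.ne'
  have h2 := card_filter_add_card_filter_not (s := A) p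
  rw [pr, pr, eq_sub_iff_add_eq, ← add_div, div_eq_one_iff_eq hA0, add_comm]
  exact_mod_cast (by convert h2)

variable {N : ℕ}

/-- The graph encoded by a string of bits. -/
def bitGraph (ω : Fin N × Fin N → Bool) : SimpleGraph (Fin N) where
  Adj u v := u ≠ v ∧ ω (min u v, max u v) = true
  symm := ⟨fun u v h => ⟨h.1.symm, by rw [min_comm, max_comm]; exact h.2⟩⟩
  loopless := ⟨fun u h => h.1 rfl⟩

/-- The label of a pair: its colour if it is an edge, and `none` otherwise. -/
noncomputable def label {V : Type*} (G : SimpleGraph V) (c : Sym2 V → Fin 2) (e : Sym2 V) :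
    Option (Fin 2) :=
  if e ∈ G.edgeSet then some (c e) else none

lemma label_diag {V : Type*} (G : SimpleGraph V) (c : Sym2 V → Fin 2) (v : V) :
    label G c s(v, v) = none := by
  simp [label]

lemma label_eq_none_iff {V : Type*} (G : SimpleGraph V) (c : Sym2 V → Fin 2) (u v : V) :
    label G c s(u, v) = none ↔ ¬ G.Adj u v := by
  simp [label]

theorem hasMonoInducedCopy_of_hasPattern {k : ℕ} {G : SimpleGraph (Fin N)}
    {H : SimpleGraph (Fin k)} {c : Sym2 (Fin N) → Fin 2} {P : Type*} {x : P → Fin N}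
    (hx : Function.Injective x) (h : HasPattern H (fun e : Sym2 P => label G c (e.map x))) :
    HasMonoInducedCopy G H c := by
  obtain ⟨j, v, hv, h⟩ := h
  simp only [Sym2.map_mk] at h
  have hf : Function.Injective fun i => x (v i) := hx.comp hv
  have hadj : ∀ i i', G.Adj (x (v i)) (x (v i')) ↔ H.Adj i i' := by
    intro i i'
    by_cases hi : i = i'
    · simp [hi]
    · have h1 := h i i' hi
      have h2 := label_eq_none_iff G c (x (v i)) (x (v i'))
      rw [h1] at h2
      by_cases h3 : H.Adj i i' <;> simp_all
  refine ⟨univ.image fun i => x (v i), j, ⟨⟨Equiv.ofBijective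
    (fun i => ⟨x (v i), by simp⟩) ⟨fun i i' hi => hf (congrArg Subtype.val hi), ?_⟩, ?_⟩⟩, ?_⟩
  · rintro ⟨y, hy⟩
    obtain ⟨i, -, rfl⟩ := mem_image.1 (mem_coe.1 hy)
    exact ⟨i, rfl⟩
  · intro i i'
    exact hadj i i'
  · intro y hy z hz hyz
    obtain ⟨i, -, rfl⟩ := mem_image.1 hy
    obtain ⟨i', -, rfl⟩ := mem_image.1 hz
    have hi := (hadj i i').1 hyz
    have h1 := h i i' hi.ne
    rw [if_pos hi, label, if_pos (by simpa using hyz)] at h1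
    simpa using h1

lemma sum_abs_pr_none_le {A : Finset (Fin N × Fin N → Bool)} (hA : A.Nonempty)
    (c : SimpleGraph (Fin N) → Sym2 (Fin N) → Fin 2) {t : ℝ} (ht : 0 < t) :
    ∑ u, ∑ v, |pr A (fun ω => label (bitGraph ω) (c (bitGraph ω)) s(u, v) = none) - 1 / 2|
      ≤ (Real.log (Fintype.card (Fin N × Fin N → Bool)) - Real.log A.card) / t
        + t * (N : ℝ) ^ 2 / 2 + N / 2 := by
  set f : Fin N → Fin N → ℝ := fun u v => |2 * pr A (fun ω => ω (u, v) = true) - 1| with hf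
  have hf0 : ∀ u v, 0 ≤ f u v := fun u v => abs_nonneg _
  have hA0 : (A.card : ℝ) ≠ 0 := by exact_mod_cast hA.card_pos.ne'
  have hpt : ∀ u v, |pr A (fun ω => label (bitGraph ω) (c (bitGraph ω)) s(u, v) = none) - 1 / 2|
      ≤ (f u v + f v u) / 2 + if u = v then 1 / 2 else 0 := by
    intro u v
    by_cases huv : u = v
    · subst huv
      have : pr A (fun ω => label (bitGraph ω) (c (bitGraph ω)) s(u, u) = none) = 1 := by
        simp [pr, label_diag, hA0]
      rw [this, if_pos rfl]
      have := hf0 u u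
      rw [abs_of_pos (by norm_num)]
      linarith
    · have h1 : pr A (fun ω => label (bitGraph ω) (c (bitGraph ω)) s(u, v) = none)
          = 1 - pr A (fun ω => ω (min u v, max u v) = true) := by
        rw [← pr_not hA]
        congr 1
        funext ω
        rw [label_eq_none_iff]
        simp [bitGraph, huv]
      have h4 : |pr A (fun ω => label (bitGraph ω) (c (bitGraph ω)) s(u, v) = none) - 1 / 2|
          = f (min u v) (max u v) / 2 := by
        rw [h1, hf]
        dsimp only
        rw [← abs_neg, ← abs_two, ← abs_div, abs_two]
        congr 1
        ring
      rw [h4, if_neg huv, add_zero]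
      rcases le_total u v with h | h
      · rw [min_eq_left h, max_eq_right h]
        linarith [hf0 v u]
      · rw [min_eq_right h, max_eq_left h]
        linarith [hf0 u v]
  have hb := sum_abs_bias_le hA ht
  rw [Fintype.sum_prod_type] at hb
  have e1 : ∑ u, ∑ v, f u v ≤ (Real.log (Fintype.card (Fin N × Fin N → Bool))
      - Real.log A.card) / t + t * (N : ℝ) ^ 2 / 2 := by
    refine hb.trans (le_of_eq ?_)
    rw [Fintype.card_prod, Fintype.card_fin]
    push_cast
    ring
  have e2 : ∑ u, ∑ v, f v u = ∑ u, ∑ v, f u v := sum_comm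
  refine (sum_le_sum fun u _ => sum_le_sum fun v _ => hpt u v).trans ?_
  simp_rw [sum_add_distrib, ← sum_div, sum_add_distrib]
  rw [e2]
  simp only [sum_ite_eq, mem_univ, if_true, sum_const, card_univ, Fintype.card_fin, nsmul_eq_mul]
  linarith

end RandomGraph

section Main

/-- If the labels of `x(P)` under a uniformly random element of `A` are unbiased and hardly
influence each other, then some element of `A` yields a monochromatic induced copy. -/
theorem exists_hasPattern {k R m : ℕ} (H : SimpleGraph (Fin k)) (hR : 4 ^ k ≤ R)
    (hm : m = 4 * R * 8 ^ k) {Ω V κ : Type*} [Fintype κ] {A : Finset Ω} (hA : A.Nonempty)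
    (χ : Ω → Sym2 V → Option (Fin 2)) (hχ : ∀ ω v, χ ω s(v, v) = none)
    (x : Fin R × Fin m → V) (g : Sym2 (Fin R × Fin m) → Ω → κ)
    (hg : ∀ i ω ω', g i ω = g i ω' → ∀ j, j ≠ i → χ ω (j.map x) = χ ω' (j.map x))
    (hx : ∑ e ∈ univ.filter (fun e : Sym2 (Fin R × Fin m) => ¬ e.IsDiag),
      (influence A (fun ω => χ ω (e.map x)) (g e)
        + 4 * |pr A (fun ω => χ ω (e.map x) = none) - 1 / 2|) < 1 / 4) :
    Function.Injective x ∧ ∃ ω ∈ A, HasPattern H fun e => χ ω (e.map x) := by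
  have hA0 : (0 : ℝ) < A.card := by exact_mod_cast hA.card_pos
  have hinf : ∀ e, 0 ≤ influence A (fun ω => χ ω (e.map x)) (g e) := fun e =>
    sum_nonneg fun s _ => mul_nonneg (pr_nonneg _ _) (sum_nonneg fun c _ => abs_nonneg _)
  have hsingle : ∀ e : Sym2 (Fin R × Fin m), ¬ e.IsDiag →
      |pr A (fun ω => χ ω (e.map x) = none) - 1 / 2| < 1 / 4 := by
    intro e he
    have h1 := single_le_sum (f := fun e : Sym2 (Fin R × Fin m) =>
      influence A (fun ω => χ ω (e.map x)) (g e)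
        + 4 * |pr A (fun ω => χ ω (e.map x) = none) - 1 / 2|)
      (s := univ.filter fun e : Sym2 (Fin R × Fin m) => ¬ e.IsDiag)
      (fun i _ => add_nonneg (hinf i) (by positivity)) (mem_filter.2 ⟨mem_univ e, he⟩)
    have h2 := hinf e
    have h3 := abs_nonneg (pr A (fun ω => χ ω (e.map x) = none) - 1 / 2)
    linarith
  refine ⟨fun a b hab => ?_, ?_⟩
  · by_contra hne
    have h1 := hsingle s(a, b) (by rwa [Sym2.mk_isDiag_iff])
    have h2 : pr A (fun ω => χ ω (Sym2.map x s(a, b)) = none) = 1 := by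
      simp [pr, Sym2.map_mk, hab, hχ, hA0.ne']
    rw [h2] at h1
    norm_num [abs_of_pos] at h1
  · have hsum : ∑ e, influence A (fun ω => χ ω (e.map x)) (g e) < 1 / 4 := by
      refine lt_of_le_of_lt ?_ hx
      rw [← sum_filter_add_sum_filter_not univ (fun e : Sym2 (Fin R × Fin m) => ¬ e.IsDiag)]
      rw [sum_eq_zero (s := univ.filter fun e : Sym2 (Fin R × Fin m) => ¬ ¬ e.IsDiag), add_zero]
      · exact sum_le_sum fun e _ => le_add_of_nonneg_right (by positivity)
      · intro e he
        simp only [mem_filter, mem_univ, true_and, not_not] at he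
        refine influence_of_const (k₀ := none) (fun ω => ?_) _
        induction e using Sym2.ind with
        | _ a b =>
          rw [Sym2.mk_isDiag_iff] at he
          rw [he, Sym2.map_mk, hχ]
    by_contra! hno
    have h1 := product_law_le hA (fun e ω => χ ω (e.map x)) g hg
      (fun y => if HasPattern H y then 1 else 0)
      (fun y => by split_ifs <;> norm_num)
      (fun y => by split_ifs <;> norm_num)
    have h2 := half_le_prob_hasPattern H hR hm
      (fun e c => pr A (fun ω => χ ω (e.map x) = c))
      (fun e c => pr_nonneg _ _) (fun e => sum_pr_fiber hA fun ω => χ ω (e.map x))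
      (fun e he => by linarith [(abs_lt.1 (hsingle e he)).1])
      (fun e he => by linarith [(abs_lt.1 (hsingle e he)).2])
    have h3 : ∑ ω ∈ A, (if HasPattern H fun e => χ ω (e.map x) then (1 : ℝ) else 0) = 0 :=
      sum_eq_zero fun ω hω => if_neg (hno ω hω)
    rw [h3, zero_add] at h1
    have h4 := le_of_mul_le_mul_left h1 hA0
    linarith

/-- The label of a pair in the graph encoded by `ω`, coloured by `c`. -/
noncomputable def bitLabel {N : ℕ} (c : SimpleGraph (Fin N) → Sym2 (Fin N) → Fin 2)
    (ω : Fin N × Fin N → Bool) : Sym2 (Fin N) → Option (Fin 2) :=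
  label (bitGraph ω) (c (bitGraph ω))

lemma log_card_observe_le (R m N : ℕ) :
    Real.log (Fintype.card (Fin R × Fin m → Fin N → Option (Fin 2)))
      ≤ 2 * ((R * m : ℕ) : ℝ) * N := by
  simp only [Fintype.card_fun, Fintype.card_prod, Fintype.card_fin, Fintype.card_option]
  rw [Nat.cast_pow, Real.log_pow, Nat.cast_pow, Real.log_pow]
  have h3 : Real.log ((2 + 1 : ℕ) : ℝ) ≤ 2 := by
    have := Real.log_le_sub_one_of_pos (x := ((2 + 1 : ℕ) : ℝ)) (by norm_num)
    push_cast at this ⊢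
    linarith
  calc ((R * m : ℕ) : ℝ) * (N * Real.log ((2 + 1 : ℕ) : ℝ)) ≤ ((R * m : ℕ) : ℝ) * (N * 2) := by
        gcongr
    _ = _ := by ring

lemma cost_estimate {M L D N : ℝ} (hM : 512 ≤ M) (hN : N = M ^ 16) (hL : L ≤ 2 * M * N)
    (hD : D ≤ N ^ 2 / M ^ 8) :
    M ^ 8 * L / (M ^ 4)⁻¹ + 3 * (M ^ 4)⁻¹ * N ^ 2
      + 4 * (D / (M ^ 4)⁻¹ + (M ^ 4)⁻¹ * N ^ 2 / 2 + N / 2) ≤ N ^ 2 * (1 / (8 * M ^ 2)) := by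
  have hM0 : 0 < M := by linarith
  subst hN
  have h1 : M ^ 8 * L / (M ^ 4)⁻¹ ≤ 2 * M ^ 29 := by
    calc _ ≤ M ^ 8 * (2 * M * M ^ 16) / (M ^ 4)⁻¹ := by gcongr
      _ = _ := by field_simp
  have h2 : D / (M ^ 4)⁻¹ ≤ M ^ 28 := by
    calc _ ≤ (M ^ 16) ^ 2 / M ^ 8 / (M ^ 4)⁻¹ := by gcongr
      _ = _ := by field_simp
  have h3 : (M ^ 4)⁻¹ * (M ^ 16) ^ 2 = M ^ 28 := by field_simp
  have h4 : (M ^ 16) ^ 2 * (1 / (8 * M ^ 2)) = M ^ 30 / 8 := by field_simp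
  have h16 : M ^ 16 ≤ M ^ 28 := pow_le_pow_right₀ (by linarith) (by norm_num)
  have h28 : 0 ≤ M ^ 28 := by positivity
  have h29 : M ^ 29 = M * M ^ 28 := by ring
  have h30 : M ^ 30 = M * (M * M ^ 28) := by ring
  have h5 : 512 * M ^ 28 ≤ M * M ^ 28 := by gcongr
  have h6 : 512 * (M * M ^ 28) ≤ M * (M * M ^ 28) := by gcongr
  rw [h4, mul_assoc 3, h3, h30]
  rw [h29] at h1
  linarith

private lemma add_le_of_scaled_le {n S T Q X Y Z : ℝ} (hn : 0 < n) (h1 : n * S ≤ Q * X)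
    (h2 : n * T ≤ Q * Y) (h : X + 4 * Y ≤ n * Z) (hQ : 0 ≤ Q) : S + 4 * T ≤ Q * Z := by
  refine le_of_mul_le_mul_left ?_ hn
  linarith [mul_le_mul_of_nonneg_left h hQ]

lemma sum_cost_le {R m N : ℕ} [NeZero N] [Nonempty (Fin R × Fin m)] {M : ℝ}
    (hMR : M = ((R * m : ℕ) : ℝ)) (hM : 512 ≤ M) (hN : (N : ℝ) = M ^ 16)
    (c : SimpleGraph (Fin N) → Sym2 (Fin N) → Fin 2) {A : Finset (Fin N × Fin N → Bool)}
    (hA : A.Nonempty)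
    (hD : Real.log (Fintype.card (Fin N × Fin N → Bool)) - Real.log A.card
      ≤ Fintype.card (Fin N × Fin N) / M ^ 8)
    (hst : ∀ (κ : Type) [Fintype κ] (g : (Fin N × Fin N → Bool) → κ),
      ∑ s, pr A (fun ω => g ω = s) * ∑ i : Fin N × Fin N, ∑ d,
        (pr (A.filter (fun ω => g ω = s)) (fun ω => bitLabel c ω s(i.1, i.2) = d)
          - pr A (fun ω => bitLabel c ω s(i.1, i.2) = d)) ^ 2
        ≤ M ^ 8 * Real.log (Fintype.card κ))
    {a b : Fin R × Fin m} (hab : a ≠ b) :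
    ∑ x : Fin R × Fin m → Fin N,
      (influence A (fun ω => bitLabel c ω s(x a, x b)) (observe (bitLabel c) none a b x)
        + 4 * |pr A (fun ω => bitLabel c ω s(x a, x b) = none) - 1 / 2|)
      ≤ Fintype.card (Fin R × Fin m → Fin N) * (1 / (8 * M ^ 2)) := by
  have hM0 : 0 < M := by linarith
  have hN0 : (0 : ℝ) < N := by rw [hN]; positivity
  have hβ : 0 < (M ^ 4)⁻¹ := by positivity
  have h1 := sum_influence_le hA (bitLabel c) none hβ hst hab
  have h2 := card_sq_mul_sum_le a b
    (fun x : Fin R × Fin m → Fin N => |pr A (fun ω => bitLabel c ω s(x a, x b) = none) - 1 / 2|)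
    (fun x => by
      simp only [Function.update_self, Function.update_of_ne hab]
      exact sum_abs_pr_none_le hA c hβ)
  have hL := log_card_observe_le R m N
  rw [← hMR] at hL
  have hcK : (Fintype.card (Option (Fin 2)) : ℝ) = 3 := by simp
  have hcV : (Fintype.card (Fin N × Fin N) : ℝ) = (N : ℝ) ^ 2 := by simp [sq]
  rw [hcK, Fintype.card_fin] at h1
  rw [Fintype.card_fin] at h2
  rw [hcV] at hD
  rw [sum_add_distrib, ← mul_sum]
  exact add_le_of_scaled_le (pow_pos hN0 2) h1 h2 (cost_estimate hM hN hL hD) (Nat.cast_nonneg _)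

theorem exists_graph {k R m N : ℕ} (H : SimpleGraph (Fin k)) (hR : 4 ^ k ≤ R)
    (hm : m = 4 * R * 8 ^ k) (hM : 512 ≤ R * m) (hN : N = (R * m) ^ 16) :
    ∃ G : SimpleGraph (Fin N), ∀ c : Sym2 (Fin N) → Fin 2, HasMonoInducedCopy G H c := by
  by_contra! hbad
  choose c hc using hbad
  obtain ⟨M, hMR⟩ : ∃ M : ℝ, M = ((R * m : ℕ) : ℝ) := ⟨_, rfl⟩
  have hM' : (512 : ℝ) ≤ M := by rw [hMR]; exact_mod_cast hM
  have hM0 : 0 < M := by linarith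
  have hNM : (N : ℝ) = M ^ 16 := by rw [hN, hMR, Nat.cast_pow]
  have : NeZero N := ⟨by rw [hN]; exact pow_ne_zero _ (by omega)⟩
  have : Nonempty (Fin R × Fin m) := by
    rw [← Fintype.card_pos_iff, Fintype.card_prod, Fintype.card_fin, Fintype.card_fin]
    omega
  have hχ : ∀ ω v, bitLabel c ω s(v, v) = none := fun ω v => label_diag _ _ v
  have hl : 0 < M ^ 8 := by positivity
  obtain ⟨A, hA, hD, hst⟩ := exists_stable
    (fun (i : Fin N × Fin N) (ω : Fin N × Fin N → Bool) => bitLabel c ω s(i.1, i.2)) hl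
  choose p hp using fun e : Sym2 (Fin R × Fin m) =>
    (⟨e.out, Quot.out_eq e⟩ : ∃ p : (Fin R × Fin m) × (Fin R × Fin m), s(p.1, p.2) = e)
  have hmap : ∀ (x : Fin R × Fin m → Fin N) e, e.map x = s(x (p e).1, x (p e).2) := by
    intro x e
    conv_lhs => rw [← hp e]
    rfl
  let cost : (Fin R × Fin m → Fin N) → Sym2 (Fin R × Fin m) → ℝ := fun x e =>
    influence A (fun ω => bitLabel c ω (e.map x)) (observe (bitLabel c) none (p e).1 (p e).2 x)
        + 4 * |pr A (fun ω => bitLabel c ω (e.map x) = none) - 1 / 2|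
  have hcost : ∀ e : Sym2 (Fin R × Fin m), ¬ e.IsDiag →
      ∑ x, cost x e ≤ Fintype.card (Fin R × Fin m → Fin N) * (1 / (8 * M ^ 2)) := by
    intro e he
    have hab : (p e).1 ≠ (p e).2 := by
      rw [← hp e, Sym2.mk_isDiag_iff] at he
      exact he
    simp only [cost, hmap]
    exact sum_cost_le hMR hM' hNM c hA hD hst hab
  have hcard : ((univ.filter fun e : Sym2 (Fin R × Fin m) => ¬ e.IsDiag).card : ℝ) ≤ M ^ 2 := by
    have h1 : Fintype.card (Sym2 (Fin R × Fin m)) ≤ (R * m) ^ 2 := by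
      refine (Fintype.card_le_of_injective p fun e e' h => ?_).trans (le_of_eq ?_)
      · rw [← hp e, ← hp e', h]
      · simp [sq]
    rw [hMR]
    exact_mod_cast (card_le_univ _).trans h1
  obtain ⟨x, -, hx⟩ : ∃ x ∈ (univ : Finset (Fin R × Fin m → Fin N)),
      ∑ e ∈ univ.filter (fun e : Sym2 (Fin R × Fin m) => ¬ e.IsDiag), cost x e ≤ 1 / 8 := by
    refine exists_le_of_sum_le univ_nonempty ?_
    rw [sum_comm]
    refine (sum_le_sum fun e he => hcost e (mem_filter.1 he).2).trans ?_
    rw [sum_const, nsmul_eq_mul, sum_const, nsmul_eq_mul, card_univ]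
    calc _ ≤ M ^ 2 * (Fintype.card (Fin R × Fin m → Fin N) * (1 / (8 * M ^ 2))) := by gcongr
      _ = _ := by field_simp
  obtain ⟨hinj, ω, -, hω⟩ := exists_hasPattern H hR hm hA (bitLabel c) hχ x
    (fun e => observe (bitLabel c) none (p e).1 (p e).2 x)
    (fun e ω ω' h j hj => eq_of_observe_eq hχ h (by rwa [hp]))
    (lt_of_le_of_lt hx (by norm_num))
  exact hc (bitGraph ω) (hasMonoInducedCopy_of_hasPattern hinj hω)

theorem exists_graph_card_le {k : ℕ} (hk : 1 ≤ k) (H : SimpleGraph (Fin k)) :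
    ∃ N : ℕ, N ≤ 2 ^ (144 * k) ∧
      ∃ G : SimpleGraph (Fin N), ∀ c : Sym2 (Fin N) → Fin 2, HasMonoInducedCopy G H c := by
  have h4 : (4 : ℕ) ^ k = 2 ^ (2 * k) := by rw [pow_mul]; norm_num
  have h8 : (8 : ℕ) ^ k = 2 ^ (3 * k) := by rw [pow_mul]; norm_num
  have hprod : 4 ^ k * (4 * 4 ^ k * 8 ^ k) = 2 ^ (7 * k + 2) := by
    rw [h4, h8, pow_add, show 7 * k = 2 * k + (2 * k + 3 * k) by ring, pow_add, pow_add]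
    ring
  refine ⟨(4 ^ k * (4 * 4 ^ k * 8 ^ k)) ^ 16, ?_, exists_graph H le_rfl rfl ?_ rfl⟩
  · rw [hprod, ← pow_mul]
    exact Nat.pow_le_pow_right (by norm_num) (by omega)
  · rw [hprod]
    calc 512 = 2 ^ 9 := by norm_num
      _ ≤ _ := Nat.pow_le_pow_right (by norm_num) (by omega)

end Main

end InducedRamsey

/-- **Theorem 1.1.** There is a constant `C > 0` such that for every `k ≥ 1` and every graph
`H` on `k` vertices there is a graph `G` with at most `2^{Ck}` vertices such that every
`2`-colouring of the edges of `G` contains a monochromatic induced copy of `H`. -/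
theorem induced_ramsey_two_colours :
    ∃ C : ℝ, 0 < C ∧ ∀ k : ℕ, 1 ≤ k → ∀ H : SimpleGraph (Fin k),
      ∃ N : ℕ, (N : ℝ) ≤ (2 : ℝ) ^ (C * (k : ℝ)) ∧
        ∃ G : SimpleGraph (Fin N),
          ∀ c : Sym2 (Fin N) → Fin 2, HasMonoInducedCopy G H c := by
  refine ⟨144, by norm_num, fun k hk H => ?_⟩
  obtain ⟨N, hN, hG⟩ := InducedRamsey.exists_graph_card_le hk H
  refine ⟨N, ?_, hG⟩
  have h : (144 : ℝ) * k = ((144 * k : ℕ) : ℝ) := by push_cast; rfl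
  rw [h, Real.rpow_natCast]
  exact_mod_cast hN
end

section
/- There exists a constant C > 0 such that for every r ≥ 2, every k ≥ 1 and every graph H on k vertices, R_ind(H;r) ≤ r^{Crk}; that is, there exists a graph G with at most r^{Crk} vertices such that every r-colouring of the edges of G contains a monochromatic induced copy of H. -/
open scoped Classical

/-- The average of `g` over the fibre of `Z` through `ω`. -/
noncomputable def condAvg {Ω γ : Type*} [Fintype Ω] (Z : Ω → γ) (g : Ω → ℝ) (ω : Ω) : ℝ :=
  (∑ ω' with Z ω' = Z ω, g ω') / (Finset.univ.filter fun ω' => Z ω' = Z ω).card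

section CondAvg

variable {Ω γ γ' : Type*} [Fintype Ω]

lemma condAvg_congr (Z : Ω → γ) (g : Ω → ℝ) {ω ω' : Ω} (h : Z ω = Z ω') :
    condAvg Z g ω = condAvg Z g ω' := by
  simp only [condAvg, h]

lemma card_fiber_pos (Z : Ω → γ) (ω : Ω) :
    (0 : ℝ) < (Finset.univ.filter fun ω' => Z ω' = Z ω).card := by
  exact_mod_cast Finset.card_pos.mpr ⟨ω, by simp⟩

lemma sum_condAvg_mul (Z : Ω → γ) (g h : Ω → ℝ)
    (hh : ∀ ω ω', Z ω = Z ω' → h ω = h ω') :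
    ∑ ω, condAvg Z g ω * h ω = ∑ ω, g ω * h ω := by
  have key : ∀ ω, condAvg Z g ω * h ω = ∑ ω', if Z ω' = Z ω then
      g ω' * h ω' / (Finset.univ.filter fun ω'' => Z ω'' = Z ω').card else 0 := by
    intro ω
    rw [condAvg, div_mul_eq_mul_div, Finset.sum_mul, Finset.sum_div, Finset.sum_filter]
    refine Finset.sum_congr rfl fun ω' _ => ?_
    split_ifs with hz
    · rw [hh _ _ hz, hz]
    · rfl
  rw [Finset.sum_congr rfl fun ω _ => key ω, Finset.sum_comm]
  refine Finset.sum_congr rfl fun ω' _ => ?_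
  rw [← Finset.sum_filter, Finset.sum_const, nsmul_eq_mul]
  have hp := card_fiber_pos Z ω'
  have : (Finset.univ.filter fun ω => Z ω' = Z ω) = Finset.univ.filter fun ω => Z ω = Z ω' := by
    ext; simp [eq_comm]
  rw [this]
  field_simp

lemma sum_condAvg_sub_sq (Z : Ω → γ) (Z' : Ω → γ') (g : Ω → ℝ)
    (hZ : ∀ ω ω', Z' ω = Z' ω' → Z ω = Z ω') :
    ∑ ω, (condAvg Z' g ω - condAvg Z g ω) ^ 2 =
      ∑ ω, condAvg Z' g ω ^ 2 - ∑ ω, condAvg Z g ω ^ 2 := by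
  have h1 := sum_condAvg_mul Z' g (condAvg Z g) fun ω ω' h => condAvg_congr Z g (hZ _ _ h)
  have h2 := sum_condAvg_mul Z g (condAvg Z g) fun ω ω' h => condAvg_congr Z g h
  have h3 : ∑ ω, (condAvg Z' g ω - condAvg Z g ω) ^ 2 =
      ∑ ω, condAvg Z' g ω ^ 2 - 2 * ∑ ω, condAvg Z' g ω * condAvg Z g ω
        + ∑ ω, condAvg Z g ω * condAvg Z g ω := by
    rw [Finset.mul_sum, ← Finset.sum_sub_distrib, ← Finset.sum_add_distrib]
    exact Finset.sum_congr rfl fun ω _ => by ring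
  have h4 : ∑ ω, condAvg Z g ω ^ 2 = ∑ ω, condAvg Z g ω * condAvg Z g ω :=
    Finset.sum_congr rfl fun ω _ => by ring
  rw [h3, h4, h1, ← h2]
  ring

lemma condAvg_nonneg (Z : Ω → γ) {g : Ω → ℝ} (hg : ∀ ω, 0 ≤ g ω) (ω : Ω) :
    0 ≤ condAvg Z g ω :=
  div_nonneg (Finset.sum_nonneg fun ω' _ => hg ω') (Nat.cast_nonneg _)

lemma condAvg_const (Z : Ω → γ) (a : ℝ) (ω : Ω) : condAvg Z (fun _ => a) ω = a := by
  have hp := card_fiber_pos Z ω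
  rw [condAvg, Finset.sum_const, nsmul_eq_mul]
  field_simp

lemma condAvg_sum {ι : Type*} (s : Finset ι) (Z : Ω → γ) (g : ι → Ω → ℝ) (ω : Ω) :
    condAvg Z (fun ω => ∑ i ∈ s, g i ω) ω = ∑ i ∈ s, condAvg Z (g i) ω := by
  simp only [condAvg]
  rw [Finset.sum_comm, Finset.sum_div]

lemma condAvg_affine (Z : Ω → γ) (g : Ω → ℝ) (a b : ℝ) (ω : Ω) :
    condAvg Z (fun ω => a + b * g ω) ω = a + b * condAvg Z g ω := by
  have hp := card_fiber_pos Z ω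
  rw [condAvg, condAvg, Finset.sum_add_distrib, Finset.sum_const, ← Finset.mul_sum, nsmul_eq_mul]
  field_simp

/-- The conditional probability of `X = t` given `Z`. -/
noncomputable def condProb {Γ : Type*} (Z : Ω → γ) (X : Ω → Γ) (ω : Ω) (t : Γ) : ℝ :=
  condAvg Z (fun ω => if X ω = t then 1 else 0) ω

lemma condProb_congr {Γ : Type*} (Z : Ω → γ) (X : Ω → Γ) {ω ω' : Ω} (h : Z ω = Z ω') :
    condProb Z X ω = condProb Z X ω' :=
  funext fun _ => condAvg_congr Z _ h

lemma condProb_nonneg {Γ : Type*} (Z : Ω → γ) (X : Ω → Γ) (ω : Ω) (t : Γ) :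
    0 ≤ condProb Z X ω t :=
  condAvg_nonneg Z (fun ω => by split_ifs <;> norm_num) ω

lemma sum_condProb {Γ : Type*} [Fintype Γ] (Z : Ω → γ) (X : Ω → Γ) (ω : Ω) :
    ∑ t, condProb Z X ω t = 1 := by
  simp only [condProb]
  rw [← condAvg_sum]
  simp [condAvg_const]

end CondAvg

/-- The indicator function of the event that the coordinates in `S` agree with `t`. -/
noncomputable def cylinder {ι Γ : Type*} (S : Finset ι) (t : ι → Γ) (ψ : ι → Γ) : ℝ :=
  if ∀ i ∈ S, ψ i = t i then 1 else 0

lemma cylinder_nonneg {ι Γ : Type*} (S : Finset ι) (t ψ : ι → Γ) : 0 ≤ cylinder S t ψ := by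
  unfold cylinder
  split_ifs <;> norm_num

lemma cylinder_of_forall {ι Γ : Type*} {S : Finset ι} {t ψ : ι → Γ} (h : ∀ i ∈ S, ψ i = t i) :
    cylinder S t ψ = 1 := if_pos h

lemma cylinder_of_not_forall {ι Γ : Type*} {S : Finset ι} {t ψ : ι → Γ}
    (h : ¬ ∀ i ∈ S, ψ i = t i) :
    cylinder S t ψ = 0 := if_neg h

section ProductExpectation

variable {ι Γ : Type*} [Fintype ι] [Fintype Γ]

/-- The expectation of `B` under the product of the weights `q i`. -/
noncomputable def prodExp (B : (ι → Γ) → ℝ) (q : ι → Γ → ℝ) : ℝ :=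
  ∑ ψ : ι → Γ, (∏ i, q i (ψ i)) * B ψ

lemma prodExp_nonneg {B : (ι → Γ) → ℝ} (hB : ∀ ψ, 0 ≤ B ψ) {q : ι → Γ → ℝ}
    (hq : ∀ i t, 0 ≤ q i t) : 0 ≤ prodExp B q :=
  Finset.sum_nonneg fun ψ _ => mul_nonneg (Finset.prod_nonneg fun i _ => hq i _) (hB ψ)

lemma prodExp_mono {B B' : (ι → Γ) → ℝ} (hB : ∀ ψ, B ψ ≤ B' ψ) {q : ι → Γ → ℝ}
    (hq : ∀ i t, 0 ≤ q i t) : prodExp B q ≤ prodExp B' q :=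
  Finset.sum_le_sum fun ψ _ =>
    mul_le_mul_of_nonneg_left (hB ψ) (Finset.prod_nonneg fun i _ => hq i _)

lemma prodExp_one {q : ι → Γ → ℝ} (hs : ∀ i, ∑ t, q i t = 1) :
    prodExp (fun _ => 1) q = 1 := by
  simp only [prodExp, mul_one]
  rw [← Fintype.prod_sum]
  simp [hs]

lemma prodExp_eq_sum_update (B : (ι → Γ) → ℝ) (q : ι → Γ → ℝ) (e : ι) :
    prodExp B q =
      ∑ t, q e t * prodExp B (Function.update q e fun u => if u = t then 1 else 0) := by
  simp only [prodExp, Finset.mul_sum]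
  rw [Finset.sum_comm]
  refine Finset.sum_congr rfl fun ψ _ => ?_
  have h : ∀ t, ∏ i, Function.update q e (fun u => if u = t then (1 : ℝ) else 0) i (ψ i) =
      (if ψ e = t then 1 else 0) * ∏ i ∈ Finset.univ.erase e, q i (ψ i) := by
    intro t
    rw [← Finset.mul_prod_erase _ _ (Finset.mem_univ e)]
    simp only [Function.update_self]
    congr 1
    refine Finset.prod_congr rfl fun i hi => ?_
    rw [Function.update_of_ne (Finset.ne_of_mem_erase hi)]
  simp only [h]
  rw [← Finset.mul_prod_erase _ _ (Finset.mem_univ e)]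
  simp [mul_assoc]

/-- The probability that prescribed coordinates take prescribed values. -/
lemma prodExp_cylinder {q : ι → Γ → ℝ} (hs : ∀ i, ∑ t, q i t = 1) (S : Finset ι) (t : ι → Γ) :
    prodExp (cylinder S t) q = ∏ i ∈ S, q i (t i) := by
  have h : ∀ ψ : ι → Γ, (∏ i, q i (ψ i)) * cylinder S t ψ =
      ∏ i, q i (ψ i) * (if i ∈ S → ψ i = t i then 1 else 0) := by
    intro ψ
    rw [Finset.prod_mul_distrib, Finset.prod_ite_zero]
    simp [cylinder]
  simp only [prodExp, h]
  rw [← Fintype.prod_sum fun i u => q i u * (if i ∈ S → u = t i then (1 : ℝ) else 0),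
    ← Finset.prod_subset (Finset.subset_univ S)]
  · refine Finset.prod_congr rfl fun i hi => ?_
    simp [hi]
  · intro i _ hi
    simp [hi, hs]

lemma prodExp_add (B B' : (ι → Γ) → ℝ) (q : ι → Γ → ℝ) :
    prodExp (fun ψ => B ψ + B' ψ) q = prodExp B q + prodExp B' q := by
  simp [prodExp, mul_add, Finset.sum_add_distrib]

lemma prodExp_const_mul (a : ℝ) (B : (ι → Γ) → ℝ) (q : ι → Γ → ℝ) :
    prodExp (fun ψ => a * B ψ) q = a * prodExp B q := by
  simp only [prodExp, Finset.mul_sum]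
  exact Finset.sum_congr rfl fun ψ _ => by ring

lemma prodExp_sum {κ : Type*} (s : Finset κ) (B : κ → (ι → Γ) → ℝ) (q : ι → Γ → ℝ) :
    prodExp (fun ψ => ∑ a ∈ s, B a ψ) q = ∑ a ∈ s, prodExp (B a) q := by
  simp only [prodExp, Finset.mul_sum]
  exact Finset.sum_comm

end ProductExpectation

section Hybrid

variable {Ω γ ι Γ : Type*} {γ' : ι → Type*} [Fintype Ω] [Fintype ι] [Fintype Γ]

/-- Comparison of the law of `X` with the product of its conditional marginals given `Z`. -/
lemma sum_apply_le_sum_prodExp (Z : Ω → γ) (Z' : ∀ e, Ω → γ' e) (X : ι → Ω → Γ)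
    (hZ : ∀ e ω ω', Z' e ω = Z' e ω' → Z ω = Z ω')
    (hX : ∀ e e', e' ≠ e → ∀ ω ω', Z' e ω = Z' e ω' → X e' ω = X e' ω')
    (B : (ι → Γ) → ℝ) (hB0 : ∀ ψ, 0 ≤ B ψ) (hB1 : ∀ ψ, B ψ ≤ 1) :
    ∑ ω, B (fun e => X e ω) ≤ ∑ ω, prodExp B (fun e => condProb Z (X e) ω) +
      ∑ e, ∑ t, ∑ ω, |condProb (Z' e) (X e) ω t - condProb Z (X e) ω t| := by
  set q : Finset ι → Ω → ι → Γ → ℝ := fun D ω e t =>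
    if e ∈ D then condProb Z (X e) ω t else if X e ω = t then 1 else 0 with hq
  have hq0 : ∀ D ω e t, 0 ≤ q D ω e t := by
    intro D ω e t
    simp only [hq]
    split_ifs <;> first | exact condProb_nonneg _ _ _ _ | norm_num
  have hq1 : ∀ D ω e, ∑ t, q D ω e t = 1 := by
    intro D ω e
    simp only [hq]
    split_ifs
    · exact sum_condProb _ _ _
    · simp
  have main : ∀ D : Finset ι, ∑ ω, B (fun e => X e ω) ≤ ∑ ω, prodExp B (q D ω) +
      ∑ e ∈ D, ∑ t, ∑ ω, |condProb (Z' e) (X e) ω t - condProb Z (X e) ω t| := by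
    intro D
    induction D using Finset.induction_on with
    | empty =>
      simp only [Finset.sum_empty, add_zero]
      refine Finset.sum_le_sum fun ω _ => ?_
      simp only [prodExp, hq]
      refine le_trans (le_of_eq ?_) (Finset.single_le_sum (f := fun ψ : ι → Γ =>
        (∏ i, (if i ∈ (∅ : Finset ι) then condProb Z (X i) ω (ψ i)
          else if X i ω = ψ i then (1 : ℝ) else 0)) * B ψ) (fun ψ _ => ?_)
          (Finset.mem_univ fun e => X e ω))
      · simp
      · exact mul_nonneg (Finset.prod_nonneg fun i _ => hq0 ∅ ω i (ψ i)) (hB0 ψ)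
    | insert e D he ih =>
      rw [Finset.sum_insert he]
      set R : Γ → Ω → ℝ := fun t ω =>
        prodExp B (Function.update (q D ω) e fun u => if u = t then 1 else 0) with hR
      have hR0 : ∀ t ω, 0 ≤ R t ω := fun t ω => prodExp_nonneg hB0 fun i u => by
        rcases eq_or_ne i e with rfl | hi
        · simp only [Function.update_self]
          split_ifs <;> norm_num
        · rw [Function.update_of_ne hi]
          exact hq0 _ _ _ _
      have hR1 : ∀ t ω, R t ω ≤ 1 := fun t ω => by
        refine (prodExp_mono hB1 fun i u => ?_).trans (prodExp_one fun i => ?_).le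
        · rcases eq_or_ne i e with rfl | hi
          · simp only [Function.update_self]
            split_ifs <;> norm_num
          · rw [Function.update_of_ne hi]
            exact hq0 _ _ _ _
        · rcases eq_or_ne i e with rfl | hi
          · simp
          · rw [Function.update_of_ne hi]
            exact hq1 _ _ _
      have hRZ : ∀ t ω ω', Z' e ω = Z' e ω' → R t ω = R t ω' := by
        intro t ω ω' h
        simp only [hR]
        congr 1
        funext i
        rcases eq_or_ne i e with rfl | hi
        · simp
        · rw [Function.update_of_ne hi, Function.update_of_ne hi]
          funext u
          simp only [hq]
          rw [condProb_congr Z (X i) (hZ e _ _ h), hX e i hi _ _ h]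
      have e1 : ∀ ω, prodExp B (q D ω) = ∑ t, (if X e ω = t then 1 else 0) * R t ω := by
        intro ω
        rw [prodExp_eq_sum_update B (q D ω) e]
        simp [hq, he, hR]
      have e2 : ∀ ω, prodExp B (q (insert e D) ω) = ∑ t, condProb Z (X e) ω t * R t ω := by
        intro ω
        rw [prodExp_eq_sum_update B (q (insert e D) ω) e]
        refine Finset.sum_congr rfl fun t _ => ?_
        simp only [hR]
        congr 1
        · simp [hq]
        · congr 1
          funext i
          rcases eq_or_ne i e with rfl | hi
          · simp
          · rw [Function.update_of_ne hi, Function.update_of_ne hi]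
            simp [hq, hi]
      have e3 : ∑ ω, prodExp B (q D ω) = ∑ t, ∑ ω, condProb (Z' e) (X e) ω t * R t ω := by
        rw [Finset.sum_congr rfl fun ω _ => e1 ω, Finset.sum_comm]
        refine Finset.sum_congr rfl fun t _ => ?_
        exact (sum_condAvg_mul (Z' e) _ (R t) (hRZ t)).symm
      have e4 : ∑ ω, prodExp B (q (insert e D) ω) =
          ∑ t, ∑ ω, condProb Z (X e) ω t * R t ω := by
        rw [Finset.sum_congr rfl fun ω _ => e2 ω, Finset.sum_comm]
      have e5 : ∑ ω, prodExp B (q D ω) ≤ ∑ ω, prodExp B (q (insert e D) ω) +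
          ∑ t, ∑ ω, |condProb (Z' e) (X e) ω t - condProb Z (X e) ω t| := by
        rw [e3, e4, ← Finset.sum_add_distrib]
        refine Finset.sum_le_sum fun t _ => ?_
        rw [← Finset.sum_add_distrib]
        refine Finset.sum_le_sum fun ω _ => ?_
        have := le_abs_self (condProb (Z' e) (X e) ω t - condProb Z (X e) ω t)
        have h2 := abs_nonneg (condProb (Z' e) (X e) ω t - condProb Z (X e) ω t)
        nlinarith [hR0 t ω, hR1 t ω]
      linarith
  have := main Finset.univ
  simpa [hq] using this

end Hybrid

/-- A function with few values carries little information about most uniform random bits. -/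
lemma sum_condAvg_sign_sq_le {ι γ : Type*} [Fintype ι] [DecidableEq ι] [Fintype γ]
    (Z : (ι → Bool) → γ) :
    ∑ ω, ∑ e, condAvg Z (fun ω => if ω e then 1 else -1) ω ^ 2 ≤
      2 * Real.log (Fintype.card γ) * Fintype.card (ι → Bool) := by
  set x : ι → (ι → Bool) → ℝ := fun e ω => if ω e then 1 else -1 with hx
  set b : ι → (ι → Bool) → ℝ := fun e => condAvg Z (x e) with hb
  set β : γ → ι → ℝ := fun z e => if h : ∃ ω, Z ω = z then b e h.choose else 0 with hβ
  have hβb : ∀ ω e, β (Z ω) e = b e ω := by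
    intro ω e
    have h : ∃ ω', Z ω' = Z ω := ⟨ω, rfl⟩
    simp only [hβ, h, dif_pos]
    exact condAvg_congr Z _ h.choose_spec
  have hmgf : ∀ v : ι → ℝ, ∑ ω, Real.exp (∑ e, (v e * x e ω - v e ^ 2 / 2)) ≤
      Fintype.card (ι → Bool) := by
    intro v
    have h1 : ∀ ω : ι → Bool, Real.exp (∑ e, (v e * x e ω - v e ^ 2 / 2)) =
        ∏ e, Real.exp (v e * (if ω e then 1 else -1) - v e ^ 2 / 2) := fun ω => Real.exp_sum _ _
    simp only [h1]
    rw [← Fintype.prod_sum fun e (s : Bool) =>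
      Real.exp (v e * (if s then 1 else -1) - v e ^ 2 / 2)]
    have h2 : ∀ e, ∑ s : Bool, Real.exp (v e * (if s then 1 else -1) - v e ^ 2 / 2) ≤ 2 := by
      intro e
      have h3 := Real.cosh_le_exp_half_sq (v e)
      rw [Real.cosh_eq] at h3
      simp only [Fintype.sum_bool, if_true, Bool.false_eq_true, if_false, mul_one, mul_neg]
      rw [Real.exp_sub, Real.exp_sub, ← add_div, div_le_iff₀ (Real.exp_pos _)]
      linarith
    refine (Finset.prod_le_prod (fun e _ => Finset.sum_nonneg fun s _ => (Real.exp_pos _).le)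
      fun e _ => h2 e).trans (le_of_eq ?_)
    simp
  set Y : (ι → Bool) → ℝ := fun ω => ∑ e, (b e ω * x e ω - b e ω ^ 2 / 2) with hY
  have hYsum : ∑ ω, Y ω = (∑ ω, ∑ e, b e ω ^ 2) / 2 := by
    have h4 : ∀ e, ∑ ω, b e ω * x e ω = ∑ ω, b e ω ^ 2 := by
      intro e
      have := sum_condAvg_mul Z (x e) (b e) fun ω ω' h => condAvg_congr Z _ h
      simp only [pow_two]
      rw [this]
      exact Finset.sum_congr rfl fun ω _ => mul_comm _ _
    simp only [hY]
    rw [Finset.sum_comm, Finset.sum_comm (f := fun ω e => b e ω ^ 2), Finset.sum_div]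
    refine Finset.sum_congr rfl fun e _ => ?_
    rw [Finset.sum_sub_distrib, h4, ← Finset.sum_div]
    ring
  have hexp : ∑ ω, Real.exp (Y ω) ≤ Fintype.card γ * Fintype.card (ι → Bool) := by
    calc ∑ ω, Real.exp (Y ω)
        ≤ ∑ ω, ∑ z, Real.exp (∑ e, (β z e * x e ω - β z e ^ 2 / 2)) := by
          refine Finset.sum_le_sum fun ω _ => ?_
          refine le_trans (le_of_eq ?_) (Finset.single_le_sum
            (f := fun z => Real.exp (∑ e, (β z e * x e ω - β z e ^ 2 / 2)))
            (fun z _ => (Real.exp_pos _).le) (Finset.mem_univ (Z ω)))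
          simp only [hβb, hY]
      _ = ∑ z, ∑ ω, Real.exp (∑ e, (β z e * x e ω - β z e ^ 2 / 2)) := Finset.sum_comm
      _ ≤ ∑ _z : γ, (Fintype.card (ι → Bool) : ℝ) := Finset.sum_le_sum fun z _ => hmgf _
      _ = _ := by simp
  have hpos : (0 : ℝ) < Fintype.card γ := by
    exact_mod_cast Fintype.card_pos_iff.mpr ⟨Z fun _ => true⟩
  have hlin : ∑ ω, (Y ω - Real.log (Fintype.card γ) + 1) ≤ Fintype.card (ι → Bool) := by
    calc ∑ ω, (Y ω - Real.log (Fintype.card γ) + 1)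
        ≤ ∑ ω, Real.exp (Y ω) / Fintype.card γ := by
          refine Finset.sum_le_sum fun ω _ => ?_
          refine (Real.add_one_le_exp _).trans (le_of_eq ?_)
          rw [Real.exp_sub, Real.exp_log hpos]
      _ ≤ _ := by
          rw [← Finset.sum_div, div_le_iff₀ hpos]
          linarith
  rw [Finset.sum_add_distrib, Finset.sum_sub_distrib, hYsum] at hlin
  simp only [Finset.sum_const, Finset.card_univ, nsmul_eq_mul, mul_one] at hlin
  linarith

/-- A probability distribution on monochromatic cliques that is spread out: it meets no small
set of vertices often. -/
lemma exists_spread_mono_clique {V : Type*} [Fintype V] [DecidableEq V] {r : ℕ} (hr : 1 ≤ r)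
    (χ : V → V → Fin r) (hχ : ∀ x y, χ x y = χ y x) {θ ℓ : ℝ} (hθ : 1 ≤ θ) (hℓ : 1 ≤ ℓ) (u : ℕ)
    (m : ℕ) : ∀ (κ : Fin r → ℕ), ∑ j, κ j = m → ∀ X : Finset V, ℓ * (2 * r) ^ m ≤ X.card →
      ∃ w : Fin r × Finset V → ℝ, (∀ a, 0 ≤ w a) ∧ ∑ a, w a = 1 ∧
        (∀ a, w a ≠ 0 → a.2 ⊆ X ∧ a.2.card = κ a.1 ∧
          ∀ x ∈ a.2, ∀ y ∈ a.2, x ≠ y → χ x y = a.1) ∧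
        ∀ U : Finset V, U.card ≤ u →
          ∑ a, w a * θ ^ (a.2 ∩ U).card ≤ (1 + θ * u / ℓ) ^ m := by
  have hr' : (1 : ℝ) ≤ r := by exact_mod_cast hr
  have hratio : 0 ≤ θ * u / ℓ := by positivity
  have base : ∀ (m : ℕ) (κ : Fin r → ℕ) (X : Finset V), (∃ j, κ j = 0) →
      ∃ w : Fin r × Finset V → ℝ, (∀ a, 0 ≤ w a) ∧ ∑ a, w a = 1 ∧
        (∀ a, w a ≠ 0 → a.2 ⊆ X ∧ a.2.card = κ a.1 ∧
          ∀ x ∈ a.2, ∀ y ∈ a.2, x ≠ y → χ x y = a.1) ∧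
        ∀ U : Finset V, U.card ≤ u →
          ∑ a, w a * θ ^ (a.2 ∩ U).card ≤ (1 + θ * u / ℓ) ^ m := by
    rintro m κ X ⟨j, hj⟩
    refine ⟨fun a => if a = (j, ∅) then 1 else 0, fun a => by dsimp only; split_ifs <;> norm_num,
      by simp,
      fun a ha => ?_, fun U _ => ?_⟩
    · have : a = (j, ∅) := by
        by_contra h
        simp [h] at ha
      subst this
      simp [hj]
    · simp only [ite_mul, one_mul, zero_mul, Finset.sum_ite_eq', Finset.mem_univ, if_true,
        Finset.empty_inter, Finset.card_empty, pow_zero]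
      exact one_le_pow₀ (by linarith)
  induction m with
  | zero =>
    intro κ hκ X _
    exact base 0 κ X ⟨⟨0, hr⟩, by simpa using (Finset.sum_eq_zero_iff.mp hκ) ⟨0, hr⟩⟩
  | succ m ih =>
    intro κ hκ X hX
    by_cases h0 : ∃ j, κ j = 0
    · exact base _ κ X h0
    push Not at h0
    have hpow : (1 : ℝ) ≤ (2 * r) ^ m := one_le_pow₀ (by linarith)
    have hX' : ℓ * (2 * r) ^ m * (2 * r) ≤ X.card := by rw [mul_assoc, ← pow_succ]; exact hX
    have hXℓ : ℓ ≤ X.card := by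
      have h1 : ℓ * 1 ≤ ℓ * (2 * r) ^ m := mul_le_mul_of_nonneg_left hpow (by linarith)
      nlinarith
    have hX2 : (2 : ℝ) ≤ X.card := by
      have h1 : 1 * 1 ≤ ℓ * (2 * r) ^ m := mul_le_mul hℓ hpow (by norm_num) (by linarith)
      nlinarith
    have step : ∀ v : V, ∃ (c : Fin r) (w : Fin r × Finset V → ℝ), v ∈ X →
        (∀ a, 0 ≤ w a) ∧ ∑ a, w a = 1 ∧
        (∀ a, w a ≠ 0 → a.2 ⊆ (X.erase v).filter (fun x => χ v x = c) ∧
          a.2.card = Function.update κ c (κ c - 1) a.1 ∧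
          ∀ x ∈ a.2, ∀ y ∈ a.2, x ≠ y → χ x y = a.1) ∧
        ∀ U : Finset V, U.card ≤ u →
          ∑ a, w a * θ ^ (a.2 ∩ U).card ≤ (1 + θ * u / ℓ) ^ m := by
      intro v
      by_cases hv : v ∈ X
      swap
      · exact ⟨⟨0, hr⟩, 0, fun h => absurd h hv⟩
      obtain ⟨c, hc⟩ : ∃ c : Fin r, ℓ * (2 * r) ^ m ≤
          ((X.erase v).filter fun x => χ v x = c).card := by
        by_contra! hcon
        have h1 : ((X.erase v).card : ℝ) =
            ∑ c : Fin r, (((X.erase v).filter fun x => χ v x = c).card : ℝ) := by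
          exact_mod_cast Finset.card_eq_sum_card_fiberwise fun x _ => Finset.mem_univ (χ v x)
        have h2 : ((X.erase v).card : ℝ) ≤ r * (ℓ * (2 * r) ^ m) := by
          rw [h1]
          refine (Finset.sum_le_sum fun c _ => (hcon c).le).trans ?_
          simp
        have h3 : ((X.erase v).card : ℝ) = X.card - 1 := by
          rw [Finset.card_erase_of_mem hv, Nat.cast_sub (Finset.card_pos.mpr ⟨v, hv⟩)]
          simp
        rcases (hX2.lt_or_eq) with h4 | h4
        · nlinarith
        · have h5 : ∑ c : Fin r, (((X.erase v).filter fun x => χ v x = c).card : ℝ) <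
              ∑ _c : Fin r, ℓ * (2 * r) ^ m :=
            Finset.sum_lt_sum_of_nonempty ⟨⟨0, hr⟩, Finset.mem_univ _⟩ fun c _ => hcon c
          rw [← h1] at h5
          simp only [Finset.sum_const, Finset.card_univ, Fintype.card_fin, nsmul_eq_mul] at h5
          nlinarith
      have hsum : ∑ j, Function.update κ c (κ c - 1) j = m := by
        have h1 := Finset.sum_update_of_mem (Finset.mem_univ c) κ (κ c - 1)
        have h2 := Finset.add_sum_erase Finset.univ κ (Finset.mem_univ c)
        rw [Finset.sdiff_singleton_eq_erase] at h1
        have h3 := h0 c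
        omega
      obtain ⟨w, hw⟩ := ih _ hsum _ hc
      exact ⟨c, w, fun _ => hw⟩
    choose c w hw using step
    set out : V → Fin r × Finset V → Fin r × Finset V := fun v a =>
      (a.1, if a.1 = c v then insert v a.2 else a.2) with hout
    set W : Fin r × Finset V → ℝ := fun a =>
      (∑ v ∈ X, ∑ a', w v a' * if out v a' = a then 1 else 0) / X.card with hW
    have hWint : ∀ g : Fin r × Finset V → ℝ,
        ∑ a, W a * g a = (∑ v ∈ X, ∑ a', w v a' * g (out v a')) / X.card := by
      intro g
      simp only [hW, div_mul_eq_mul_div, ← Finset.sum_div, Finset.sum_mul]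
      congr 1
      rw [Finset.sum_comm]
      refine Finset.sum_congr rfl fun v _ => ?_
      rw [Finset.sum_comm]
      refine Finset.sum_congr rfl fun a' _ => ?_
      simp
    refine ⟨W, fun a => ?_, ?_, fun a ha => ?_, fun U hU => ?_⟩
    · refine div_nonneg (Finset.sum_nonneg fun v hv => Finset.sum_nonneg fun a' _ => ?_)
        (Nat.cast_nonneg _)
      exact mul_nonneg ((hw v hv).1 a') (by split_ifs <;> norm_num)
    · have := hWint fun _ => 1
      simp only [mul_one] at this
      rw [this, Finset.sum_congr rfl fun v hv => (hw v hv).2.1]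
      simp only [Finset.sum_const, nsmul_eq_mul, mul_one]
      exact div_self (by linarith)
    · obtain ⟨v, hv, a', ha', rfl⟩ : ∃ v ∈ X, ∃ a', w v a' ≠ 0 ∧ out v a' = a := by
        by_contra! hcon
        apply ha
        simp only [hW]
        rw [Finset.sum_eq_zero, zero_div]
        intro v hv
        refine Finset.sum_eq_zero fun a' _ => ?_
        by_cases h : w v a' = 0
        · simp [h]
        · simp [hcon v hv a' h]
      obtain ⟨hsub, hcard, hmono⟩ := (hw v hv).2.2.1 a' ha'
      have hsubX : a'.2 ⊆ X := fun x hx =>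
        Finset.mem_of_mem_erase (Finset.mem_filter.mp (hsub hx)).1
      have hva : v ∉ a'.2 := fun h => by simpa using hsub h
      by_cases hcv : a'.1 = c v
      · simp only [hout, hcv, if_true]
        refine ⟨Finset.insert_subset hv hsubX, ?_, ?_⟩
        · rw [Finset.card_insert_of_notMem hva, hcard, hcv, Function.update_self]
          have := h0 (c v)
          omega
        · have hvx : ∀ x ∈ a'.2, χ v x = c v := fun x hx => (Finset.mem_filter.mp (hsub hx)).2
          intro x hx y hy hxy
          rcases Finset.mem_insert.mp hx with hxv | hxQ
          · rcases Finset.mem_insert.mp hy with hyv | hyQ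
            · exact absurd (hxv.trans hyv.symm) hxy
            · rw [hxv]
              exact hvx y hyQ
          · rcases Finset.mem_insert.mp hy with hyv | hyQ
            · rw [hχ, hyv]
              exact hvx x hxQ
            · rw [← hcv]
              exact hmono x hxQ y hyQ hxy
      · simp only [hout, hcv, if_false]
        refine ⟨hsubX, ?_, hmono⟩
        rw [hcard, Function.update_of_ne hcv]
    · rw [hWint fun a => θ ^ (a.2 ∩ U).card, div_le_iff₀ (by linarith)]
      have h1 : ∀ v ∈ X, ∑ a', w v a' * θ ^ ((out v a').2 ∩ U).card ≤
          (1 + (if v ∈ U then θ else 0)) * (1 + θ * u / ℓ) ^ m := by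
        intro v hv
        have h2 : ∀ a' : Fin r × Finset V, θ ^ ((out v a').2 ∩ U).card ≤
            (1 + (if v ∈ U then θ else 0)) * θ ^ (a'.2 ∩ U).card := by
          intro a'
          have hp : 0 < θ ^ (a'.2 ∩ U).card := by positivity
          have h3 : (out v a').2 ∩ U ⊆ if v ∈ U then insert v (a'.2 ∩ U) else a'.2 ∩ U := by
            intro x hx
            simp only [hout] at hx
            by_cases hvU : v ∈ U <;> by_cases hcv : a'.1 = c v <;>
              simp only [hvU, hcv, if_true, if_false, Finset.mem_inter, Finset.mem_insert] at hx ⊢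
            · tauto
            · tauto
            · rcases hx with ⟨rfl | hx, hxU⟩
              · exact absurd hxU hvU
              · exact ⟨hx, hxU⟩
            · exact hx
          have h4 := Finset.card_le_card h3
          by_cases hvU : v ∈ U
          · simp only [hvU, if_true] at h4 ⊢
            calc θ ^ ((out v a').2 ∩ U).card ≤ θ ^ ((a'.2 ∩ U).card + 1) :=
                  pow_le_pow_right₀ hθ (h4.trans (Finset.card_insert_le _ _))
              _ ≤ _ := by rw [pow_succ]; nlinarith
          · simp only [hvU, if_false] at h4 ⊢
            simpa using pow_le_pow_right₀ hθ h4
        calc _ ≤ ∑ a', w v a' * ((1 + (if v ∈ U then θ else 0)) * θ ^ (a'.2 ∩ U).card) :=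
              Finset.sum_le_sum fun a' _ => mul_le_mul_of_nonneg_left (h2 a') ((hw v hv).1 a')
          _ = (1 + (if v ∈ U then θ else 0)) * ∑ a', w v a' * θ ^ (a'.2 ∩ U).card := by
              rw [Finset.mul_sum]
              exact Finset.sum_congr rfl fun a' _ => by ring
          _ ≤ _ := mul_le_mul_of_nonneg_left ((hw v hv).2.2.2 U hU)
              (by split_ifs <;> linarith)
      refine (Finset.sum_le_sum h1).trans ?_
      rw [← Finset.sum_mul, pow_succ', mul_right_comm]
      refine mul_le_mul_of_nonneg_right ?_ (by positivity)
      rw [Finset.sum_add_distrib, ← Finset.sum_filter, Finset.sum_const, Finset.sum_const,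
        nsmul_eq_mul, nsmul_eq_mul, mul_one, add_mul, one_mul]
      have h5 : ((X.filter fun v => v ∈ U).card : ℝ) ≤ u := by
        exact_mod_cast (Finset.card_le_card fun x hx => (Finset.mem_filter.mp hx).2).trans hU
      have h6 : θ * u / ℓ * ℓ ≤ θ * u / ℓ * X.card := mul_le_mul_of_nonneg_left hXℓ hratio
      rw [div_mul_cancel₀ _ (by linarith : ℓ ≠ 0)] at h6
      nlinarith

/-- The assignment `ψ` of colours, or `none` for a non-edge, to the pairs of points of `Fin K`
contains a monochromatic induced copy of `H`. -/
def HasCopy {r k K : ℕ} (H : SimpleGraph (Fin k))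
    (ψ : {e : Fin K × Fin K // e.1 < e.2} → Option (Fin r)) : Prop :=
  ∃ (j : Fin r) (φ : Fin k → Fin K), Function.Injective φ ∧
    ∀ a b (h : φ a < φ b), ψ ⟨(φ a, φ b), h⟩ = if H.Adj a b then some j else none

set_option maxHeartbeats 400000 in
/-- Under a product law in which every pair is a non-edge, and has some colour, with probability
at least `ε`, a monochromatic copy of `H` appears with probability at least one half. -/
lemma prodExp_no_copy_le_half {r k K : ℕ} (hr : 1 ≤ r) (hk : 1 ≤ k) (H : SimpleGraph (Fin k))
    (p : {e : Fin K × Fin K // e.1 < e.2} → Option (Fin r) → ℝ) {ε : ℝ} (hε : 0 < ε)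
    (hε1 : ε ≤ 1) (hp0 : ∀ e t, 0 ≤ p e t) (hp1 : ∀ e, ∑ t, p e t = 1)
    (hnone : ∀ e, ε ≤ p e none) (hsome : ∀ e, ∃ c, ε ≤ p e (some c))
    (hK : 2 * r * k ^ 2 * ε⁻¹ ^ k * (2 * r) ^ (r * k) ≤ K) :
    prodExp (fun ψ => if HasCopy H ψ then 0 else 1) p ≤ 1 / 2 := by
  have hr' : (1 : ℝ) ≤ r := by exact_mod_cast hr
  have hk' : (1 : ℝ) ≤ k := by exact_mod_cast hk
  set θ : ℝ := ε⁻¹ ^ k with hθdef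
  have hεi : 1 ≤ ε⁻¹ := (one_le_inv₀ hε).mpr hε1
  have hθ : 1 ≤ θ := one_le_pow₀ hεi
  set ℓ : ℝ := 2 * r * k ^ 2 * θ with hℓdef
  have hℓ : 1 ≤ ℓ := by
    have h1 : (1 : ℝ) ≤ k ^ 2 := one_le_pow₀ hk'
    have h2 : (1 : ℝ) ≤ r * k ^ 2 := by nlinarith
    nlinarith
  have hKpos : 0 < K := by
    have h1 : (1 : ℝ) ≤ (2 * r) ^ (r * k) := one_le_pow₀ (by linarith)
    have h2 : (1 : ℝ) ≤ K := by nlinarith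
    exact_mod_cast (by linarith : (0 : ℝ) < K)
  choose χE hχE using hsome
  set χ : Fin K → Fin K → Fin r := fun x y =>
    if h : x < y then χE ⟨(x, y), h⟩ else if h : y < x then χE ⟨(y, x), h⟩ else ⟨0, hr⟩ with hχdef
  have hχsymm : ∀ x y, χ x y = χ y x := by
    intro x y
    rcases lt_trichotomy x y with h | h | h
    · simp [hχdef, h, h.not_gt]
    · rw [h]
    · simp [hχdef, h, h.not_gt]
  obtain ⟨w, hw0, hw1, hwsupp, hwspread⟩ := exists_spread_mono_clique hr χ hχsymm hθ hℓ k (r * k)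
    (fun _ => k) (by simp) Finset.univ (by simpa using hK)
  have hφ : ∀ Q : Finset (Fin K), ∃ φ : Fin k → Fin K,
      Q.card = k → Function.Injective φ ∧ ∀ a, φ a ∈ Q := by
    intro Q
    by_cases h : Q.card = k
    · refine ⟨fun a => (Q.equivFinOfCardEq h).symm a, fun _ => ⟨fun a b hab => ?_, fun a => ?_⟩⟩
      · simpa using Subtype.ext hab
      · simp
    · exact ⟨fun _ => ⟨0, hKpos⟩, fun h' => absurd h' h⟩
  choose φ hφ using hφ
  set S : Finset (Fin K) → Finset {e : Fin K × Fin K // e.1 < e.2} := fun Q =>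
    Finset.univ.filter fun e => e.1.1 ∈ Q ∧ e.1.2 ∈ Q with hS
  set t : Fin r × Finset (Fin K) → {e : Fin K × Fin K // e.1 < e.2} → Option (Fin r) := fun a e =>
    if ∃ x y, φ a.2 x = e.1.1 ∧ φ a.2 y = e.1.2 ∧ H.Adj x y then some a.1 else none with ht
  set P : Fin r × Finset (Fin K) → ℝ := fun a => ∏ e ∈ S a.2, p e (t a e) with hP
  set M : Fin r × Finset (Fin K) → ({e : Fin K × Fin K // e.1 < e.2} → Option (Fin r)) → ℝ :=
    fun a => cylinder (S a.2) (t a) with hM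
  have hpt : ∀ a, w a ≠ 0 → ∀ e ∈ S a.2, ε ≤ p e (t a e) := by
    intro a ha e he
    simp only [hS, Finset.mem_filter, Finset.mem_univ, true_and] at he
    simp only [ht]
    split_ifs
    · have h1 := (hwsupp a ha).2.2 _ he.1 _ he.2 e.2.ne
      have h2 : χ e.1.1 e.1.2 = χE e := by
        simp only [hχdef, e.2, dif_pos]
      rw [← h1, h2]
      exact hχE e
    · exact hnone e
  have hPpos : ∀ a, w a ≠ 0 → 0 < P a := fun a ha =>
    Finset.prod_pos fun e he => hε.trans_le (hpt a ha e he)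
  have hEM : ∀ a, prodExp (M a) p = P a := fun a => prodExp_cylinder hp1 _ _
  have hcard : ∀ Q Q' : Finset (Fin K), Q'.card ≤ k → (S Q ∩ S Q').card ≤ k * (Q' ∩ Q).card := by
    intro Q Q' hQ'
    have h1 : ((S Q ∩ S Q').map (Function.Embedding.subtype _)) ⊆ (Q' ∩ Q) ×ˢ (Q' ∩ Q) := by
      intro e he
      simp only [hS, Finset.mem_map, Finset.mem_inter, Finset.mem_filter, Finset.mem_univ,
        true_and, Function.Embedding.subtype_apply] at he
      obtain ⟨e', ⟨h1, h2⟩, rfl⟩ := he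
      simp only [Finset.mem_product, Finset.mem_inter]
      exact ⟨⟨h2.1, h1.1⟩, ⟨h2.2, h1.2⟩⟩
    have h2 := Finset.card_le_card h1
    rw [Finset.card_map, Finset.card_product] at h2
    exact h2.trans (Nat.mul_le_mul_right _
      ((Finset.card_le_card Finset.inter_subset_left).trans hQ'))
  have hEMM : ∀ a a', w a ≠ 0 → w a' ≠ 0 →
      prodExp (fun ψ => M a ψ * M a' ψ) p ≤ P a * P a' * θ ^ (a'.2 ∩ a.2).card := by
    intro a a' ha ha'
    have h1 : prodExp (fun ψ => M a ψ * M a' ψ) p ≤ ∏ e ∈ S a.2 ∪ S a'.2,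
        p e (if e ∈ S a.2 then t a e else t a' e) := by
      rw [← prodExp_cylinder hp1]
      refine prodExp_mono (fun ψ => ?_) hp0
      simp only [hM]
      by_cases hA : ∀ e ∈ S a.2, ψ e = t a e
      · by_cases hA' : ∀ e ∈ S a'.2, ψ e = t a' e
        · have hAA' : ∀ e ∈ S a.2 ∪ S a'.2, ψ e = if e ∈ S a.2 then t a e else t a' e := by
            intro e he
            split_ifs with h
            · exact hA e h
            · exact hA' e ((Finset.mem_union.mp he).resolve_left h)
          rw [cylinder_of_forall hA, cylinder_of_forall hA', cylinder_of_forall hAA', one_mul]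
        · rw [cylinder_of_not_forall hA', mul_zero]
          exact cylinder_nonneg _ _ _
      · rw [cylinder_of_not_forall hA, zero_mul]
        exact cylinder_nonneg _ _ _
    have h2 : ∏ e ∈ S a.2 ∪ S a'.2, p e (if e ∈ S a.2 then t a e else t a' e) =
        P a * ∏ e ∈ S a'.2 \ S a.2, p e (t a' e) := by
      rw [← Finset.union_sdiff_self_eq_union, Finset.prod_union Finset.disjoint_sdiff]
      congr 1
      · exact Finset.prod_congr rfl fun e he => by rw [if_pos he]
      · exact Finset.prod_congr rfl fun e he => by rw [if_neg (Finset.mem_sdiff.mp he).2]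
    have h3 : P a' = (∏ e ∈ S a'.2 \ S a.2, p e (t a' e)) *
        ∏ e ∈ S a.2 ∩ S a'.2, p e (t a' e) := by
      rw [Finset.inter_comm, mul_comm]
      exact (Finset.prod_inter_mul_prod_sdiff _ _ _).symm
    have h4 : ε ^ (S a.2 ∩ S a'.2).card ≤ ∏ e ∈ S a.2 ∩ S a'.2, p e (t a' e) := by
      rw [← Finset.prod_const]
      exact Finset.prod_le_prod (fun _ _ => hε.le) fun e he =>
        hpt a' ha' e (Finset.mem_inter.mp he).2
    have h5 : (θ ^ (a'.2 ∩ a.2).card)⁻¹ ≤ ε ^ (S a.2 ∩ S a'.2).card := by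
      rw [hθdef, ← pow_mul, ← inv_pow, inv_inv]
      exact pow_le_pow_of_le_one hε.le hε1 (hcard _ _ (hwsupp a' ha').2.1.le)
    have h6 : 0 ≤ ∏ e ∈ S a'.2 \ S a.2, p e (t a' e) := Finset.prod_nonneg fun e _ => hp0 _ _
    have h7 : ∏ e ∈ S a'.2 \ S a.2, p e (t a' e) ≤ P a' * θ ^ (a'.2 ∩ a.2).card := by
      have hθp : 0 < θ ^ (a'.2 ∩ a.2).card := by positivity
      rw [← div_le_iff₀ hθp, div_eq_mul_inv, h3]
      exact mul_le_mul_of_nonneg_left (h5.trans h4) h6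
    calc _ ≤ _ := h1
      _ = _ := h2
      _ ≤ P a * (P a' * θ ^ (a'.2 ∩ a.2).card) := mul_le_mul_of_nonneg_left h7 (hPpos a ha).le
      _ = _ := by ring
  set Y : ({e : Fin K × Fin K // e.1 < e.2} → Option (Fin r)) → ℝ := fun ψ =>
    ∑ a, w a * (P a)⁻¹ * M a ψ with hY
  have hEY : prodExp Y p = 1 := by
    rw [hY, prodExp_sum, ← hw1]
    refine Finset.sum_congr rfl fun a _ => ?_
    rw [prodExp_const_mul, hEM]
    by_cases ha : w a = 0
    · simp [ha]
    · have := (hPpos a ha).ne'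
      field_simp
  have hpow : (1 + θ * k / ℓ) ^ (r * k) ≤ 2 := by
    have h1 : θ * k / ℓ = 1 / (2 * (r * k)) := by
      rw [hℓdef]
      field_simp
    have h2 : (1 + θ * k / ℓ) ≤ Real.exp (1 / (2 * (r * k))) := by
      rw [h1, add_comm]
      exact Real.add_one_le_exp _
    have h3 : (1 + θ * k / ℓ) ^ (r * k) ≤ Real.exp (1 / 2) := by
      refine (pow_le_pow_left₀ (by positivity) h2 _).trans (le_of_eq ?_)
      rw [← Real.exp_nat_mul]
      congr 1
      push_cast
      field_simp
    refine h3.trans ?_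
    have h4 : Real.exp (1 / 2) * Real.exp (1 / 2) = Real.exp 1 := by
      rw [← Real.exp_add]
      norm_num
    nlinarith [Real.exp_one_lt_d9, Real.exp_pos (1 / 2)]
  have hEYY : prodExp (fun ψ => Y ψ ^ 2) p ≤ 2 := by
    have h1 : ∀ ψ, Y ψ ^ 2 = ∑ a, ∑ a', w a * (P a)⁻¹ * (w a' * (P a')⁻¹) * (M a ψ * M a' ψ) := by
      intro ψ
      rw [pow_two, hY, Finset.sum_mul_sum]
      exact Finset.sum_congr rfl fun a _ => Finset.sum_congr rfl fun a' _ => by ring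
    have h2 : prodExp (fun ψ => Y ψ ^ 2) p = ∑ a, ∑ a', w a * (P a)⁻¹ * (w a' * (P a')⁻¹) *
        prodExp (fun ψ => M a ψ * M a' ψ) p := by
      simp only [h1]
      rw [prodExp_sum]
      refine Finset.sum_congr rfl fun a _ => ?_
      rw [prodExp_sum]
      exact Finset.sum_congr rfl fun a' _ => prodExp_const_mul _ _ _
    rw [h2]
    calc _ ≤ ∑ a, ∑ a', w a * (w a' * θ ^ (a'.2 ∩ a.2).card) := by
          refine Finset.sum_le_sum fun a _ => Finset.sum_le_sum fun a' _ => ?_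
          by_cases ha : w a = 0
          · simp [ha]
          by_cases ha' : w a' = 0
          · simp [ha']
          have hPa := hPpos a ha
          have hPa' := hPpos a' ha'
          have hwa := hw0 a
          have hwa' := hw0 a'
          calc _ ≤ w a * (P a)⁻¹ * (w a' * (P a')⁻¹) * (P a * P a' * θ ^ (a'.2 ∩ a.2).card) :=
                mul_le_mul_of_nonneg_left (hEMM a a' ha ha') (by positivity)
            _ = _ := by field_simp
      _ ≤ ∑ a, w a * 2 := by
          refine Finset.sum_le_sum fun a _ => ?_
          rw [← Finset.mul_sum]
          by_cases ha : w a = 0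
          · simp [ha]
          exact mul_le_mul_of_nonneg_left
            ((hwspread a.2 (hwsupp a ha).2.1.le).trans hpow) (hw0 a)
      _ = 2 := by rw [← Finset.sum_mul, hw1, one_mul]
  have hmatch : ∀ ψ, ¬ HasCopy H ψ → Y ψ = 0 := by
    intro ψ hψ
    refine Finset.sum_eq_zero fun a _ => ?_
    by_cases ha : w a = 0
    · simp [ha]
    have hMa : M a ψ = 0 := by
      simp only [hM]
      refine cylinder_of_not_forall fun hall => hψ ⟨a.1, φ a.2, ?_⟩
      obtain ⟨hinj, hmem⟩ := hφ a.2 (hwsupp a ha).2.1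
      refine ⟨hinj, fun x y h => ?_⟩
      rw [hall ⟨(φ a.2 x, φ a.2 y), h⟩ (by simp [hS, hmem])]
      refine if_congr ⟨?_, fun h => ⟨x, y, rfl, rfl, h⟩⟩ rfl rfl
      rintro ⟨x', y', hx, hy, hadj⟩
      rwa [← hinj hx, ← hinj hy]
    rw [hMa, mul_zero]
  refine (prodExp_mono (B' := fun ψ => 1 + (-1 * Y ψ + 1 / 4 * Y ψ ^ 2)) (fun ψ => ?_) hp0).trans ?_
  · split_ifs with h
    · nlinarith [sq_nonneg (Y ψ / 2 - 1)]
    · rw [hmatch ψ h]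
      norm_num
  · rw [prodExp_add (fun _ => 1), prodExp_one hp1, prodExp_add, prodExp_const_mul,
      prodExp_const_mul, hEY]
    linarith

section Sampling

lemma sum_sum_update {κ V : Type*} [Fintype κ] [Fintype V] [DecidableEq κ] (i : κ)
    (g : (κ → V) → ℝ) :
    ∑ s, ∑ x, g (Function.update s i x) = Fintype.card V * ∑ s, g s := by
  let σ : (κ → V) × V ≃ (κ → V) × V :=
    { toFun := fun q => (Function.update q.1 i q.2, q.1 i)
      invFun := fun q => (Function.update q.1 i q.2, q.1 i)
      left_inv := fun q => by simp
      right_inv := fun q => by simp }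
  have h := Equiv.sum_comp σ fun q : (κ → V) × V => g q.1
  rw [Fintype.sum_prod_type, Fintype.sum_prod_type] at h
  simp only [σ, Equiv.coe_fn_mk] at h
  rw [h]
  simp [Finset.mul_sum]

lemma card_sq_mul_sum_le {κ V : Type*} [Fintype κ] [Fintype V] [DecidableEq κ] (i j : κ)
    (g : (κ → V) → ℝ) {b : ℝ}
    (h : ∀ s, ∑ x, ∑ y, g (Function.update (Function.update s i x) j y) ≤ b) :
    (Fintype.card V : ℝ) ^ 2 * ∑ s, g s ≤ Fintype.card (κ → V) * b := by
  have h1 := sum_sum_update i fun s => ∑ y, g (Function.update s j y)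
  rw [sum_sum_update j g, ← mul_assoc, ← pow_two] at h1
  rw [← h1]
  refine (Finset.sum_le_sum fun s _ => h s).trans (le_of_eq ?_)
  simp

lemma sum_sum_sym2_le {V : Type*} [Fintype V] [DecidableEq V] (g : Sym2 V → ℝ)
    (hg : ∀ e, 0 ≤ g e) : ∑ x, ∑ y, g s(x, y) ≤ 2 * ∑ e, g e := by
  rw [← Fintype.sum_prod_type fun q : V × V => g s(q.1, q.2),
    ← Finset.sum_fiberwise_of_maps_to (g := fun q : V × V => s(q.1, q.2))
      (t := Finset.univ) (fun _ _ => Finset.mem_univ _), Finset.mul_sum]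
  refine Finset.sum_le_sum fun e _ => ?_
  induction e using Sym2.ind with
  | _ a b =>
    have h1 : ∀ q ∈ Finset.univ.filter (fun q : V × V => s(q.1, q.2) = s(a, b)),
        g s(q.1, q.2) = g s(a, b) := fun q hq => by rw [(Finset.mem_filter.mp hq).2]
    rw [Finset.sum_congr rfl h1, Finset.sum_const, nsmul_eq_mul]
    refine mul_le_mul_of_nonneg_right ?_ (hg _)
    have h2 : Finset.univ.filter (fun q : V × V => s(q.1, q.2) = s(a, b)) ⊆
        {(a, b), (b, a)} := by
      rintro ⟨x, y⟩ hq
      have h3 := (Finset.mem_filter.mp hq).2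
      rw [Sym2.eq_iff] at h3
      simpa [Prod.ext_iff] using h3
    exact_mod_cast (Finset.card_le_card h2).trans Finset.card_le_two

end Sampling

section Stars

variable {V Ω Γ : Type*} [Fintype V] [DecidableEq V] [Fintype Ω] [Fintype Γ]

/-- The values of `f` on all pairs meeting `A`. -/
def starInfo {V Ω Γ : Type*} (f : Sym2 V → Ω → Γ) (A : Finset V) (ω : Ω) : A × V → Γ :=
  fun q => f s(q.1.1, q.2) ω

lemma starInfo_eq_of_subset {V Ω Γ : Type*} (f : Sym2 V → Ω → Γ) {A A' : Finset V} (h : A ⊆ A')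
    {ω ω' : Ω} (hω : starInfo f A' ω = starInfo f A' ω') : starInfo f A ω = starInfo f A ω' :=
  funext fun q => congrFun hω (⟨q.1.1, h q.1.2⟩, q.2)

/-- There is a small set `A` whose stars already determine the conditional distributions of the
values of `f` almost as well as slightly larger sets do. -/
lemma exists_stable_set (f : Sym2 V → Ω → Γ) {D : ℝ} (hD : 0 < D) :
    ∃ A : Finset V, A.card * D ≤ Fintype.card V ∧ ∀ T : Finset V,
      ∑ x, ∑ y, ∑ t, ∑ ω, (condProb (starInfo f (A ∪ T)) (f s(x, y)) ω t -
        condProb (starInfo f A) (f s(x, y)) ω t) ^ 2 ≤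
      Fintype.card Ω * Fintype.card V * D * T.card := by
  rcases isEmpty_or_nonempty Ω with hΩ | hΩ
  · exact ⟨∅, by simp, fun T => by simp⟩
  rcases isEmpty_or_nonempty V with hV | hV
  · exact ⟨∅, by simp, fun T => by simp⟩
  set Φ : Finset V → ℝ := fun A =>
    ∑ x, ∑ y, ∑ t, ∑ ω, condProb (starInfo f A) (f s(x, y)) ω t ^ 2 with hΦ
  have hΩ0 : (0 : ℝ) < Fintype.card Ω := by exact_mod_cast Fintype.card_pos
  have hV0 : (0 : ℝ) < Fintype.card V := by exact_mod_cast Fintype.card_pos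
  have hΦ0 : 0 ≤ Φ ∅ := Finset.sum_nonneg fun _ _ => Finset.sum_nonneg fun _ _ =>
    Finset.sum_nonneg fun _ _ => Finset.sum_nonneg fun _ _ => sq_nonneg _
  have hΦ1 : ∀ A, Φ A ≤ Fintype.card V * (Fintype.card V * Fintype.card Ω) := by
    intro A
    have h1 : ∀ x y : V, ∑ t, ∑ ω, condProb (starInfo f A) (f s(x, y)) ω t ^ 2 ≤
        Fintype.card Ω := by
      intro x y
      rw [Finset.sum_comm]
      have h2 : ∀ ω, ∑ t, condProb (starInfo f A) (f s(x, y)) ω t ^ 2 ≤ 1 := by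
        intro ω
        have h3 := sum_condProb (starInfo f A) (f s(x, y)) ω
        have h4 := Finset.sum_sq_le_sq_sum_of_nonneg
          (f := fun t => condProb (starInfo f A) (f s(x, y)) ω t) (s := Finset.univ)
          fun t _ => condProb_nonneg _ _ _ _
        rw [h3] at h4
        simpa using h4
      exact (Finset.sum_le_sum fun ω _ => h2 ω).trans (by simp)
    refine (Finset.sum_le_sum fun x _ => Finset.sum_le_sum fun y _ => h1 x y).trans ?_
    simp
  obtain ⟨A, hA⟩ := Finite.exists_max fun A : Finset V =>
    Φ A - Fintype.card Ω * Fintype.card V * D * A.card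
  refine ⟨A, ?_, fun T => ?_⟩
  · have h1 := hA ∅
    have h2 := hΦ1 A
    simp only [Finset.card_empty, Nat.cast_zero, mul_zero, sub_zero] at h1
    have h3 : (Fintype.card Ω * Fintype.card V : ℝ) * (A.card * D) ≤
        (Fintype.card Ω * Fintype.card V) * Fintype.card V := by linarith
    exact le_of_mul_le_mul_left h3 (by positivity)
  · have h1 := hA (A ∪ T)
    have h2 : ((A ∪ T).card : ℝ) ≤ A.card + T.card := by exact_mod_cast Finset.card_union_le A T
    have h3 : ∑ x, ∑ y, ∑ t, ∑ ω, (condProb (starInfo f (A ∪ T)) (f s(x, y)) ω t -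
        condProb (starInfo f A) (f s(x, y)) ω t) ^ 2 = Φ (A ∪ T) - Φ A := by
      simp only [hΦ, ← Finset.sum_sub_distrib]
      refine Finset.sum_congr rfl fun x _ => Finset.sum_congr rfl fun y _ =>
        Finset.sum_congr rfl fun t _ => ?_
      rw [Finset.sum_sub_distrib]
      exact sum_condAvg_sub_sq _ _ _ fun ω ω' h =>
        starInfo_eq_of_subset f Finset.subset_union_left h
    rw [h3]
    have h4 := mul_le_mul_of_nonneg_left h2
      (by positivity : (0 : ℝ) ≤ Fintype.card Ω * Fintype.card V * D)
    linarith

end Stars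

/-- The edges of the random graph `ω` with their colours, and `none` for the non-edges. -/
def colouring {V : Type*} {r : ℕ} (c : (Sym2 V → Bool) → Sym2 V → Fin r) (e : Sym2 V)
    (ω : Sym2 V → Bool) : Option (Fin r) :=
  if ω e then some (c ω e) else none

lemma sum_sum_condAvg_sign_sq_le {V Γ : Type*} [Fintype V] [DecidableEq V] [Fintype Γ]
    (f : Sym2 V → (Sym2 V → Bool) → Γ) (A : Finset V) :
    ∑ x, ∑ y, ∑ ω, condAvg (starInfo f A) (fun ω => if ω s(x, y) then 1 else -1) ω ^ 2 ≤
      4 * (A.card * Fintype.card V * Real.log (Fintype.card Γ)) *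
        Fintype.card (Sym2 V → Bool) := by
  have h1 := sum_condAvg_sign_sq_le (starInfo f A)
  rw [Finset.sum_comm] at h1
  have h2 := sum_sum_sym2_le (fun e => ∑ ω, condAvg (starInfo f A)
      (fun ω => if ω e then 1 else -1) ω ^ 2) fun e => Finset.sum_nonneg fun _ _ => sq_nonneg _
  have h3 : Real.log (Fintype.card (A × V → Γ)) =
      A.card * Fintype.card V * Real.log (Fintype.card Γ) := by
    rw [Fintype.card_fun, Fintype.card_prod, Fintype.card_coe]
    push_cast
    rw [Real.log_pow]
    push_cast
    rfl
  rw [h3] at h1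
  refine h2.trans ?_
  linarith

/-- The indicator function of the event that there is no copy of `H`. -/
noncomputable def noCopy {r k K : ℕ} (H : SimpleGraph (Fin k))
    (ψ : {e : Fin K × Fin K // e.1 < e.2} → Option (Fin r)) : ℝ :=
  if HasCopy H ψ then 0 else 1

lemma noCopy_nonneg {r k K : ℕ} (H : SimpleGraph (Fin k))
    (ψ : {e : Fin K × Fin K // e.1 < e.2} → Option (Fin r)) : 0 ≤ noCopy H ψ := by
  unfold noCopy
  split_ifs <;> norm_num

lemma noCopy_le_one {r k K : ℕ} (H : SimpleGraph (Fin k))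
    (ψ : {e : Fin K × Fin K // e.1 < e.2} → Option (Fin r)) : noCopy H ψ ≤ 1 := by
  unfold noCopy
  split_ifs <;> norm_num

lemma prodExp_noCopy_le {r k K : ℕ} (hr : 1 ≤ r) (hk : 1 ≤ k) (H : SimpleGraph (Fin k))
    (p : {e : Fin K × Fin K // e.1 < e.2} → Option (Fin r) → ℝ)
    (hp0 : ∀ e t, 0 ≤ p e t) (hp1 : ∀ e, ∑ t, p e t = 1)
    (b : {e : Fin K × Fin K // e.1 < e.2} → ℝ) (hb : ∀ e, p e none = 1 / 2 - b e / 2)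
    (hK : (2 * r * k ^ 2 * (4 * r) ^ k * (2 * r) ^ (r * k) : ℝ) ≤ K) :
    prodExp (noCopy H) p ≤ 1 / 2 + 4 * ∑ e, b e ^ 2 := by
  have hr' : (1 : ℝ) ≤ r := by exact_mod_cast hr
  have hsum : 0 ≤ ∑ e, b e ^ 2 := Finset.sum_nonneg fun e _ => sq_nonneg _
  by_cases hlarge : 1 ≤ 4 * ∑ e, b e ^ 2
  · have h1 := (prodExp_mono (noCopy_le_one H) hp0).trans (prodExp_one hp1).le
    linarith
  have hbs : ∀ e, |b e| ≤ 1 / 2 := by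
    intro e
    have h1 := Finset.single_le_sum (f := fun e => b e ^ 2) (fun e _ => sq_nonneg _)
      (Finset.mem_univ e)
    refine abs_le_of_sq_le_sq ?_ (by norm_num)
    have h2 : b e ^ 2 ≤ ∑ e, b e ^ 2 := h1
    linarith
  have hε : (0 : ℝ) < 1 / (4 * r) := by positivity
  have hε4 : 1 / (4 * r : ℝ) ≤ 1 / 4 := by
    refine one_div_le_one_div_of_le (by norm_num) (by linarith)
  have h2 := prodExp_no_copy_le_half hr hk H p hε (by linarith) hp0 hp1
    (fun e => by
      have := (abs_le.mp (hbs e)).2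
      rw [hb]
      linarith)
    (fun e => by
      by_contra! hlt
      have h3 := hp1 e
      rw [Fintype.sum_option, hb] at h3
      have h4 : ∑ c : Fin r, p e (some c) < ∑ _c : Fin r, 1 / (4 * r : ℝ) :=
        Finset.sum_lt_sum_of_nonempty ⟨⟨0, hr⟩, Finset.mem_univ _⟩ fun c _ => hlt c
      have h5 : ∑ _c : Fin r, 1 / (4 * r : ℝ) = 1 / 4 := by
        rw [Finset.sum_const, Finset.card_univ, Fintype.card_fin, nsmul_eq_mul]
        field_simp
      have := (abs_le.mp (hbs e)).1
      linarith)
    (by simpa using hK)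
  have h3 : prodExp (noCopy H) p = prodExp (fun ψ => if HasCopy H ψ then 0 else 1) p := rfl
  linarith

lemma exists_sum_le_of_sum_update_le {V : Type*} [Fintype V] [Nonempty V] {K : ℕ}
    (g : {e : Fin K × Fin K // e.1 < e.2} → (Fin K → V) → ℝ) {b : ℝ} (hb : 0 ≤ b)
    (hg : ∀ e s, ∑ x, ∑ y, g e (Function.update (Function.update s e.1.1 x) e.1.2 y) ≤
      Fintype.card V ^ 2 * b) :
    ∃ s, ∑ e, g e s ≤ K ^ 2 * b := by
  have hV : (0 : ℝ) < Fintype.card V := by exact_mod_cast Fintype.card_pos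
  have h1 : ∀ e, ∑ s, g e s ≤ Fintype.card (Fin K → V) * b := by
    intro e
    have h2 := card_sq_mul_sum_le e.1.1 e.1.2 (g e) (hg e)
    refine le_of_mul_le_mul_left (a := (Fintype.card V : ℝ) ^ 2) (h2.trans (le_of_eq ?_))
      (by positivity)
    ring
  by_contra! hlt
  have h3 : ∑ _s : Fin K → V, (K ^ 2 * b : ℝ) < ∑ s, ∑ e, g e s :=
    Finset.sum_lt_sum_of_nonempty Finset.univ_nonempty fun s _ => hlt s
  rw [Finset.sum_comm] at h3
  have h4 := h3.trans_le (Finset.sum_le_sum fun e _ => h1 e)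
  simp only [Finset.sum_const, nsmul_eq_mul, Finset.card_univ] at h4
  have h5 : (Fintype.card {e : Fin K × Fin K // e.1 < e.2} : ℝ) ≤ K ^ 2 := by
    have := Fintype.card_subtype_le fun e : Fin K × Fin K => e.1 < e.2
    rw [Fintype.card_prod, Fintype.card_fin, ← pow_two] at this
    exact_mod_cast this
  have h6 := mul_le_mul_of_nonneg_right h5
    (by positivity : (0 : ℝ) ≤ Fintype.card (Fin K → V) * b)
  linarith

lemma sum_sum_abs_sub_le {α β : Type*} (s : Finset α) (t : Finset β) (u : α → β → ℝ) {η : ℝ}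
    (hη : 0 < η) :
    ∑ a ∈ s, ∑ b ∈ t, |u a b| ≤
      (∑ a ∈ s, ∑ b ∈ t, u a b ^ 2) / (2 * η) + s.card * t.card * (η / 2) := by
  have h1 : ∀ a b, |u a b| ≤ u a b ^ 2 / (2 * η) + η / 2 := by
    intro a b
    have h2 : u a b ^ 2 / (2 * η) + η / 2 - |u a b| = (|u a b| - η) ^ 2 / (2 * η) := by
      rw [← sq_abs (u a b)]
      field_simp
      ring
    have h3 : 0 ≤ (|u a b| - η) ^ 2 / (2 * η) := by positivity
    linarith
  refine (Finset.sum_le_sum fun a _ => Finset.sum_le_sum fun b _ => h1 a b).trans (le_of_eq ?_)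
  simp only [Finset.sum_add_distrib, Finset.sum_const, nsmul_eq_mul, Finset.sum_div]
  ring

/-- Conditionally on any information, a pair is a non-edge with probability determined by the
average of the corresponding random sign. -/
lemma condProb_colouring_none {V γ : Type*} [Fintype V] [DecidableEq V] {r : ℕ}
    (c : (Sym2 V → Bool) → Sym2 V → Fin r) (Z : (Sym2 V → Bool) → γ) (e : Sym2 V)
    (ω : Sym2 V → Bool) :
    condProb Z (colouring c e) ω none =
      1 / 2 - condAvg Z (fun ω => if ω e then 1 else -1) ω / 2 := by
  have h1 := condAvg_affine Z (fun ω : Sym2 V → Bool => if ω e then (1 : ℝ) else -1) (1 / 2)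
    (-1 / 2) ω
  have h2 : condProb Z (colouring c e) ω none =
      condAvg Z (fun ω => 1 / 2 + (-1 / 2) * if ω e then (1 : ℝ) else -1) ω := by
    unfold condProb
    congr 1
    funext ω
    unfold colouring
    by_cases h : ω e = true
    · rw [if_pos h, if_pos h, if_neg (Option.some_ne_none _)]
      norm_num
    · rw [if_neg h, if_neg h, if_pos rfl]
      norm_num
  rw [h2, h1]
  ring

/-- Some family of random graphs with colourings contains, for some outcome, a monochromatic
induced copy of `H`. -/
lemma exists_hasCopy {V : Type*} [Fintype V] [DecidableEq V] {r k K : ℕ} (hr : 1 ≤ r) (hk : 1 ≤ k)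
    (H : SimpleGraph (Fin k))
    (hK : (2 * r * k ^ 2 * (4 * r) ^ k * (2 * r) ^ (r * k) : ℝ) ≤ K)
    (hV : (2 ^ 14 * K ^ 7 * r ^ 2 : ℝ) ≤ Fintype.card V)
    (c : (Sym2 V → Bool) → Sym2 V → Fin r) :
    ∃ ω, ∃ s : Fin K → V, Function.Injective s ∧
      HasCopy H fun e => colouring c s(s e.1.1, s e.1.2) ω := by
  by_contra! hno
  have hr' : (1 : ℝ) ≤ r := by exact_mod_cast hr
  have hk' : (1 : ℝ) ≤ k := by exact_mod_cast hk
  have hK1 : (1 : ℝ) ≤ K := by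
    have : (0 : ℝ) < K := lt_of_lt_of_le (by positivity) hK
    exact_mod_cast this
  set N : ℝ := (Fintype.card V : ℝ) with hN
  have hN0 : 0 < N := lt_of_lt_of_le (by positivity) hV
  have hVne : Nonempty V := by
    rw [← Fintype.card_pos_iff]
    rw [hN] at hN0
    exact_mod_cast hN0
  set f := colouring c with hf
  set W : ℝ := (Fintype.card (Sym2 V → Bool) : ℝ) with hW
  have hW0 : 0 < W := by
    rw [hW]
    exact_mod_cast Fintype.card_pos
  obtain ⟨A, hA, hAT⟩ := exists_stable_set f (D := 256 * K ^ 2 * r) (by positivity)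
  set β : V → V → ℝ := fun x y =>
    ∑ ω, condAvg (starInfo f A) (fun ω => if ω s(x, y) then 1 else -1) ω ^ 2 with hβ
  set dev : Finset V → V → V → ℝ := fun T x y =>
    ∑ t, ∑ ω, (condProb (starInfo f (A ∪ T)) (f s(x, y)) ω t -
        condProb (starInfo f A) (f s(x, y)) ω t) ^ 2 with hdev
  have hβsum : ∑ x, ∑ y, β x y ≤ W * N ^ 2 / (64 * K ^ 2) := by
    have h1 := sum_sum_condAvg_sign_sq_le f A
    have h2 : Real.log (Fintype.card (Option (Fin r))) ≤ r := by
      rw [Fintype.card_option, Fintype.card_fin]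
      push_cast
      have := Real.log_le_sub_one_of_pos (by positivity : (0 : ℝ) < r + 1)
      linarith
    refine h1.trans ?_
    rw [← hW, ← hN, le_div_iff₀ (by positivity)]
    have h3 := mul_le_mul_of_nonneg_left h2
      (by positivity : 0 ≤ 4 * (A.card * N) * W * (64 * K ^ 2))
    have h4 := mul_le_mul_of_nonneg_left hA (by positivity : 0 ≤ N * W)
    linarith
  have hβ0 : ∀ x y, 0 ≤ β x y := fun x y => Finset.sum_nonneg fun _ _ => sq_nonneg _
  have hdev0 : ∀ T x y, 0 ≤ dev T x y := fun T x y =>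
    Finset.sum_nonneg fun _ _ => Finset.sum_nonneg fun _ _ => sq_nonneg _
  set T : {e : Fin K × Fin K // e.1 < e.2} → (Fin K → V) → Finset V := fun e s =>
    (Finset.univ \ {e.1.1, e.1.2}).image s with hT
  have hTcard : ∀ e s, ((T e s).card : ℝ) ≤ K := by
    intro e s
    have := (Finset.card_image_le (f := s)).trans
      (Finset.card_le_univ (Finset.univ \ {e.1.1, e.1.2}))
    rw [Fintype.card_fin] at this
    exact_mod_cast this
  have hTupd : ∀ e s x y, T e (Function.update (Function.update s e.1.1 x) e.1.2 y) = T e s := by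
    intro e s x y
    refine Finset.image_congr fun i hi => ?_
    have hi' : i ≠ e.1.1 ∧ i ≠ e.1.2 := by simpa using hi
    rw [Function.update_of_ne hi'.2, Function.update_of_ne hi'.1]
  set g : {e : Fin K × Fin K // e.1 < e.2} → (Fin K → V) → ℝ := fun e s =>
    4 * K ^ 2 * r * dev (T e s) (s e.1.1) (s e.1.2) + 4 * β (s e.1.1) (s e.1.2) +
      (if s e.1.1 = s e.1.2 then W else 0) with hg
  have hg0 : ∀ e s, 0 ≤ g e s := by
    intro e s
    have h1 := hdev0 (T e s) (s e.1.1) (s e.1.2)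
    have h2 := hβ0 (s e.1.1) (s e.1.2)
    have h3 : 0 ≤ (if s e.1.1 = s e.1.2 then W else 0) := by
      split_ifs
      exacts [hW0.le, le_rfl]
    have h4 : 0 ≤ 4 * K ^ 2 * r * dev (T e s) (s e.1.1) (s e.1.2) := by positivity
    simp only [hg]
    linarith
  obtain ⟨s, hs⟩ := exists_sum_le_of_sum_update_le g (b := 3 * W / (16 * K ^ 2)) (by positivity) (by
    intro e s
    have hne : e.1.1 ≠ e.1.2 := e.2.ne
    simp only [hg, hTupd, Function.update_self, Function.update_of_ne hne]
    simp only [Finset.sum_add_distrib, ← Finset.mul_sum]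
    have h1 : ∑ x, ∑ y, dev (T e s) x y ≤ W * N * (256 * K ^ 2 * r) * K := by
      refine (hAT (T e s)).trans ?_
      exact mul_le_mul_of_nonneg_left (hTcard e s) (by positivity)
    have h2 : ∑ x : V, ∑ y : V, (if x = y then W else 0) = N * W := by
      simp [hN]
    rw [h2]
    have h3 : 4 * K ^ 2 * r * ∑ x, ∑ y, dev (T e s) x y ≤ N ^ 2 * W / (16 * K ^ 2) := by
      refine (mul_le_mul_of_nonneg_left h1 (by positivity)).trans ?_
      rw [le_div_iff₀ (by positivity)]
      have := mul_le_mul_of_nonneg_left hV (by positivity : 0 ≤ N * W)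
      linarith
    have h4 : N * W ≤ N ^ 2 * W / (16 * K ^ 2) := by
      rw [le_div_iff₀ (by positivity)]
      have h5 : (16 * K ^ 2 : ℝ) ≤ N := by
        refine le_trans ?_ hV
        have h6 : (K : ℝ) ^ 2 ≤ K ^ 7 := pow_le_pow_right₀ hK1 (by norm_num)
        have h7 : (1 : ℝ) ≤ r ^ 2 := one_le_pow₀ hr'
        have h8 : (K : ℝ) ^ 7 * 1 ≤ K ^ 7 * r ^ 2 :=
          mul_le_mul_of_nonneg_left h7 (by positivity)
        have h9 : (0 : ℝ) ≤ K ^ 7 := by positivity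
        linarith
      have := mul_le_mul_of_nonneg_left h5 (by positivity : 0 ≤ N * W)
      linarith
    have h5 : N ^ 2 * (3 * W / (16 * K ^ 2)) = 3 * (N ^ 2 * W / (16 * K ^ 2)) := by ring
    have h6 : 4 * (W * N ^ 2 / (64 * K ^ 2)) = N ^ 2 * W / (16 * K ^ 2) := by
      field_simp
      norm_num
    rw [h5]
    linarith)
  have hs' : ∑ e, g e s ≤ 3 * W / 16 := hs.trans (le_of_eq (by field_simp))
  have hgs : ∀ e, g e s < W := fun e => by
    have := Finset.single_le_sum (f := fun e => g e s) (fun e _ => hg0 e s) (Finset.mem_univ e)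
    have h2 : g e s ≤ ∑ e, g e s := this
    linarith
  have hne : ∀ i j, i < j → s i ≠ s j := by
    intro i j hij hsij
    have h1 := hgs ⟨(i, j), hij⟩
    have h2 := hdev0 (T ⟨(i, j), hij⟩ s) (s i) (s j)
    have h3 := hβ0 (s i) (s j)
    have h4 : 0 ≤ 4 * K ^ 2 * r * dev (T ⟨(i, j), hij⟩ s) (s i) (s j) := by positivity
    simp only [hg] at h1
    rw [if_pos hsij] at h1
    linarith
  have hinj : Function.Injective s := by
    intro i j hij
    rcases lt_trichotomy i j with h | h | h
    · exact absurd hij (hne i j h)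
    · exact h
    · exact absurd hij.symm (hne j i h)
  set X : {e : Fin K × Fin K // e.1 < e.2} → (Sym2 V → Bool) → Option (Fin r) := fun e ω =>
    f s(s e.1.1, s e.1.2) ω with hX
  have hyb := sum_apply_le_sum_prodExp
    (γ' := fun e => ((A ∪ T e s : Finset V) × V → Option (Fin r)))
    (starInfo f A) (fun e => starInfo f (A ∪ T e s)) X
    (fun e ω ω' h => starInfo_eq_of_subset f Finset.subset_union_left h)
    (by
      intro e e' hee ω ω' h
      have hcov : e'.1.1 ∈ Finset.univ \ {e.1.1, e.1.2} ∨
          e'.1.2 ∈ Finset.univ \ {e.1.1, e.1.2} := by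
        by_contra! hnot
        obtain ⟨⟨i, j⟩, hij⟩ := e
        obtain ⟨⟨i', j'⟩, hij'⟩ := e'
        simp only [Finset.mem_sdiff, Finset.mem_univ, true_and, not_not, Finset.mem_insert,
          Finset.mem_singleton] at hnot hij hij'
        apply hee
        rw [Subtype.mk.injEq, Prod.mk.injEq]
        omega
      rcases hcov with h1 | h1
      · exact congrFun h (⟨s e'.1.1, Finset.mem_union_right _ (Finset.mem_image_of_mem s h1)⟩,
          s e'.1.2)
      · have h2 := congrFun h
          (⟨s e'.1.2, Finset.mem_union_right _ (Finset.mem_image_of_mem s h1)⟩, s e'.1.1)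
        simp only [starInfo] at h2
        simp only [hX]
        rw [Sym2.eq_swap]
        exact h2)
    (noCopy H) (noCopy_nonneg H) (noCopy_le_one H)
  have hlhs : ∑ ω, noCopy H (fun e => X e ω) = W := by
    have h1 : ∀ ω, noCopy H (fun e => X e ω) = 1 := fun ω => if_neg (hno ω s hinj)
    simp [h1, hW]
  have hprod : ∑ ω, prodExp (noCopy H) (fun e => condProb (starInfo f A) (X e) ω) ≤
      W / 2 + 4 * ∑ e : {e : Fin K × Fin K // e.1 < e.2}, β (s e.1.1) (s e.1.2) := by
    have h1 : ∀ ω, prodExp (noCopy H) (fun e => condProb (starInfo f A) (X e) ω) ≤ 1 / 2 +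
        4 * ∑ e : {e : Fin K × Fin K // e.1 < e.2}, condAvg (starInfo f A)
          (fun ω => if ω s(s e.1.1, s e.1.2) then 1 else -1) ω ^ 2 := fun ω =>
      prodExp_noCopy_le hr hk H _ (fun e t => condProb_nonneg _ _ _ _)
        (fun e => sum_condProb _ _ _) _ (fun e => condProb_colouring_none c _ _ ω) hK
    refine (Finset.sum_le_sum fun ω _ => h1 ω).trans (le_of_eq ?_)
    rw [Finset.sum_add_distrib, ← Finset.mul_sum, Finset.sum_comm]
    simp only [Finset.sum_const, Finset.card_univ, nsmul_eq_mul, hβ, hW]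
    ring
  have herr : ∑ e, ∑ t, ∑ ω, |condProb (starInfo f (A ∪ T e s)) (X e) ω t -
      condProb (starInfo f A) (X e) ω t| ≤
      ∑ e : {e : Fin K × Fin K // e.1 < e.2},
        4 * K ^ 2 * r * dev (T e s) (s e.1.1) (s e.1.2) + W / 8 := by
    have h1 : ∀ e, ∑ t, ∑ ω, |condProb (starInfo f (A ∪ T e s)) (X e) ω t -
        condProb (starInfo f A) (X e) ω t| ≤
        4 * K ^ 2 * r * dev (T e s) (s e.1.1) (s e.1.2) + W / (8 * K ^ 2) := by
      intro e
      refine (sum_sum_abs_sub_le Finset.univ Finset.univ (fun t ω =>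
        condProb (starInfo f (A ∪ T e s)) (X e) ω t - condProb (starInfo f A) (X e) ω t)
        (by positivity : (0 : ℝ) < 1 / (8 * K ^ 2 * r))).trans ?_
      refine add_le_add (le_of_eq ?_) ?_
      · have h2 : ∀ S : ℝ, S / (2 * (1 / (8 * K ^ 2 * r))) = 4 * K ^ 2 * r * S := by
          intro S
          field_simp
          ring
        exact h2 _
      · rw [Finset.card_univ, Finset.card_univ, Fintype.card_option, Fintype.card_fin, ← hW]
        push_cast
        have h2 : (r + 1 : ℝ) ≤ 2 * r := by linarith
        have h3 := mul_le_mul_of_nonneg_right h2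
          (by positivity : 0 ≤ W * (1 / (8 * K ^ 2 * r) / 2))
        refine le_trans (le_of_eq (by ring)) (h3.trans (le_of_eq ?_))
        field_simp
    refine (Finset.sum_le_sum fun e _ => h1 e).trans ?_
    rw [Finset.sum_add_distrib, Finset.sum_const, nsmul_eq_mul, Finset.card_univ]
    have h5 : (Fintype.card {e : Fin K × Fin K // e.1 < e.2} : ℝ) ≤ K ^ 2 := by
      have := Fintype.card_subtype_le fun e : Fin K × Fin K => e.1 < e.2
      rw [Fintype.card_prod, Fintype.card_fin, ← pow_two] at this
      exact_mod_cast this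
    have h6 := mul_le_mul_of_nonneg_right h5 (by positivity : 0 ≤ W / (8 * K ^ 2))
    have h7 : K ^ 2 * (W / (8 * K ^ 2)) = W / 8 := by field_simp
    linarith
  have hcost : ∑ e : {e : Fin K × Fin K // e.1 < e.2},
      4 * K ^ 2 * r * dev (T e s) (s e.1.1) (s e.1.2) +
      4 * ∑ e : {e : Fin K × Fin K // e.1 < e.2}, β (s e.1.1) (s e.1.2) ≤ ∑ e, g e s := by
    rw [Finset.mul_sum, ← Finset.sum_add_distrib]
    refine Finset.sum_le_sum fun e _ => ?_
    simp only [hg]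
    have h3 : 0 ≤ (if s e.1.1 = s e.1.2 then W else 0) := by
      split_ifs
      exacts [hW0.le, le_rfl]
    linarith
  rw [hlhs] at hyb
  linarith

lemma hasMonoInducedCopy_of_hasCopy {n k r K : ℕ} {H : SimpleGraph (Fin k)}
    {G : SimpleGraph (Fin n)} {ω : Sym2 (Fin n) → Bool}
    (hG : ∀ x y, G.Adj x y ↔ x ≠ y ∧ ω s(x, y) = true)
    (c : (Sym2 (Fin n) → Bool) → Sym2 (Fin n) → Fin r) {s : Fin K → Fin n}
    (hs : Function.Injective s)
    (h : HasCopy H fun e : {e : Fin K × Fin K // e.1 < e.2} =>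
      colouring c s(s e.1.1, s e.1.2) ω) :
    HasMonoInducedCopy G H (c ω) := by
  obtain ⟨j, φ, hφ, hcol⟩ := h
  have hcol' : ∀ a b, a ≠ b →
      colouring c s(s (φ a), s (φ b)) ω = if H.Adj a b then some j else none := by
    intro a b hab
    rcases lt_or_gt_of_ne (hφ.ne hab) with hlt | hlt
    · exact hcol a b hlt
    · have h1 := hcol b a hlt
      simp only [H.adj_comm b a] at h1
      rw [Sym2.eq_swap]
      exact h1
  have hadj : ∀ a b, G.Adj (s (φ a)) (s (φ b)) ↔ H.Adj a b := by
    intro a b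
    rcases eq_or_ne a b with rfl | hab
    · simp
    have h1 := hcol' a b hab
    rw [hG]
    unfold colouring at h1
    by_cases hH : H.Adj a b
    · rw [if_pos hH] at h1
      refine iff_of_true ⟨(hs.comp hφ).ne hab, ?_⟩ hH
      by_contra hω
      rw [if_neg hω] at h1
      exact Option.some_ne_none _ h1.symm
    · rw [if_neg hH] at h1
      refine iff_of_false (fun hω => ?_) hH
      rw [if_pos hω.2] at h1
      exact Option.some_ne_none _ h1
  refine ⟨Finset.univ.image fun a => s (φ a), j, ⟨⟨Equiv.ofBijective
    (fun a => ⟨s (φ a), by simp⟩) ⟨fun a b hab => ?_, ?_⟩, ?_⟩⟩, ?_⟩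
  · exact hφ (hs (congrArg Subtype.val hab))
  · rintro ⟨x, hx⟩
    obtain ⟨a, _, ha⟩ := Finset.mem_image.mp (Finset.mem_coe.mp hx)
    exact ⟨a, Subtype.ext ha⟩
  · intro a b
    exact hadj a b
  · intro x hx y hy hxy
    obtain ⟨a, _, rfl⟩ := Finset.mem_image.mp hx
    obtain ⟨b, _, rfl⟩ := Finset.mem_image.mp hy
    have hH := (hadj a b).mp hxy
    have h1 := hcol' a b hH.ne
    rw [if_pos hH] at h1
    unfold colouring at h1
    rw [if_pos ((hG _ _).mp hxy).2] at h1
    exact Option.some_injective _ h1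

lemma clique_size_le {r k : ℕ} (hr : 2 ≤ r) (hk : 1 ≤ k) :
    2 * r * k ^ 2 * (4 * r) ^ k * (2 * r) ^ (r * k) ≤ r ^ (6 * (r * k)) := by
  have h1 : k ^ 2 ≤ r ^ (2 * k) := by
    rw [mul_comm, pow_mul]
    exact Nat.pow_le_pow_left (k.lt_two_pow_self.le.trans (Nat.pow_le_pow_left hr k)) 2
  have h2 : (4 * r) ^ k ≤ r ^ (3 * k) := by
    rw [pow_mul]
    refine Nat.pow_le_pow_left ?_ k
    nlinarith [Nat.mul_le_mul hr hr]
  have h3 : (2 * r) ^ (r * k) ≤ r ^ (2 * (r * k)) := by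
    rw [pow_mul r 2]
    refine Nat.pow_le_pow_left ?_ _
    nlinarith
  calc 2 * r * k ^ 2 * (4 * r) ^ k * (2 * r) ^ (r * k)
      ≤ r * r * r ^ (2 * k) * r ^ (3 * k) * r ^ (2 * (r * k)) := by gcongr
    _ = r ^ (1 + 1 + 2 * k + 3 * k + 2 * (r * k)) := by simp only [pow_add, pow_one]
    _ ≤ r ^ (6 * (r * k)) := by
      refine Nat.pow_le_pow_right (by omega) ?_
      have := Nat.mul_le_mul_right k hr
      omega

lemma vertex_count_le {r k K : ℕ} (hr : 2 ≤ r) (hk : 1 ≤ k) (hK : K ≤ r ^ (6 * (r * k))) :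
    2 ^ 14 * K ^ 7 * r ^ 2 ≤ r ^ (58 * (r * k)) := by
  calc 2 ^ 14 * K ^ 7 * r ^ 2 ≤ r ^ 14 * (r ^ (6 * (r * k))) ^ 7 * r ^ 2 := by gcongr
    _ = r ^ (14 + 6 * (r * k) * 7 + 2) := by simp only [pow_add, pow_mul]
    _ ≤ r ^ (58 * (r * k)) := by
      refine Nat.pow_le_pow_right (by omega) ?_
      have := Nat.mul_le_mul hr hk
      omega

/-- **Theorem 1.2.** There is a constant `C > 0` such that for every `r ≥ 2`, every `k ≥ 1`
and every graph `H` on `k` vertices there is a graph `G` with at most `r^{Crk}` vertices such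
that every `r`-colouring of the edges of `G` contains a monochromatic induced copy of `H`. -/
theorem induced_ramsey_multicolour :
    ∃ C : ℝ, 0 < C ∧ ∀ r : ℕ, 2 ≤ r → ∀ k : ℕ, 1 ≤ k → ∀ H : SimpleGraph (Fin k),
      ∃ N : ℕ, (N : ℝ) ≤ (r : ℝ) ^ (C * (r : ℝ) * (k : ℝ)) ∧
        ∃ G : SimpleGraph (Fin N),
          ∀ c : Sym2 (Fin N) → Fin r, HasMonoInducedCopy G H c := by
  refine ⟨58, by norm_num, fun r hr k hk H => ?_⟩
  set K : ℕ := 2 * r * k ^ 2 * (4 * r) ^ k * (2 * r) ^ (r * k) with hK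
  refine ⟨2 ^ 14 * K ^ 7 * r ^ 2, ?_, ?_⟩
  · have h1 : (58 * (r : ℝ) * (k : ℝ)) = ((58 * (r * k) : ℕ) : ℝ) := by
      push_cast
      ring
    rw [h1, Real.rpow_natCast]
    exact_mod_cast vertex_count_le hr hk (clique_size_le hr hk)
  · by_contra! hno
    let G : (Sym2 (Fin (2 ^ 14 * K ^ 7 * r ^ 2)) → Bool) →
        SimpleGraph (Fin (2 ^ 14 * K ^ 7 * r ^ 2)) := fun ω =>
      { Adj := fun x y => x ≠ y ∧ ω s(x, y) = true
        symm := ⟨fun x y h => ⟨h.1.symm, by rw [Sym2.eq_swap]; exact h.2⟩⟩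
        loopless := ⟨fun x h => h.1 rfl⟩ }
    choose c hc using fun ω => hno (G ω)
    obtain ⟨ω, s, hs, hcopy⟩ := exists_hasCopy (K := K) (by omega) hk H
      (by rw [hK]; push_cast; exact le_rfl)
      (by rw [Fintype.card_fin]; exact le_of_eq (by push_cast; ring)) c
    exact hc ω (hasMonoInducedCopy_of_hasCopy (fun x y => Iff.rfl) c hs hcopy)
end

section
/- There exists a constant C > 0 such that for every r ≥ 2 and every k ≥ 1 there exists a single graph G with at most r^{Crk} vertices with the following property: for every graph H on k vertices and every colouring c : E(G) → {1,…,r}, G contains a monochromatic induced copy of H. -/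
open scoped Classical

/-- A family of subsets of `Y` that is large compared with `(1 + 1/b) ^ |Y|` shatters a large
subset of `Y`. -/
theorem Finset.exists_shatters_of_lt_card {α : Type*} [DecidableEq α] {𝒜 : Finset (Finset α)}
    {Y : Finset α} {b d : ℕ} (hb : 0 < b) (hY : ∀ A ∈ 𝒜, A ⊆ Y)
    (h : b ^ d * (b + 1) ^ Y.card < 𝒜.card * b ^ Y.card) :
    ∃ T, 𝒜.Shatters T ∧ T ⊆ Y ∧ d < T.card := by
  by_contra! hT
  have hsub : 𝒜.shatterer ⊆ Y.powerset := by
    intro T hTs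
    rw [Finset.mem_shatterer] at hTs
    obtain ⟨u, hu, hTu⟩ := hTs (Finset.Subset.refl T)
    exact Finset.mem_powerset.2 ((Finset.inter_eq_left.1 hTu).trans (hY u hu))
  refine absurd h (not_lt.2 ?_)
  calc 𝒜.card * b ^ Y.card ≤ 𝒜.shatterer.card * b ^ Y.card :=
        Nat.mul_le_mul_right _ (Finset.card_le_card_shatterer 𝒜)
    _ = ∑ T ∈ 𝒜.shatterer, b ^ Y.card := by simp
    _ ≤ ∑ T ∈ 𝒜.shatterer, b ^ d * (1 ^ T.card * b ^ (Y.card - T.card)) := by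
        refine Finset.sum_le_sum fun T hTs => ?_
        have hTY := Finset.mem_powerset.1 (hsub hTs)
        have := hT T (Finset.mem_shatterer.1 hTs) hTY
        rw [one_pow, one_mul, ← pow_add]
        exact Nat.pow_le_pow_right hb (by omega)
    _ ≤ ∑ T ∈ Y.powerset, b ^ d * (1 ^ T.card * b ^ (Y.card - T.card)) :=
        Finset.sum_le_sum_of_subset hsub
    _ = b ^ d * (b + 1) ^ Y.card := by
        rw [← Finset.mul_sum, Finset.sum_pow_mul_eq_add_pow, add_comm]

/-- The number of functions that agree with `f` on `S`. -/
theorem card_forall_mem_eq {X C : Type*} [Fintype X] [Fintype C] (S : Finset X) (f : X → C) :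
    (Finset.univ.filter fun χ : X → C => ∀ x ∈ S, χ x = f x).card
      = Fintype.card C ^ (Fintype.card X - S.card) := by
  have : (Finset.univ.filter fun χ : X → C => ∀ x ∈ S, χ x = f x)
      = Fintype.piFinset (fun x => if x ∈ S then {f x} else Finset.univ) := by
    ext χ
    simp only [Finset.mem_filter, Finset.mem_univ, true_and, Fintype.mem_piFinset]
    refine forall_congr' fun x => ?_
    by_cases hx : x ∈ S <;> simp [hx]
  rw [this, Fintype.card_piFinset]
  have h2 : ∀ x : X, (if x ∈ S then ({f x} : Finset C) else Finset.univ).card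
      = if x ∈ S then 1 else Fintype.card C := by
    intro x; split_ifs <;> simp
  simp only [h2]
  rw [Finset.prod_ite]
  simp only [Finset.prod_const_one, one_mul, Finset.prod_const]
  congr 1
  rw [← Finset.card_compl]
  congr 1
  ext x; simp

/-- If every subset `S` of `Y` is coloured with `r` colours, then some colouring of the ground set
agrees on `S` with the colouring of `S` for at least `(1 + 1/r) ^ |Y|` subsets `S`. -/
theorem exists_colouring_agreeing {X : Type*} [Fintype X] {r : ℕ} (Y : Finset X)
    (f : Finset X → X → Fin r) (hr : 0 < r) :
    ∃ χ : X → Fin r, (r + 1) ^ Y.card ≤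
      (Y.powerset.filter fun S => ∀ x ∈ S, χ x = f S x).card * r ^ Y.card := by
  by_contra! h
  have : Nonempty (Fin r) := ⟨⟨0, hr⟩⟩
  have h1 := Finset.sum_lt_sum_of_nonempty (s := (Finset.univ : Finset (X → Fin r)))
    Finset.univ_nonempty fun χ _ => h χ
  rw [← Finset.sum_mul, Finset.sum_const, Finset.card_univ, Fintype.card_fun, Fintype.card_fin,
    smul_eq_mul] at h1
  have h2 : ∑ χ : X → Fin r, (Y.powerset.filter fun S => ∀ x ∈ S, χ x = f S x).card
      = ∑ S ∈ Y.powerset, r ^ (Fintype.card X - S.card) := by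
    simp only [Finset.card_filter]
    rw [Finset.sum_comm]
    refine Finset.sum_congr rfl fun S _ => ?_
    have h := card_forall_mem_eq S (f S)
    rw [Fintype.card_fin] at h
    rw [← Finset.card_filter, ← h]
    congr!
  have h3 : ∑ S ∈ Y.powerset, r ^ (Fintype.card X - S.card)
      = r ^ (Fintype.card X - Y.card) * (r + 1) ^ Y.card := by
    rw [add_comm r 1, ← Finset.sum_pow_mul_eq_add_pow, Finset.mul_sum]
    refine Finset.sum_congr rfl fun S hS => ?_
    have hS' := Finset.card_le_card (Finset.mem_powerset.1 hS)
    have hY' := Finset.card_le_univ Y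
    rw [one_pow, one_mul, ← pow_add]
    congr 1; omega
  have hY' := Finset.card_le_univ Y
  rw [h2, h3, mul_right_comm, ← pow_add, Nat.sub_add_cancel hY'] at h1
  exact lt_irrefl _ h1

/-- The number of two-valued labellings for which all `m` of the disjoint traces along `e` lie in
`𝓑`. -/
theorem card_labellings_le {E : Type*} [Fintype E] [DecidableEq E] {n m : ℕ}
    (e : Fin m → Fin n → E)
    (he : Function.Injective (fun p : Fin m × Fin n => e p.1 p.2))
    (𝓑 : Finset (Finset (Fin n))) :
    (Finset.univ.filter fun g : E → Bool =>
        ∀ v, (Finset.univ.filter fun i => g (e v i) = true) ∈ 𝓑).card * 2 ^ (n * m)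
      ≤ 𝓑.card ^ m * 2 ^ Fintype.card E := by
  set R : Set E := Set.range (fun p : Fin m × Fin n => e p.1 p.2)
  have hcard : Fintype.card E = Fintype.card {x // x ∉ R} + n * m := by
    have h1 := Fintype.card_subtype_compl (fun x => x ∈ R)
    have h2 : Fintype.card {x // x ∈ R} = n * m := by
      rw [← Fintype.card_congr (Equiv.ofInjective _ he)]
      simp [mul_comm]
    have h3 := Fintype.card_subtype_le (fun x => x ∈ R)
    omega
  rw [hcard, pow_add, ← mul_assoc]
  refine Nat.mul_le_mul_right _ ?_
  have : 𝓑.card ^ m * 2 ^ Fintype.card {x // x ∉ R}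
      = ((Fintype.piFinset fun _ : Fin m => 𝓑) ×ˢ
          (Finset.univ : Finset ({x // x ∉ R} → Bool))).card := by
    rw [Finset.card_product, Fintype.card_piFinset, Finset.card_univ, Fintype.card_fun]
    simp
  rw [this]
  refine Finset.card_le_card_of_injOn
    (fun g => (fun v => Finset.univ.filter fun i => g (e v i) = true, fun x => g x.1)) ?_ ?_
  · intro g hg
    simpa using hg
  · intro g _ g' _ hgg
    simp only [Prod.mk.injEq] at hgg
    funext x
    by_cases hx : x ∈ R
    · obtain ⟨⟨v, i⟩, rfl⟩ := hx
      have := congrArg (fun s => i ∈ s) (congrFun hgg.1 v)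
      simp only [Finset.mem_filter, Finset.mem_univ, true_and, eq_iff_iff] at this
      exact Bool.eq_iff_iff.2 this
    · exact congrFun hgg.2 ⟨x, hx⟩

theorem two_mul_pow_le_succ_pow {b : ℕ} (hb : 0 < b) : 2 * b ^ b ≤ (b + 1) ^ b := by
  have h := one_add_mul_le_pow (R := ℚ) (a := 1 / b) (by
    have : (0 : ℚ) ≤ 1 / b := by positivity
    linarith) b
  have hb' : (0 : ℚ) < b := by exact_mod_cast hb
  have h2 : (2 : ℚ) ≤ (1 + 1 / b) ^ b := by
    refine le_trans (le_of_eq ?_) h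
    field_simp; norm_num
  have h3 : (2 * b ^ b : ℚ) ≤ (b + 1) ^ b := by
    calc (2 * b ^ b : ℚ) ≤ (1 + 1 / b) ^ b * b ^ b := by gcongr
      _ = (b + 1) ^ b := by rw [← mul_pow]; congr 1; field_simp
  exact_mod_cast h3

theorem pow_mul_pow_lt_pow {r d : ℕ} (hd : 0 < d) :
    (2 * r) ^ d * (2 * r + 1) ^ ((2 * r + 1) * ((r + 1) * d))
      < (2 * r + 2) ^ ((2 * r + 1) * ((r + 1) * d)) := by
  have h1 : 2 * r < 2 ^ (r + 1) := by
    have := Nat.lt_two_pow_self (n := r)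
    rw [pow_succ]; omega
  have h2 := Nat.pow_le_pow_left (two_mul_pow_le_succ_pow (Nat.succ_pos (2 * r))) ((r + 1) * d)
  rw [mul_pow, ← pow_mul, ← pow_mul] at h2
  refine lt_of_lt_of_le ?_ h2
  rw [pow_mul 2]
  exact Nat.mul_lt_mul_of_pos_right (Nat.pow_lt_pow_left h1 hd.ne') (by positivity)

/-- The first `a` values of `φ` induce, in the partially coloured complete graph `κ`, a copy of the
first `a` vertices of `h` in colour `j`; uncoloured pairs are non-edges. -/
def IsMonoCopy {X : Type*} {r k : ℕ} (κ : X → X → Option (Fin r)) (h : Fin k → Fin k → Bool)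
    (a : ℕ) (j : Fin r) (φ : Fin k → X) : Prop :=
  ∀ i i' : Fin k, i < i' → i'.val < a →
    φ i ≠ φ i' ∧ κ (φ i) (φ i') = if h i i' then some j else none

/-- The neighbourhood `B` of a new vertex can be coloured so that no monochromatic copy of the
first `a j` vertices of `h` in colour `j` is extended by the new vertex. -/
def IsAvoidable {X : Type*} {r k : ℕ} (κ : X → X → Option (Fin r)) (h : Fin k → Fin k → Bool)
    (a : Fin r → Fin k) (B : Finset X) : Prop :=
  ∃ ψ : X → Option (Fin r), (∀ x, (ψ x).isSome ↔ x ∈ B) ∧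
    ∀ j φ, IsMonoCopy κ h (a j) j φ →
      ∃ i : Fin k, i < a j ∧ ψ (φ i) ≠ if h i (a j) then some j else none

theorem IsMonoCopy.injOn {X : Type*} {r k : ℕ} {κ : X → X → Option (Fin r)}
    {h : Fin k → Fin k → Bool} {a : ℕ} {j : Fin r} {φ : Fin k → X} (hφ : IsMonoCopy κ h a j φ)
    {i i' : Fin k} (hi : i.val < a) (hi' : i'.val < a) (hii : φ i = φ i') : i = i' := by
  rcases lt_trichotomy i i' with hlt | heq | hlt
  · exact absurd hii (hφ i i' hlt hi').1
  · exact heq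
  · exact absurd hii.symm (hφ i' i hlt hi).1

/-- If every set of at least `q` vertices contains the required copies in each colour, then few
sets are avoidable. -/
theorem card_isAvoidable_le {X : Type*} [Fintype X] {r k q t : ℕ} (hr : 0 < r) (hq : 0 < q)
    (ht : t = (2 * r + 1) * ((r + 1) * (r * q))) (hX : Fintype.card X = 12 * t)
    (κ : X → X → Option (Fin r)) (h : Fin k → Fin k → Bool) (a : Fin r → Fin k)
    (hrich : ∀ j : Fin r, ∀ T : Finset X, q ≤ T.card →
      ∃ φ, IsMonoCopy κ h (a j) j φ ∧ ∀ i < a j, φ i ∈ T) :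
    (Finset.univ.filter fun B : Finset X => IsAvoidable κ h a B).card ≤ 2 ^ (6 * t) := by
  by_contra! hlt
  set 𝓑 := Finset.univ.filter fun B : Finset X => IsAvoidable κ h a B
  obtain ⟨T₁, hT₁, -, hT₁c⟩ := Finset.exists_shatters_of_lt_card (𝒜 := 𝓑) (Y := Finset.univ)
    (b := 8) (d := t) (by norm_num) (fun A _ => Finset.subset_univ A) (by
      rw [Finset.card_univ, hX]
      calc 8 ^ t * (8 + 1) ^ (12 * t) = (8 * 9 ^ 12) ^ t := by rw [mul_pow, pow_mul]
        _ ≤ (2 ^ 6 * 8 ^ 12) ^ t := Nat.pow_le_pow_left (by norm_num) t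
        _ = 2 ^ (6 * t) * 8 ^ (12 * t) := by rw [mul_pow, pow_mul 2, pow_mul 8]
        _ < 𝓑.card * 8 ^ (12 * t) := Nat.mul_lt_mul_of_pos_right hlt (by positivity))
  obtain ⟨T₀, hT₀₁, hT₀c⟩ := Finset.exists_subset_card_eq hT₁c.le
  have hT₀ := hT₁.mono_right hT₀₁
  have hex : ∀ S : Finset X, ∃ ψ : X → Option (Fin r), S ⊆ T₀ →
      (∀ x ∈ T₀, (ψ x).isSome ↔ x ∈ S) ∧
      ∀ j φ, IsMonoCopy κ h (a j) j φ →
        ∃ i : Fin k, i < a j ∧ ψ (φ i) ≠ if h i (a j) then some j else none := by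
    intro S
    by_cases hS : S ⊆ T₀
    · obtain ⟨B, hB, hBS⟩ := hT₀ hS
      obtain ⟨ψ, hψ, hψ'⟩ := (Finset.mem_filter.1 hB).2
      refine ⟨ψ, fun _ => ⟨fun x hx => ?_, hψ'⟩⟩
      rw [hψ, ← hBS]
      simp [hx]
    · exact ⟨fun _ => none, fun h => absurd h hS⟩
  choose ψ hψ using hex
  obtain ⟨χ, hχ⟩ := exists_colouring_agreeing T₀ (fun S x => (ψ S x).getD ⟨0, hr⟩) hr
  set 𝒮 := T₀.powerset.filter fun S => ∀ x ∈ S, χ x = (ψ S x).getD ⟨0, hr⟩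
  have hd : 0 < r * q := Nat.mul_pos hr hq
  obtain ⟨T, hT, hTT₀, hTc⟩ := Finset.exists_shatters_of_lt_card (𝒜 := 𝒮) (Y := T₀)
    (b := 2 * r) (d := r * q) (by omega)
    (fun A hA => Finset.mem_powerset.1 (Finset.mem_filter.1 hA).1) (by
      rw [hT₀c] at hχ ⊢
      calc (2 * r) ^ (r * q) * (2 * r + 1) ^ t < (2 * r + 2) ^ t := by
            rw [ht]; exact pow_mul_pow_lt_pow hd
        _ = 2 ^ t * (r + 1) ^ t := by rw [← mul_pow]; congr 1
        _ ≤ 2 ^ t * (𝒮.card * r ^ t) := Nat.mul_le_mul_left _ hχ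
        _ = 𝒮.card * (2 * r) ^ t := by rw [mul_pow]; ring)
  obtain ⟨j, -, hj⟩ := Finset.exists_lt_card_fiber_of_mul_lt_card_of_maps_to
    (t := (Finset.univ : Finset (Fin r))) (f := χ) (n := q) (fun x _ => Finset.mem_univ _)
    (by simpa using hTc)
  obtain ⟨φ, hφ, hφT⟩ := hrich j _ hj.le
  simp only [Finset.mem_filter] at hφT
  obtain ⟨S, hS, hTS⟩ := hT (t := T.filter fun x => ∃ i < a j, h i (a j) = true ∧ φ i = x)
    (Finset.filter_subset _ _)
  obtain ⟨hST, hSχ⟩ := Finset.mem_filter.1 hS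
  obtain ⟨hψS, hψa⟩ := hψ S (Finset.mem_powerset.1 hST)
  obtain ⟨i, hi, hne⟩ := hψa j φ hφ
  refine hne ?_
  obtain ⟨hiT, hij⟩ := hφT i hi
  have hmem : φ i ∈ S ↔ ∃ i' < a j, h i' (a j) = true ∧ φ i' = φ i := by
    have := congrArg (fun Z => φ i ∈ Z) hTS
    simpa [hiT] using this
  have hsome := hψS (φ i) (hTT₀ hiT)
  by_cases hh : h i (a j) = true
  · have hiS : φ i ∈ S := hmem.2 ⟨i, hi, hh, rfl⟩
    obtain ⟨z, hz⟩ := Option.isSome_iff_exists.1 (hsome.2 hiS)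
    have := hSχ _ hiS
    rw [hz, hij] at this
    rw [if_pos hh, hz, this]
    rfl
  · rw [if_neg hh]
    rw [← Option.not_isSome_iff_eq_none, hsome, hmem]
    rintro ⟨i', hi', hh', heq⟩
    rw [hφ.injOn hi' hi heq] at hh'
    exact hh hh'

theorem card_bad_labellings_le {N n m : ℕ} {u : Fin n → Fin N} {w : Fin m → Fin N}
    (hu : Function.Injective u) (hw : Function.Injective w) (huw : ∀ i v, u i ≠ w v)
    (𝓑 : Finset (Finset (Fin n))) :
    (Finset.univ.filter fun g : Sym2 (Fin N) → Bool =>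
        ∀ v, (Finset.univ.filter fun i => g s(u i, w v) = true) ∈ 𝓑).card * 2 ^ (n * m)
      ≤ 𝓑.card ^ m * 2 ^ Fintype.card (Sym2 (Fin N)) := by
  refine card_labellings_le (fun v i => s(u i, w v)) ?_ 𝓑
  rintro ⟨v, i⟩ ⟨v', i'⟩ h
  simp only [Sym2.eq_iff] at h
  rcases h with ⟨h1, h2⟩ | ⟨h1, -⟩
  · rw [hu h1, hw h2]
  · exact absurd h1 (huw i v')

/-- A random labelling of the pairs of vertices avoids all the given small trace families,
at every scale `s < S` and on every pair of disjoint vertex sets of the prescribed sizes. -/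
theorem exists_edge_labelling {N S : ℕ} (n m D : ℕ → ℕ) (L : ℕ → Type) [∀ s, Fintype (L s)]
    (𝓑 : ∀ s, L s → Finset (Finset (Fin (n s)))) (h𝓑 : ∀ s l, (𝓑 s l).card ≤ D s)
    (hlt : ∀ s < S, S * (N ^ n s * N ^ m s * Fintype.card (L s) * D s ^ m s) < 2 ^ (n s * m s)) :
    ∃ g : Sym2 (Fin N) → Bool, ∀ s < S, ∀ (u : Fin (n s) → Fin N) (w : Fin (m s) → Fin N),
      Function.Injective u → Function.Injective w → (∀ i v, u i ≠ w v) → ∀ l,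
        ∃ v, (Finset.univ.filter fun i => g s(u i, w v) = true) ∉ 𝓑 s l := by
  rcases Nat.eq_zero_or_pos S with rfl | hS
  · exact ⟨fun _ => true, fun s hs => absurd hs (Nat.not_lt_zero s)⟩
  set E := Fintype.card (Sym2 (Fin N))
  let Q : ∀ s, (Fin (n s) → Fin N) × (Fin (m s) → Fin N) × L s → Finset (Sym2 (Fin N) → Bool) :=
    fun s p => if Function.Injective p.1 ∧ Function.Injective p.2.1 ∧ ∀ i v, p.1 i ≠ p.2.1 v then
      Finset.univ.filter fun g : Sym2 (Fin N) → Bool =>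
        ∀ v, (Finset.univ.filter fun i => g s(p.1 i, p.2.1 v) = true) ∈ 𝓑 s p.2.2 else ∅
  have hQ : ∀ s p, (Q s p).card * 2 ^ (n s * m s) ≤ D s ^ m s * 2 ^ E := by
    intro s p
    simp only [Q]
    split_ifs with hp
    · exact (card_bad_labellings_le hp.1 hp.2.1 hp.2.2 _).trans
        (Nat.mul_le_mul_right _ (Nat.pow_le_pow_left (h𝓑 s p.2.2) _))
    · simp
  have hb : ∀ s < S, S * ((Finset.univ : Finset _).biUnion (Q s)).card < 2 ^ E := by
    intro s hs
    refine Nat.lt_of_mul_lt_mul_right (a := 2 ^ (n s * m s)) ?_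
    calc S * ((Finset.univ : Finset _).biUnion (Q s)).card * 2 ^ (n s * m s)
        ≤ S * (∑ p, (Q s p).card) * 2 ^ (n s * m s) := by
          gcongr; exact Finset.card_biUnion_le
      _ = S * ∑ p, (Q s p).card * 2 ^ (n s * m s) := by rw [mul_assoc, Finset.sum_mul]
      _ ≤ S * ∑ p : (Fin (n s) → Fin N) × (Fin (m s) → Fin N) × L s, D s ^ m s * 2 ^ E :=
          Nat.mul_le_mul_left _ (Finset.sum_le_sum fun p _ => hQ s p)
      _ = S * (N ^ n s * N ^ m s * Fintype.card (L s) * D s ^ m s) * 2 ^ E := by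
          simp [Fintype.card_prod]; ring
      _ < 2 ^ (n s * m s) * 2 ^ E := Nat.mul_lt_mul_of_pos_right (hlt s hs) (by positivity)
      _ = _ := mul_comm _ _
  have htot : ((Finset.range S).biUnion fun s => (Finset.univ : Finset _).biUnion (Q s)).card
      < 2 ^ E := by
    refine lt_of_le_of_lt Finset.card_biUnion_le ?_
    refine Nat.lt_of_mul_lt_mul_left (a := S) ?_
    rw [Finset.mul_sum]
    calc _ < ∑ s ∈ Finset.range S, 2 ^ E :=
          Finset.sum_lt_sum_of_nonempty (Finset.nonempty_range_iff.2 hS.ne')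
            fun s hs => hb s (Finset.mem_range.1 hs)
      _ = S * 2 ^ E := by simp
  obtain ⟨g, -, hg⟩ := Finset.exists_mem_notMem_of_card_lt_card
    (t := (Finset.univ : Finset (Sym2 (Fin N) → Bool))) (htot.trans_eq (by
      rw [Finset.card_univ, Fintype.card_fun, Fintype.card_bool]))
  refine ⟨g, fun s hs u w hu hw huw l => ?_⟩
  by_contra! hcon
  refine hg (Finset.mem_biUnion.2 ⟨s, Finset.mem_range.2 hs,
    Finset.mem_biUnion.2 ⟨(u, w, l), Finset.mem_univ _, ?_⟩⟩)
  simp only [Q]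
  rw [if_pos ⟨hu, hw, huw⟩]
  exact Finset.mem_filter.2 ⟨Finset.mem_univ _, hcon⟩

/-- If some trace is not avoidable, a copy inside the first part extends by one vertex. -/
theorem exists_isMonoCopy_succ {V : Type*} {r k n m q t : ℕ} (hr : 0 < r) (hq : 0 < q)
    (ht : t = (2 * r + 1) * ((r + 1) * (r * q))) (hn : n = 12 * t)
    {κ : V → V → Option (Fin r)} {h : Fin k → Fin k → Bool} {a : Fin r → Fin k} {W : Finset V}
    {u : Fin n → V} {w : Fin m → V} (hu : Function.Injective u) (huw : ∀ i v, u i ≠ w v)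
    (huW : ∀ i, u i ∈ W) (hwW : ∀ v, w v ∈ W)
    (hrich : ∀ j : Fin r, ∀ T ⊆ W, q ≤ T.card →
      ∃ φ, IsMonoCopy κ h (a j) j φ ∧ ∀ i < a j, φ i ∈ T)
    (htrace : (Finset.univ.filter fun B : Finset (Fin n) =>
        IsAvoidable (fun x y => κ (u x) (u y)) h a B).card ≤ 2 ^ (6 * t) →
      ∃ v, ¬ IsAvoidable (fun x y => κ (u x) (u y)) h a
        (Finset.univ.filter fun i => (κ (u i) (w v)).isSome = true)) :
    ∃ j φ, IsMonoCopy κ h ((a j).val + 1) j φ ∧ ∀ i : Fin k, i.val < (a j).val + 1 → φ i ∈ W := by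
  have hn0 : 0 < n := by rw [hn, ht]; positivity
  have : Nonempty (Fin n) := ⟨⟨0, hn0⟩⟩
  obtain ⟨v, hv⟩ := htrace <| card_isAvoidable_le hr hq ht (by rw [Fintype.card_fin, hn]) _ h a <| by
    intro j T hT
    obtain ⟨φ, hφ, hφT⟩ := hrich j (T.image u)
      (Finset.image_subset_iff.2 fun x _ => huW x)
      (by rwa [Finset.card_image_of_injective _ hu])
    have hinv : ∀ i < a j, u (Function.invFun u (φ i)) = φ i ∧ Function.invFun u (φ i) ∈ T := by
      intro i hi
      obtain ⟨x, hx, hxi⟩ := Finset.mem_image.1 (hφT i hi)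
      rw [← hxi, Function.leftInverse_invFun hu x]
      exact ⟨rfl, hx⟩
    refine ⟨fun i => Function.invFun u (φ i), fun i i' hii hi' => ?_, fun i hi => (hinv i hi).2⟩
    obtain ⟨h1, h2⟩ := hφ i i' hii hi'
    have e1 := (hinv i (hii.trans hi')).1
    have e2 := (hinv i' hi').1
    refine ⟨fun heq => h1 ?_, ?_⟩
    · rw [← e1, ← e2]; exact congrArg u heq
    · simp only [e1, e2, h2]
  simp only [IsAvoidable, not_exists, not_and, not_forall] at hv
  obtain ⟨j, φ, hφ, hext⟩ := hv (fun i => κ (u i) (w v)) (fun x => by simp)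
  refine ⟨j, Function.update (fun i => u (φ i)) (a j) (w v), fun i i' hii hi' => ?_,
    fun i _ => ?_⟩
  · have hi'' : i' ≤ a j := Nat.lt_succ_iff.1 hi'
    have hi : i < a j := lt_of_lt_of_le hii hi''
    rw [Function.update_of_ne hi.ne]
    rcases hi''.lt_or_eq with hlt | rfl
    · rw [Function.update_of_ne hlt.ne]
      obtain ⟨h1, h2⟩ := hφ i i' hii hlt
      exact ⟨fun heq => h1 (hu heq), h2⟩
    · rw [Function.update_self]
      exact ⟨huw _ _, not_not.1 (hext i hi)⟩
  · by_cases hi : i = a j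
    · rw [hi, Function.update_self]; exact hwW v
    · rw [Function.update_of_ne hi]; exact huW _

/-- A set of at least `n + m` elements contains disjoint sets of sizes `n` and `m`. -/
theorem Finset.exists_disjoint_injective {V : Type*} {W : Finset V} {n m : ℕ}
    (hW : n + m ≤ W.card) :
    ∃ (u : Fin n → V) (w : Fin m → V), Function.Injective u ∧ Function.Injective w ∧
      (∀ i v, u i ≠ w v) ∧ (∀ i, u i ∈ W) ∧ ∀ v, w v ∈ W := by
  let f : Fin (n + m) → V := fun x => (W.equivFin.symm (Fin.castLE hW x)).1
  have hf : Function.Injective f := fun x y hxy => by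
    simpa [f, Subtype.ext_iff] using hxy
  refine ⟨fun i => f (Fin.castAdd m i), fun v => f (Fin.natAdd n v), ?_, ?_, ?_,
    fun i => Subtype.prop _, fun v => Subtype.prop _⟩
  · exact hf.comp (Fin.castAdd_injective n m)
  · exact hf.comp (Fin.natAdd_injective m n)
  · intro i v heq
    have := congrArg Fin.val (hf heq)
    simp only [Fin.val_castAdd, Fin.val_natAdd] at this
    omega

/-- By induction on the total size, every set of at least `q s` vertices contains a copy of the
first `size j` vertices of `h` in some colour `j`, when the sizes sum to `s`. -/
theorem exists_isMonoCopy {V : Type*} {r k S : ℕ} (hr : 0 < r) {q t n m : ℕ → ℕ}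
    (hq : ∀ s, 0 < q s) (ht : ∀ s, t s = (2 * r + 1) * ((r + 1) * (r * q s)))
    (hn : ∀ s, n s = 12 * t s) (hnm : ∀ s, n s + m s ≤ q (s + 1))
    {κ : V → V → Option (Fin r)} {h : Fin k → Fin k → Bool}
    (htrace : ∀ s < S, ∀ (u : Fin (n s) → V) (w : Fin (m s) → V),
      Function.Injective u → Function.Injective w → (∀ i v, u i ≠ w v) → ∀ a : Fin r → Fin k,
      (Finset.univ.filter fun B : Finset (Fin (n s)) =>
        IsAvoidable (fun x y => κ (u x) (u y)) h a B).card ≤ 2 ^ (6 * t s) →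
      ∃ v, ¬ IsAvoidable (fun x y => κ (u x) (u y)) h a
        (Finset.univ.filter fun i => (κ (u i) (w v)).isSome = true))
    {s : ℕ} (hs : s ≤ S) (size : Fin r → ℕ) (hsize : ∀ j, size j ≤ k) (hsum : ∑ j, size j = s)
    (W : Finset V) (hW : q s ≤ W.card) :
    ∃ j φ, IsMonoCopy κ h (size j) j φ ∧ ∀ i : Fin k, i.val < size j → φ i ∈ W := by
  induction s generalizing size W with
  | zero =>
    obtain ⟨x, -⟩ := Finset.card_pos.1 ((hq 0).trans_le hW)
    have h0 : size ⟨0, hr⟩ = 0 := Finset.sum_eq_zero_iff.1 hsum _ (Finset.mem_univ _)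
    refine ⟨⟨0, hr⟩, fun _ => x, ?_, ?_⟩
    · intro i i' _ hi'
      omega
    · intro i hi
      omega
  | succ s ih =>
    by_cases hz : ∃ j, size j = 0
    · obtain ⟨j, hj⟩ := hz
      obtain ⟨x, -⟩ := Finset.card_pos.1 ((hq _).trans_le hW)
      refine ⟨j, fun _ => x, ?_, ?_⟩
      · intro i i' _ hi'
        omega
      · intro i hi
        omega
    push Not at hz
    by_contra hcon
    obtain ⟨u, w, hu, hw, huw, huW, hwW⟩ := Finset.exists_disjoint_injective ((hnm s).trans hW)
    let a : Fin r → Fin k := fun j => ⟨size j - 1, by have := hz j; have := hsize j; omega⟩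
    have ha : ∀ j, (a j).val + 1 = size j := fun j => Nat.sub_add_cancel (Nat.pos_of_ne_zero (hz j))
    have hrich : ∀ j : Fin r, ∀ T ⊆ W, q s ≤ T.card →
        ∃ φ, IsMonoCopy κ h (a j) j φ ∧ ∀ i < a j, φ i ∈ T := by
      intro j T hTW hT
      obtain ⟨j', φ, hφ, hφT⟩ := ih (Nat.le_of_succ_le hs) (Function.update size j (a j).val)
        (fun i => by
          by_cases hi : i = j
          · rw [hi, Function.update_self]; exact (a j).2.le
          · rw [Function.update_of_ne hi]; exact hsize i)
        (by
          have h1 := Finset.sum_update_of_mem (Finset.mem_univ j) size (a j).val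
          have h2 := Finset.sum_sdiff (f := size) (Finset.subset_univ {j})
          rw [Finset.sum_singleton] at h2
          have := ha j
          omega) T hT
      by_cases hj : j' = j
      · subst hj
        rw [Function.update_self] at hφ hφT
        exact ⟨φ, hφ, hφT⟩
      · rw [Function.update_of_ne hj] at hφ hφT
        exact absurd ⟨j', φ, hφ, fun i hi => hTW (hφT i hi)⟩ hcon
    obtain ⟨j, φ, hφ⟩ := exists_isMonoCopy_succ hr (hq s) (ht s) (hn s) hu huw huW hwW hrich
      (htrace s hs u w hu hw huw a)
    rw [ha] at hφ
    exact hcon ⟨j, φ, hφ⟩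

theorem labelling_count_lt {r k t M : ℕ} (hr : 2 ≤ r) (hk : k ≤ 12 * t) (hrt : r ≤ 12 * t)
    (hM : 4 * M ≤ 12 * t) :
    r * k * ((2 ^ M) ^ (12 * t) * (2 ^ M) ^ (100 * r * (12 * t)) *
      (((r + 1) ^ (12 * t)) ^ (12 * t) * ((2 ^ k) ^ k * k ^ r)) *
      (2 ^ (6 * t)) ^ (100 * r * (12 * t))) < 2 ^ (12 * t * (100 * r * (12 * t))) := by
  have ht : 0 < t := by omega
  have h1 : r * k ≤ 2 ^ (12 * t * (12 * t)) :=
    (Nat.mul_le_mul hrt hk).trans Nat.lt_two_pow_self.le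
  have h2 : ((r + 1) ^ (12 * t)) ^ (12 * t) ≤ 2 ^ (r * (12 * t * (12 * t))) := by
    rw [← pow_mul, pow_mul 2]
    exact Nat.pow_le_pow_left Nat.lt_two_pow_self _
  have h3 : (2 ^ k) ^ k ≤ 2 ^ (12 * t * (12 * t)) := by
    rw [← pow_mul]
    exact Nat.pow_le_pow_right (by norm_num) (Nat.mul_le_mul hk hk)
  have h4 : k ^ r ≤ 2 ^ (12 * t * (12 * t)) := by
    refine (Nat.pow_le_pow_left (Nat.lt_two_pow_self (n := k)).le r).trans ?_
    rw [← pow_mul]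
    exact Nat.pow_le_pow_right (by norm_num) (Nat.mul_le_mul hk hrt)
  calc _ ≤ 2 ^ (12 * t * (12 * t)) * ((2 ^ M) ^ (12 * t) * (2 ^ M) ^ (100 * r * (12 * t)) *
        (2 ^ (r * (12 * t * (12 * t))) * (2 ^ (12 * t * (12 * t)) * 2 ^ (12 * t * (12 * t)))) *
      (2 ^ (6 * t)) ^ (100 * r * (12 * t))) := by gcongr
    _ = 2 ^ (3 * (12 * t * (12 * t)) + M * (12 * t) + M * (100 * r * (12 * t))
          + r * (12 * t * (12 * t)) + 6 * t * (100 * r * (12 * t))) := by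
        simp only [← pow_mul, ← pow_add]; congr 1; ring
    _ < _ := by
        refine Nat.pow_lt_pow_right (by norm_num) ?_
        have hM' : M ≤ 3 * t := by omega
        have h5 : M * (12 * t) ≤ 3 * t * (12 * t) := Nat.mul_le_mul_right _ hM'
        have h6 : M * (100 * r * (12 * t)) ≤ 3 * t * (100 * r * (12 * t)) :=
          Nat.mul_le_mul_right _ hM'
        have h7 : 2 * (t * t) ≤ r * (t * t) := Nat.mul_le_mul_right _ hr
        have h8 : 0 < t * t := Nat.mul_pos ht ht
        nlinarith

theorem scale_growth {r : ℕ} (hr : 2 ≤ r) :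
    12 * ((2 * r + 1) * ((r + 1) * r)) * (1 + 100 * r) ≤ r ^ 20 := by
  have h1 : 2 * r + 1 ≤ r ^ 3 := by nlinarith [pow_succ r 2, pow_succ r 1]
  have h2 : r + 1 ≤ r ^ 2 := by nlinarith
  have h3 : 1 + 100 * r ≤ 2 ^ 7 * r := by omega
  have h4 : 12 * 2 ^ 7 ≤ r ^ 11 := le_trans (by norm_num) (Nat.pow_le_pow_left hr 11)
  calc _ ≤ 12 * (r ^ 3 * (r ^ 2 * r)) * (2 ^ 7 * r) := by gcongr
    _ = 12 * 2 ^ 7 * r ^ 7 := by ring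
    _ ≤ r ^ 11 * r ^ 7 := by gcongr
    _ = r ^ 18 := by ring
    _ ≤ r ^ 20 := Nat.pow_le_pow_right (by omega) (by norm_num)

theorem final_scale_le {r l y : ℕ} (hl : r ≤ 2 ^ l) (hy : 2 ≤ y) {z : ℕ} (hz : l * z = y) :
    4 * (32 * y) * r ^ (20 * z) ≤ 2 ^ (32 * y) := by
  calc 4 * (32 * y) * r ^ (20 * z) ≤ 4 * (32 * 2 ^ y) * (2 ^ l) ^ (20 * z) := by
        gcongr; exact Nat.lt_two_pow_self.le
    _ = 2 ^ (7 + 21 * y) := by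
        rw [← hz, ← pow_mul, pow_add, show 21 * (l * z) = l * z + l * (20 * z) by ring, pow_add]
        ring
    _ ≤ 2 ^ (32 * y) := Nat.pow_le_pow_right (by norm_num) (by omega)

theorem hasMonoInducedCopy_of_isMonoCopy {n k r : ℕ} {G : SimpleGraph (Fin n)}
    {H : SimpleGraph (Fin k)} {c : Sym2 (Fin n) → Fin r} {j : Fin r} {φ : Fin k → Fin n}
    [DecidableRel G.Adj] (hφ : IsMonoCopy (fun x y => if G.Adj x y then some (c s(x, y)) else none)
      (fun i i' => decide (H.Adj i i')) k j φ) : HasMonoInducedCopy G H c := by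
  have hinj : Function.Injective φ := fun i i' => hφ.injOn i.2 i'.2
  have hlt : ∀ i i', i < i' → (G.Adj (φ i) (φ i') ↔ H.Adj i i') ∧
      (G.Adj (φ i) (φ i') → c s(φ i, φ i') = j) := by
    intro i i' hii
    have h := (hφ i i' hii i'.2).2
    by_cases h1 : G.Adj (φ i) (φ i') <;> by_cases h2 : H.Adj i i' <;> simp_all
  have hall : ∀ i i', (G.Adj (φ i) (φ i') ↔ H.Adj i i') ∧
      (G.Adj (φ i) (φ i') → c s(φ i, φ i') = j) := by
    intro i i'
    rcases lt_trichotomy i i' with h | rfl | h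
    · exact hlt i i' h
    · simp
    · rw [G.adj_comm, H.adj_comm, Sym2.eq_swap]
      exact hlt i' i h
  refine ⟨Finset.univ.image φ, j, ⟨⟨(Equiv.ofInjective φ hinj).trans
    (Equiv.setCongr (by simp)), fun {i i'} => (hall i i').1⟩⟩, ?_⟩
  intro x hx y hy
  obtain ⟨i, -, rfl⟩ := Finset.mem_image.1 hx
  obtain ⟨i', -, rfl⟩ := Finset.mem_image.1 hy
  exact (hall i i').2

/-- A graph on `2 ^ M` vertices that hosts monochromatic induced copies of all graphs on `k`
vertices, for `M` large. -/
theorem exists_universal_host {r k M : ℕ} (hr : 2 ≤ r) (hkM : k ≤ M) (hrM : r ≤ M)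
    (hM : 4 * M * r ^ (20 * (r * k)) ≤ 2 ^ M) :
    ∃ G : SimpleGraph (Fin (2 ^ M)), ∀ (H : SimpleGraph (Fin k)) (c : Sym2 (Fin (2 ^ M)) → Fin r),
      HasMonoInducedCopy G H c := by
  let q : ℕ → ℕ := fun s => 4 * M * r ^ (20 * s)
  let t : ℕ → ℕ := fun s => (2 * r + 1) * ((r + 1) * (r * q s))
  have hq : ∀ s, 0 < q s := fun s => by
    have : 0 < M := by omega
    positivity
  have hqt : ∀ s, q s ≤ t s := fun s => by
    have h1 : 0 < (2 * r + 1) * ((r + 1) * r) := by positivity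
    calc q s ≤ ((2 * r + 1) * ((r + 1) * r)) * q s := Nat.le_mul_of_pos_left _ h1
      _ = t s := by simp only [t]; ring
  have hMq : ∀ s, 4 * M ≤ 12 * t s := fun s => by
    have : 4 * M ≤ q s := Nat.le_mul_of_pos_right _ (by positivity)
    have := hqt s
    omega
  obtain ⟨g, hg⟩ := exists_edge_labelling (N := 2 ^ M) (S := r * k) (fun s => 12 * t s)
    (fun s => 100 * r * (12 * t s)) (fun s => 2 ^ (6 * t s))
    (fun s => (Fin (12 * t s) → Fin (12 * t s) → Option (Fin r)) ×
      (Fin k → Fin k → Bool) × (Fin r → Fin k))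
    (fun s l =>
      if (Finset.univ.filter fun B => IsAvoidable l.1 l.2.1 l.2.2 B).card ≤ 2 ^ (6 * t s)
      then Finset.univ.filter fun B => IsAvoidable l.1 l.2.1 l.2.2 B else ∅)
    (fun s l => by
      split_ifs with h
      · exact h
      · simp)
    (fun s _ => by
      have := labelling_count_lt (k := k) (t := t s) hr (by have := hMq s; omega)
        (by have := hMq s; omega) (hMq s)
      simp only [Fintype.card_prod, Fintype.card_fun, Fintype.card_fin, Fintype.card_bool,
        Fintype.card_option]
      exact this)
  let G : SimpleGraph (Fin (2 ^ M)) :=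
    { Adj := fun x y => x ≠ y ∧ g s(x, y) = true
      symm := ⟨fun x y hxy => ⟨hxy.1.symm, by rw [Sym2.eq_swap]; exact hxy.2⟩⟩
      loopless := ⟨fun x hx => hx.1 rfl⟩ }
  refine ⟨G, fun H c => ?_⟩
  obtain ⟨j, φ, hφ, -⟩ := exists_isMonoCopy (V := Fin (2 ^ M)) (k := k) (S := r * k) (by omega) hq
    (fun _ => rfl) (n := fun s => 12 * t s) (m := fun s => 100 * r * (12 * t s)) (fun _ => rfl)
    (fun s => by
      calc 12 * t s + 100 * r * (12 * t s)
          = 12 * ((2 * r + 1) * ((r + 1) * r)) * (1 + 100 * r) * q s := by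
            simp only [t]; ring
        _ ≤ r ^ 20 * q s := Nat.mul_le_mul_right _ (scale_growth hr)
        _ = q (s + 1) := by simp only [q]; ring)
    (κ := fun x y => if G.Adj x y then some (c s(x, y)) else none)
    (h := fun i i' => decide (H.Adj i i'))
    (fun s hs u w hu hw huw a hcard => by
      obtain ⟨v, hv⟩ := hg s hs u w hu hw huw
        (fun x y => if G.Adj (u x) (u y) then some (c s(u x, u y)) else none,
          fun i i' => decide (H.Adj i i'), a)
      refine ⟨v, fun hav => hv ?_⟩
      rw [if_pos hcard]
      refine Finset.mem_filter.2 ⟨Finset.mem_univ _, ?_⟩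
      convert hav using 3 with i
      by_cases hgi : g s(u i, w v) = true <;> simp [G, huw i v, hgi])
    le_rfl (fun _ => k) (fun _ => le_rfl) (by simp) Finset.univ
    (by rw [Finset.card_univ, Fintype.card_fin]; exact hM)
  exact hasMonoInducedCopy_of_isMonoCopy hφ

/-- There is a constant `C > 0` such that, for every `r ≥ 2` and `k ≥ 1`, there is a single
graph `G` with at most `r^{Crk}` vertices such that for every graph `H` on `k` vertices and
every `r`-colouring of the edges of `G`, there is a monochromatic induced copy of `H`. -/
theorem induced_ramsey_universal_host :
    ∃ C : ℝ, 0 < C ∧ ∀ r : ℕ, 2 ≤ r → ∀ k : ℕ, 1 ≤ k →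
      ∃ N : ℕ, (N : ℝ) ≤ (r : ℝ) ^ (C * (r : ℝ) * (k : ℝ)) ∧
        ∃ G : SimpleGraph (Fin N),
          ∀ H : SimpleGraph (Fin k), ∀ c : Sym2 (Fin N) → Fin r,
            HasMonoInducedCopy G H c := by
  refine ⟨64, by norm_num, fun r hr k hk => ?_⟩
  have hl1 : r ≤ 2 ^ Nat.clog 2 r := Nat.le_pow_clog (by norm_num) r
  have hl2 : 2 ^ Nat.clog 2 r ≤ r ^ 2 := by
    have h := Nat.pow_pred_clog_lt_self (b := 2) (by norm_num) (x := r) (by omega)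
    have hpos : 0 < Nat.clog 2 r := Nat.clog_pos (by norm_num) hr
    calc 2 ^ Nat.clog 2 r = 2 * 2 ^ (Nat.clog 2 r).pred := by
          rw [← pow_succ', ← Nat.succ_eq_add_one, Nat.succ_pred_eq_of_pos hpos]
      _ ≤ r * r := Nat.mul_le_mul hr h.le
      _ = r ^ 2 := (sq r).symm
  have hpos : 0 < Nat.clog 2 r := Nat.clog_pos (by norm_num) hr
  set l := Nat.clog 2 r
  have hrk : r * k ≤ l * (r * k) := Nat.le_mul_of_pos_left _ hpos
  have hrrk : r ≤ r * k := Nat.le_mul_of_pos_right _ hk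
  have hkrk : k ≤ r * k := Nat.le_mul_of_pos_left _ (by omega)
  refine ⟨2 ^ (32 * (l * (r * k))), ?_, exists_universal_host hr (by omega) (by omega)
    (final_scale_le hl1 (by omega) rfl)⟩
  have hN : 2 ^ (32 * (l * (r * k))) ≤ r ^ (64 * r * k) := by
    calc 2 ^ (32 * (l * (r * k))) = (2 ^ l) ^ (32 * (r * k)) := by rw [← pow_mul]; congr 1; ring
      _ ≤ (r ^ 2) ^ (32 * (r * k)) := Nat.pow_le_pow_left hl2 _
      _ = r ^ (64 * r * k) := by rw [← pow_mul]; congr 1; ring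
  calc ((2 ^ (32 * (l * (r * k))) : ℕ) : ℝ) ≤ ((r ^ (64 * r * k) : ℕ) : ℝ) := by exact_mod_cast hN
    _ = (r : ℝ) ^ ((64 : ℝ) * r * k) := by
      rw [Nat.cast_pow, ← Real.rpow_natCast]
      push_cast
      rfl
end
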